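/- Let n ≥ 2 and let E = E(r_1,…,r_n) ⊂ ℝ^{2n} be the open ellipsoid with symplectic half axes 1 = r_1 ≤ … ≤ r_n = R, where at least two of the half axes are different and R < 2^{1/(2n)}. For ε ∈ (0,1) set U_ε = (1+ε)E \ closure((1−ε)E) and ε₀ = (R−1)/(R+1). Then for every ε ∈ (0, ε₀] one has s(U_ε) ≤ ((1+ε)^{2n} − (1−ε)^{2n})^{1/n} · πR². -/

import Mathlib

open Metric Set MeasureTheory Real Filter Topology Bornology
open scoped ContDiff ENNReal

noncomputable section

/-- `ℝ^{2n}` with the Euclidean structure. -/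
abbrev R2n (n : ℕ) := EuclideanSpace ℝ (Fin (2 * n))

/-- The standard symplectic form `ω_st = Σ dx_i ∧ dy_i` on `ℝ^{2n}`,
evaluated on a pair of (tangent) vectors. -/
def sympForm (n : ℕ) (v w : R2n n) : ℝ :=
  ∑ i : Fin n,
    (v ⟨2 * i.1, by have := i.isLt; omega⟩ * w ⟨2 * i.1 + 1, by have := i.isLt; omega⟩ -
      v ⟨2 * i.1 + 1, by have := i.isLt; omega⟩ * w ⟨2 * i.1, by have := i.isLt; omega⟩)

/-- `φ` is a symplectic embedding of the open set `N ⊆ ℝ^{2n}` into `U ⊆ ℝ^{2n}`: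
a smooth injective map on `N` with image in `U` whose derivative preserves `ω_st`. -/
def IsSympEmbOn (n : ℕ) (N U : Set (R2n n)) (φ : R2n n → R2n n) : Prop :=
  IsOpen N ∧ ContDiffOn ℝ ∞ φ N ∧ InjOn φ N ∧ MapsTo φ N U ∧
    ∀ p ∈ N, ∀ v w : R2n n,
      sympForm n (fderiv ℝ φ p v) (fderiv ℝ φ p w) = sympForm n v w

/-- A symplectic embedding of (a neighbourhood of) an arbitrary set `A ⊆ ℝ^{2n}` into `U`. -/
def SympEmbNbhd (n : ℕ) (A U : Set (R2n n)) : Prop :=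
  ∃ N φ, A ⊆ N ∧ IsSympEmbOn n N U φ

/-- The spherical capacity `s(U)`. -/
def sphericalCap (n : ℕ) (U : Set (R2n n)) : ℝ≥0∞ :=
  sSup {c : ℝ≥0∞ | ∃ r : ℝ, 0 < r ∧ c = ENNReal.ofReal (π * r ^ 2) ∧
    SympEmbNbhd n (sphere (0 : R2n n) r) U}

/-- The quadratic form defining the ellipsoid with symplectic half axes `a i`. -/
def ellQ (n : ℕ) (a : Fin n → ℝ) (z : R2n n) : ℝ :=
  ∑ i : Fin n,
    ((z ⟨2 * i.1, by have := i.isLt; omega⟩) ^ 2 +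
      (z ⟨2 * i.1 + 1, by have := i.isLt; omega⟩) ^ 2) / (a i) ^ 2

/-- The open ellipsoid `E(a 0, …, a (n-1)) ⊆ ℝ^{2n}`. -/
def ellipsoid (n : ℕ) (a : Fin n → ℝ) : Set (R2n n) := {z | ellQ n a z < 1}

/-- The boundary `∂E(a 0, …, a (n-1)) ⊆ ℝ^{2n}` of an ellipsoid. -/
def ellipsoidBdry (n : ℕ) (a : Fin n → ℝ) : Set (R2n n) := {z | ellQ n a z = 1}

/-- The ellipsoidal shell `U_ε = (1+ε)E \ closure((1-ε)E)`. -/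
def ellShell (n : ℕ) (a : Fin n → ℝ) (ε : ℝ) : Set (R2n n) :=
  ellipsoid n (fun i => (1 + ε) * a i) \ closure (ellipsoid n (fun i => (1 - ε) * a i))

/-- The `δ`-shell capacity `c_δ(U)`, defined via embeddings of the closed
shells `r A_δ = closure(B_r) \ B_{r(1-δ)}`. -/
def shellCap (n : ℕ) (δ : ℝ) (U : Set (R2n n)) : ℝ≥0∞ :=
  sSup {c : ℝ≥0∞ | ∃ r : ℝ, 0 < r ∧ c = ENNReal.ofReal (π * r ^ 2) ∧
    SympEmbNbhd n (closedBall (0 : R2n n) r \ ball 0 (r * (1 - δ))) U}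

/-- The ellipsoidal capacity `e(U)`: the supremum of `π r₁²` over symplectic embeddings of
boundaries of ellipsoids with half axes `r₁ ≤ … ≤ r_n` (here `r₁ = ⨅ i, a i`). -/
def ellipsoidalCap (n : ℕ) (U : Set (R2n n)) : ℝ≥0∞ :=
  sSup {c : ℝ≥0∞ | ∃ a : Fin n → ℝ, (∀ i, 0 < a i) ∧ Monotone a ∧
    c = ENNReal.ofReal (π * (⨅ i, a i) ^ 2) ∧ SympEmbNbhd n (ellipsoidBdry n a) U}

/-- The Gromov radius `c_B(U)`. -/
def gromovRadius (n : ℕ) (U : Set (R2n n)) : ℝ≥0∞ :=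
  sSup {c : ℝ≥0∞ | ∃ r : ℝ, 0 < r ∧ c = ENNReal.ofReal (π * r ^ 2) ∧
    ∃ φ, IsSympEmbOn n (ball (0 : R2n n) r) U φ}

set_option linter.unusedSectionVars false

theorem det_one_add_pos {E : Type*} [NormedAddCommGroup E] [NormedSpace ℝ E]
    [FiniteDimensional ℝ E] (A : E →L[ℝ] E) (hA : ‖A‖ < 1) :
    0 < (ContinuousLinearMap.id ℝ E + A).det := by
  have hne : ∀ s ∈ Icc (0 : ℝ) 1, (ContinuousLinearMap.id ℝ E + s • A).det ≠ 0 := by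
    intro s hs h
    have hlt : ‖-(s • A)‖ < 1 := by
      rw [norm_neg, norm_smul, Real.norm_eq_abs, abs_of_nonneg hs.1]
      nlinarith [norm_nonneg A, hs.2]
    have hu : IsUnit (1 - (-(s • A))) := isUnit_one_sub_of_norm_lt_one hlt
    rw [sub_neg_eq_add] at hu
    have h2 : IsUnit ((1 + s • A : E →L[ℝ] E) : E →ₗ[ℝ] E) :=
      hu.map (ContinuousLinearMap.toLinearMapRingHom : (E →L[ℝ] E) →+* (E →ₗ[ℝ] E))
    exact (LinearMap.isUnit_iff_isUnit_det _).1 h2 |>.ne_zero h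
  have hcont : Continuous fun s : ℝ => (ContinuousLinearMap.id ℝ E + s • A).det :=
    ContinuousLinearMap.continuous_det.comp (by fun_prop)
  by_contra hneg
  push Not at hneg
  have h0 : (0 : ℝ) ∈ (fun s : ℝ => (ContinuousLinearMap.id ℝ E + s • A).det) '' Icc 0 1 := by
    apply intermediate_value_Icc' zero_le_one hcont.continuousOn
    constructor
    · simpa using hneg
    · simp [ContinuousLinearMap.det]
  obtain ⟨s, hs, h⟩ := h0
  exact hne s hs h

theorem exists_polynomial_det {E : Type*} [NormedAddCommGroup E] [NormedSpace ℝ E]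
    [FiniteDimensional ℝ E] (A : E →L[ℝ] E) :
    ∃ p : Polynomial ℝ, p.natDegree ≤ Module.finrank ℝ E ∧
      ∀ t : ℝ, p.eval t = (ContinuousLinearMap.id ℝ E + t • A).det := by
  let b := Module.finBasis ℝ E
  let M := LinearMap.toMatrix b b (A : E →ₗ[ℝ] E)
  refine ⟨_, (Polynomial.natDegree_det_X_add_C_le M 1).trans (by simp), fun t => ?_⟩
  have h1 : (ContinuousLinearMap.id ℝ E + t • A).det
      = (LinearMap.toMatrix b b
        ((ContinuousLinearMap.id ℝ E + t • A : E →L[ℝ] E) : E →ₗ[ℝ] E)).det := by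
    rw [LinearMap.det_toMatrix]
  rw [h1, ← Polynomial.coe_evalRingHom, RingHom.map_det]
  congr 1
  have : ((ContinuousLinearMap.id ℝ E + t • A : E →L[ℝ] E) : E →ₗ[ℝ] E)
      = LinearMap.id + t • (A : E →ₗ[ℝ] E) := by ext; simp
  rw [this, map_add (LinearMap.toMatrix b b), map_smul (LinearMap.toMatrix b b),
    LinearMap.toMatrix_id]
  ext i j
  by_cases hij : i = j <;> simp [M, hij] <;> ring

theorem integral_det_fderiv_eq_volume_of_fix_sphere {E : Type*} [NormedAddCommGroup E]
    [NormedSpace ℝ E] [FiniteDimensional ℝ E] [MeasurableSpace E] [BorelSpace E]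
    (μ : Measure E) [μ.IsAddHaarMeasure] {F : E → E} (hF : ContDiff ℝ 1 F) {R : ℝ}
    (hfix : ∀ x, ‖x‖ = R → F x = x) :
    ∫ x in ball (0 : E) R, (fderiv ℝ F x).det ∂μ = μ.real (ball 0 R) := by
  set w : E → E := fun x => F x - x with hw
  have hwC : ContDiff ℝ 1 w := hF.sub contDiff_id
  have hFd : Differentiable ℝ F := hF.differentiable one_ne_zero
  have hwd : Differentiable ℝ w := hwC.differentiable one_ne_zero
  obtain ⟨L, hL⟩ := hwC.contDiffOn.exists_lipschitzOnWith (s := closedBall (0 : E) R) one_ne_zero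
    (convex_closedBall _ _) (isCompact_closedBall _ _)
  have hfd : ∀ x ∈ ball (0 : E) R, ‖fderiv ℝ w x‖ ≤ L := fun x hx =>
    norm_fderiv_le_of_lipschitzOn ℝ (mem_of_superset (isOpen_ball.mem_nhds hx) ball_subset_closedBall) hL
  classical
  set v : E → E := fun x => if ‖x‖ ≤ R then w x else 0 with hv
  have hvL1 : ∀ x y, ‖x‖ ≤ R → ¬ ‖y‖ ≤ R → ‖v x - v y‖ ≤ L * ‖x - y‖ := by
    intro x y hx hy
    push Not at hy
    have hc : Continuous fun s : ℝ => ‖x + s • (y - x)‖ := by fun_prop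
    obtain ⟨s, hs, h⟩ := intermediate_value_Icc zero_le_one hc.continuousOn
      (show R ∈ Icc _ _ by simp [hx, hy.le])
    set z := x + s • (y - x)
    have hz : w z = 0 := by simp only [hw, hfix z h, sub_self]
    have := hL.dist_le_mul x (by simpa using hx) z (by simpa using h.le)
    rw [dist_eq_norm, dist_eq_norm, hz] at this
    simp only [hv, hx, if_true, hy.not_ge, if_false]
    refine this.trans (mul_le_mul_of_nonneg_left ?_ L.2)
    have : x - z = s • (x - y) := by simp only [z]; module
    rw [this, norm_smul, Real.norm_eq_abs, abs_of_nonneg hs.1]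
    nlinarith [norm_nonneg (x - y), hs.2]
  have hvL : ∀ x y, ‖v x - v y‖ ≤ L * ‖x - y‖ := by
    intro x y
    by_cases hx : ‖x‖ ≤ R <;> by_cases hy : ‖y‖ ≤ R
    · simpa [hv, hx, hy, dist_eq_norm] using
        hL.dist_le_mul x (by simpa using hx) y (by simpa using hy)
    · exact hvL1 x y hx hy
    · rw [norm_sub_rev, norm_sub_rev x]; exact hvL1 y x hy hx
    · simp [hv, hx, hy]; positivity
  have hlip : ∀ t ∈ Icc (0 : ℝ) (1 / (2 * (L + 1))), t * L < 1 := by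
    intro t ht
    have hLp : (0 : ℝ) < 2 * (L + 1) := by positivity
    have := (le_div_iff₀ hLp).1 ht.2
    nlinarith [ht.1, L.2]
  have hsmall : ∀ t ∈ Icc (0 : ℝ) (1 / (2 * (L + 1))),
      ∫ x in ball (0 : E) R, (ContinuousLinearMap.id ℝ E + t • fderiv ℝ w x).det ∂μ
        = μ.real (ball 0 R) := by
    intro t ht
    have htL := hlip t ht
    set f : E → E := fun x => x + t • w x with hf
    set g : E → E := fun x => x + t • v x with hg
    have hfg : ∀ x, ‖x‖ ≤ R → f x = g x := fun x hx => by simp [hf, hg, hv, hx]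
    have hginj : Function.Injective g := by
      intro x y hxy
      have h1 : x - y = t • (v y - v x) := by
        simp only [hg] at hxy
        rw [smul_sub, sub_eq_sub_iff_add_eq_add, hxy, add_comm]
      have h2 : ‖x - y‖ ≤ t * (L * ‖x - y‖) := by
        conv_lhs => rw [h1]
        rw [norm_smul, Real.norm_eq_abs, abs_of_nonneg ht.1, norm_sub_rev x y]
        exact mul_le_mul_of_nonneg_left (hvL y x) ht.1
      have : ‖x - y‖ = 0 := by nlinarith [norm_nonneg (x - y)]
      exact sub_eq_zero.1 (norm_eq_zero.1 this)
    have hgsurj : Function.Surjective g := by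
      intro y
      have hK : ContractingWith ⟨t * L, mul_nonneg ht.1 L.2⟩ (fun x => y - t • v x) := by
        refine ⟨by exact_mod_cast htL, LipschitzWith.of_dist_le_mul fun a b => ?_⟩
        rw [dist_eq_norm, dist_eq_norm, sub_sub_sub_cancel_left, ← smul_sub, norm_smul,
          Real.norm_eq_abs, abs_of_nonneg ht.1, norm_sub_rev a b]
        exact (mul_le_mul_of_nonneg_left (hvL b a) ht.1).trans_eq (mul_assoc _ _ _).symm
      refine ⟨hK.fixedPoint _, ?_⟩
      have := hK.fixedPoint_isFixedPt
      simp only [Function.IsFixedPt] at this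
      simp only [hg]
      nth_rewrite 1 [← this]
      abel
    have hgout : ∀ x, R ≤ ‖x‖ → g x = x := by
      intro x hx
      rcases hx.lt_or_eq with h | h
      · simp [hg, hv, h.not_ge]
      · simp [hg, hv, ← h, hw, hfix x h.symm]
    have himg : f '' ball 0 R = ball 0 R := by
      have : f '' ball 0 R = g '' ball 0 R :=
        image_congr fun x hx => hfg x (by simpa using (mem_ball_zero_iff.1 hx).le)
      rw [this]
      ext y
      constructor
      · rintro ⟨x, hx, rfl⟩
        by_contra hcon
        have hge : R ≤ ‖g x‖ := by simpa using hcon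
        have : g x = x := hginj (hgout _ hge)
        rw [this] at hge
        exact absurd (mem_ball_zero_iff.1 hx) hge.not_gt
      · intro hy
        obtain ⟨x, rfl⟩ := hgsurj y
        refine ⟨x, ?_, rfl⟩
        by_contra hcon
        have hge : R ≤ ‖x‖ := by simpa using hcon
        rw [hgout x hge] at hy
        exact hcon hy
    have hinj : InjOn f (ball 0 R) := by
      intro x hx y hy hxy
      rw [hfg x (mem_ball_zero_iff.1 hx).le, hfg y (mem_ball_zero_iff.1 hy).le] at hxy
      exact hginj hxy
    have hder : ∀ x ∈ ball (0 : E) R, HasFDerivWithinAt f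
        (ContinuousLinearMap.id ℝ E + t • fderiv ℝ w x) (ball 0 R) x := fun x _ =>
      ((hasFDerivAt_id x).add ((hwd x).hasFDerivAt.const_smul t)).hasFDerivWithinAt
    have key := integral_image_eq_integral_abs_det_fderiv_smul μ measurableSet_ball hder hinj
      (fun _ => (1 : ℝ))
    rw [himg] at key
    rw [setIntegral_const, smul_eq_mul, mul_one] at key
    rw [key]
    refine setIntegral_congr_fun measurableSet_ball fun x hx => ?_
    have : 0 < (ContinuousLinearMap.id ℝ E + t • fderiv ℝ w x).det := by
      apply det_one_add_pos
      rw [norm_smul, Real.norm_eq_abs, abs_of_nonneg ht.1]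
      exact (mul_le_mul_of_nonneg_left (hfd x hx) ht.1).trans_lt htL
    simp [abs_of_pos this]
  -- interpolation
  set d := Module.finrank ℝ E
  set t0 : ℝ := 1 / (2 * (L + 1)) with ht0
  have ht0p : 0 < t0 := by positivity
  let node : ℕ → ℝ := fun j => t0 / (j + 1)
  have hnode : ∀ j, node j ∈ Icc (0 : ℝ) t0 := fun j =>
    ⟨by positivity, div_le_self ht0p.le (by linarith [(Nat.cast_nonneg j : (0 : ℝ) ≤ j)])⟩
  have hninj : InjOn node (Finset.range (d + 1) : Set ℕ) := by
    intro i _ j _ h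
    simp only [node] at h
    have hi : (i : ℝ) + 1 ≠ 0 := by positivity
    have hj : (j : ℝ) + 1 ≠ 0 := by positivity
    rw [div_eq_div_iff hi hj] at h
    have := mul_left_cancel₀ ht0p.ne' h
    exact_mod_cast (add_right_cancel this).symm
  set c : ℕ → ℝ := fun j => (Lagrange.basis (Finset.range (d + 1)) node j).eval 1
  have hinterp : ∀ A : E →L[ℝ] E, (ContinuousLinearMap.id ℝ E + A).det
      = ∑ j ∈ Finset.range (d + 1), c j * (ContinuousLinearMap.id ℝ E + node j • A).det := by
    intro A
    obtain ⟨p, hp, hpe⟩ := exists_polynomial_det A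
    have hdeg : p.degree < (Finset.range (d + 1)).card := by
      rw [Finset.card_range]
      exact Polynomial.degree_le_natDegree.trans_lt (by exact_mod_cast Nat.lt_succ_of_le hp)
    have h := Lagrange.eq_interpolate hninj hdeg
    have h1 := congrArg (Polynomial.eval 1) h
    rw [hpe, one_smul] at h1
    rw [h1, Lagrange.interpolate_apply, Polynomial.eval_finsetSum]
    refine Finset.sum_congr rfl fun j _ => ?_
    rw [Polynomial.eval_mul, Polynomial.eval_C, hpe, mul_comm]
  have hsum : ∑ j ∈ Finset.range (d + 1), c j = 1 := by
    have := hinterp 0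
    rw [add_zero, Finset.sum_congr rfl fun j _ => by rw [smul_zero, add_zero],
      ← Finset.sum_mul] at this
    have h1 : (ContinuousLinearMap.id ℝ E).det = 1 := by simp [ContinuousLinearMap.det]
    rw [h1, mul_one] at this
    exact this.symm
  have hfw : ∀ x, fderiv ℝ F x = ContinuousLinearMap.id ℝ E + fderiv ℝ w x := by
    intro x
    have : fderiv ℝ w x = fderiv ℝ F x - ContinuousLinearMap.id ℝ E :=
      ((hFd x).hasFDerivAt.sub (hasFDerivAt_id x)).fderiv
    rw [this]; abel
  rw [integral_congr_ae (Eventually.of_forall fun x => by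
    rw [hfw, hinterp])]
  rw [integral_finsetSum]
  · simp_rw [integral_const_mul]
    rw [Finset.sum_congr rfl fun j _ => by rw [hsmall _ (hnode j)], ← Finset.sum_mul, hsum, one_mul]
  · intro j _
    refine Integrable.const_mul ?_ _
    have hc : Continuous fun x => (ContinuousLinearMap.id ℝ E + node j • fderiv ℝ w x).det :=
      ContinuousLinearMap.continuous_det.comp
        (by have := hwC.continuous_fderiv one_ne_zero; fun_prop)
    exact (hc.continuousOn.integrableOn_compact (isCompact_closedBall 0 R)).mono_set
      ball_subset_closedBall

theorem brouwer_of_contDiff_of_hasCompactSupport {E : Type*} [NormedAddCommGroup E]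
    [InnerProductSpace ℝ E] [FiniteDimensional ℝ E] {u : E → E} (hu : ContDiff ℝ 1 u)
    (hc : HasCompactSupport u) : ∃ x, u x = x := by
  by_contra! hne
  borelize E
  set g : E → E := fun x => x - u x with hg
  have hg0 : ∀ x, g x ≠ 0 := fun x h => hne x (sub_eq_zero.1 h).symm
  have hgC : ContDiff ℝ 1 g := contDiff_id.sub hu
  obtain ⟨R, hR, hsup⟩ := hc.isCompact.isBounded.subset_ball_lt 0 0
  have hnR : ∀ x, ‖x‖ = R → u x = 0 := fun x hx => by
    by_contra h
    have := hsup (subset_tsupport _ (Function.mem_support.2 h))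
    rw [mem_ball_zero_iff] at this
    linarith
  set F : E → E := fun x => (R * ‖g x‖⁻¹) • g x with hF
  have hFC : ContDiff ℝ 1 F :=
    (contDiff_const.mul ((hgC.norm ℝ hg0).inv fun x => norm_ne_zero_iff.2 (hg0 x))).smul hgC
  have hFn : ∀ x, ‖F x‖ = R := by
    intro x
    have := norm_ne_zero_iff.2 (hg0 x)
    simp only [hF, norm_smul, norm_mul, norm_inv, norm_norm]
    rw [Real.norm_eq_abs, abs_of_pos hR]
    field_simp
  have hfix : ∀ x, ‖x‖ = R → F x = x := by
    intro x hx
    have hgx : g x = x := by simp only [hg, hnR x hx, sub_zero]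
    simp only [hF, hgx, hx, mul_inv_cancel₀ hR.ne', one_smul]
  have hdet : ∀ x, (fderiv ℝ F x).det = 0 := by
    intro x
    by_contra hdne
    have hd := ((hFC.differentiable one_ne_zero) x).hasFDerivAt
    have hsq := hd.inner ℝ hd
    have hconst : (fun y => inner ℝ (F y) (F y)) = fun _ => R ^ 2 := by
      ext y; rw [real_inner_self_eq_norm_sq, hFn]
    rw [hconst] at hsq
    have h0 := hsq.unique (hasFDerivAt_const (R ^ 2) x)
    have hsurj : Function.Surjective (fderiv ℝ F x) := by
      have hu : IsUnit ((fderiv ℝ F x : E →L[ℝ] E) : E →ₗ[ℝ] E) :=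
        (LinearMap.isUnit_iff_isUnit_det _).2 (isUnit_iff_ne_zero.2 hdne)
      exact ((Module.End.isUnit_iff _).1 hu).2
    obtain ⟨h, hh⟩ := hsurj (F x)
    have h1 := congrArg (fun L : E →L[ℝ] ℝ => L h) h0
    simp [hh] at h1
    have := hFn x
    rw [h1, norm_zero] at this
    exact hR.ne this
  have key := integral_det_fderiv_eq_volume_of_fix_sphere (volume : Measure E) hFC hfix
  simp only [hdet, integral_zero] at key
  have : 0 < (volume : Measure E).real (ball 0 R) :=
    ENNReal.toReal_pos (measure_ball_pos _ _ hR).ne' measure_ball_lt_top.ne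
  exact this.ne key

theorem brouwer_of_bounded {E : Type*} [NormedAddCommGroup E]
    [InnerProductSpace ℝ E] [FiniteDimensional ℝ E] {f : E → E} (hf : Continuous f)
    {B : ℝ} (hB : ∀ x, ‖f x‖ ≤ B) : ∃ x, f x = x := by
  by_contra! hne
  have hB0 : 0 ≤ B := (norm_nonneg _).trans (hB 0)
  obtain ⟨x0, hx0, hmin⟩ := (isCompact_closedBall (0 : E) (B + 1)).exists_isMinOn
    ⟨0, by simp; linarith⟩ (f := fun x => ‖f x - x‖) (by fun_prop)
  set δ := min (‖f x0 - x0‖) 1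
  have hδ : 0 < δ := lt_min (norm_pos_iff.2 (sub_ne_zero.2 (hne x0))) one_pos
  let ψ : ContDiffBump (0 : E) := ⟨B + 1, B + 2, by linarith, by linarith⟩
  obtain ⟨u, huC, hud, hus⟩ := (show Continuous fun x => ψ x • f x from ψ.continuous.smul hf).exists_contDiff_approx 1
    (ε := fun _ => δ) continuous_const fun _ => hδ
  have hcs : HasCompactSupport u := by
    refine HasCompactSupport.intro' (isCompact_closedBall (0 : E) (B + 2)) isClosed_closedBall ?_
    intro x hx
    by_contra h
    have h2 := hus h
    simp only [Function.mem_support, ne_eq, smul_eq_zero, not_or] at h2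
    apply h2.1
    refine ψ.zero_of_le_dist ?_
    simpa using (not_le.1 (by simpa using hx)).le
  obtain ⟨x, hx⟩ := brouwer_of_contDiff_of_hasCompactSupport huC hcs
  have h1 := hud x
  rw [hx, dist_eq_norm] at h1
  have hb1 : ‖ψ x • f x‖ ≤ B := by
    rw [norm_smul, Real.norm_eq_abs, abs_of_nonneg ψ.nonneg]
    nlinarith [ψ.le_one (x := x), ψ.nonneg (x := x), norm_nonneg (f x), hB x]
  have hxin : ‖x‖ ≤ B + 1 := by
    have := norm_sub_norm_le x (ψ x • f x)
    linarith [min_le_right (‖f x0 - x0‖) 1]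
  have hψ : ψ x = 1 := ψ.one_of_mem_closedBall (by simpa using hxin)
  rw [hψ, one_smul, norm_sub_rev] at h1
  have h2 : ‖f x0 - x0‖ ≤ ‖f x - x‖ := hmin (by simpa using hxin)
  linarith [min_le_left (‖f x0 - x0‖) 1]

/-- Continuous self-maps of `X` at bounded distance from the identity along the fixed space
of `P`. -/
def linkMaps {X : Type*} [NormedAddCommGroup X] [NormedSpace ℝ X] (P : X →L[ℝ] X) :
    Set (X → X) :=
  {γ | Continuous γ ∧ ∃ B, ∀ x, P x = x → ‖γ x - x‖ ≤ B}

/-- The minimax value of `F` over the class `linkMaps P`. -/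
def minimaxVal {X : Type*} [NormedAddCommGroup X] [NormedSpace ℝ X] (P : X →L[ℝ] X)
    (F : X → ℝ) : ℝ :=
  sInf {b | ∃ γ ∈ linkMaps P, ∀ x, P x = x → F (γ x) ≤ b}

section
variable {X : Type*} [NormedAddCommGroup X] [InnerProductSpace ℝ X] [FiniteDimensional ℝ X]

theorem exists_link {P : X →L[ℝ] X} (hP : ∀ x, P (P x) = P x) {γ : X → X}
    (hγ : γ ∈ linkMaps P) {p : X} (hp : P p = p) : ∃ x, P x = x ∧ P (γ x) = p := by
  obtain ⟨hc, B, hB⟩ := hγ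
  have hb : ∀ x, ‖p - (P (γ (P x)) - P x)‖ ≤ ‖p‖ + ‖P‖ * B := by
    intro x
    refine (norm_sub_le _ _).trans (add_le_add_right ?_ _)
    have : P (γ (P x)) - P x = P (γ (P x) - P x) := by rw [map_sub, hP]
    rw [this]
    exact (P.le_opNorm _).trans (mul_le_mul_of_nonneg_left (hB _ (hP x)) (norm_nonneg _))
  obtain ⟨x, hx⟩ := brouwer_of_bounded (f := fun x => p - (P (γ (P x)) - P x)) (by fun_prop) hb
  have hPx : P x = x := by
    have := congrArg P hx
    rw [map_sub, map_sub, hP, hP, hp] at this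
    rw [← this, hx]
  refine ⟨x, hPx, ?_⟩
  rw [hPx] at hx
  have h2 : p - P (γ x) = 0 := by
    have : p - (P (γ x) - x) - x = 0 := sub_eq_zero.2 hx
    rw [← this]; abel
  exact (sub_eq_zero.1 h2).symm

variable {P : X →L[ℝ] X} {F F' : X → ℝ}

theorem minimaxVal_bddBelow (hP : ∀ x, P (P x) = P x) {p : X} (hp : P p = p) {lo : ℝ}
    (hlo : ∀ x, P x = p → lo ≤ F x) :
    lo ∈ lowerBounds {b | ∃ γ ∈ linkMaps P, ∀ x, P x = x → F (γ x) ≤ b} := by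
  rintro b ⟨γ, hγ, h⟩
  obtain ⟨x, hx, hxp⟩ := exists_link hP hγ hp
  exact (hlo _ hxp).trans (h x hx)

theorem minimaxVal_le (hP : ∀ x, P (P x) = P x) {p : X} (hp : P p = p) {lo : ℝ}
    (hlo : ∀ x, P x = p → lo ≤ F x) {γ : X → X} (hγ : γ ∈ linkMaps P) {b : ℝ}
    (hb : ∀ x, P x = x → F (γ x) ≤ b) : minimaxVal P F ≤ b :=
  csInf_le ⟨lo, minimaxVal_bddBelow hP hp hlo⟩ ⟨γ, hγ, hb⟩

/-- `F` tends to `-∞` at infinity along bounded neighbourhoods of the fixed space of `P`. -/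
def AntiCoercive (P : X →L[ℝ] X) (F : X → ℝ) : Prop :=
  ∀ B b : ℝ, ∃ R : ℝ, ∀ v, P v = v → R ≤ ‖v‖ → ∀ w, ‖w‖ ≤ B → F (v + w) ≤ b

theorem id_mem_linkMaps : (fun x : X => x) ∈ linkMaps P :=
  ⟨continuous_id, 0, fun x _ => by simp⟩

theorem minimaxVal_nonempty (hF : Continuous F) (hanti : AntiCoercive P F) :
    {b | ∃ γ ∈ linkMaps P, ∀ x, P x = x → F (γ x) ≤ b}.Nonempty := by
  obtain ⟨R, hR⟩ := hanti 0 0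
  obtain ⟨C, hC⟩ := (isCompact_closedBall (0 : X) R).bddAbove_image hF.continuousOn
  refine ⟨max C 0, fun x => x, id_mem_linkMaps, fun x hx => ?_⟩
  rcases le_total R ‖x‖ with h | h
  · have := hR x hx h 0 (by simp)
    rw [add_zero] at this
    exact this.trans (le_max_right _ _)
  · exact (hC ⟨x, by simpa using h, rfl⟩).trans (le_max_left _ _)

theorem le_minimaxVal (hP : ∀ x, P (P x) = P x) (hF : Continuous F) (hanti : AntiCoercive P F)
    {p : X} (hp : P p = p) {lo : ℝ} (hlo : ∀ x, P x = p → lo ≤ F x) : lo ≤ minimaxVal P F :=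
  le_csInf (minimaxVal_nonempty hF hanti) (minimaxVal_bddBelow hP hp hlo)

theorem minimaxVal_le_add (hP : ∀ x, P (P x) = P x) (hF' : Continuous F')
    (hanti' : AntiCoercive P F') {lo : ℝ} (hlo : ∀ x, P x = 0 → lo ≤ F x) {ε : ℝ}
    (hle : ∀ x, F x ≤ F' x + ε) : minimaxVal P F ≤ minimaxVal P F' + ε := by
  rw [← sub_le_iff_le_add]
  refine le_csInf (minimaxVal_nonempty hF' hanti') ?_
  rintro b ⟨γ, hγ, h⟩
  rw [sub_le_iff_le_add]
  exact minimaxVal_le hP (map_zero P) hlo hγ fun x hx => (hle _).trans (by linarith [h x hx])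

theorem exists_critical_near_minimaxVal (hP : ∀ x, P (P x) = P x) (hF : Continuous F)
    (hanti : AntiCoercive P F) {lo : ℝ} (hlo : ∀ x, P x = 0 → lo ≤ F x)
    {g : X → X} (hg : Continuous g) {L : ℝ} (hL : 0 < L)
    (hdesc : ∀ x y, F y ≤ F x + inner ℝ (g x) (y - x) + L * ‖y - x‖ ^ 2)
    {R : ℝ} (hcoer : ∀ x, R ≤ ‖x‖ → 1 ≤ ‖g x‖) {η : ℝ} (hη : 0 < η) :
    ∃ x, g x = 0 ∧ |F x - minimaxVal P F| ≤ η := by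
  set c := minimaxVal P F with hc
  by_contra! hcon
  have hcon' : ∀ x, |F x - c| ≤ η → g x ≠ 0 := fun x h h0 => (hcon x h0).not_ge h
  obtain ⟨δ, hδ, hgδ⟩ : ∃ δ > 0, ∀ x, |F x - c| ≤ η → δ ≤ ‖g x‖ := by
    have hK : IsCompact (closedBall (0 : X) R ∩ {x | |F x - c| ≤ η}) :=
      (isCompact_closedBall 0 R).inter_right
        (isClosed_le (by fun_prop) continuous_const)
    rcases (closedBall (0 : X) R ∩ {x | |F x - c| ≤ η}).eq_empty_or_nonempty with h | h
    · refine ⟨1, one_pos, fun x hx => hcoer x ?_⟩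
      by_contra hlt
      have : x ∈ closedBall (0 : X) R ∩ {x | |F x - c| ≤ η} :=
        ⟨by simpa using (not_le.1 hlt).le, hx⟩
      rw [h] at this
      exact this
    · obtain ⟨x0, hx0, hmin⟩ := hK.exists_isMinOn h hg.norm.continuousOn
      refine ⟨min ‖g x0‖ 1, lt_min (norm_pos_iff.2 (hcon' x0 hx0.2)) one_pos, fun x hx => ?_⟩
      rcases le_total R ‖x‖ with h | h
      · exact (min_le_right _ _).trans (hcoer x h)
      · exact (min_le_left _ _).trans (hmin ⟨by simpa using h, hx⟩)
  set χ : ℝ → ℝ := fun s => max 0 (min 1 (s - (c - η - 1))) with hχ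
  have hχc : Continuous χ := by fun_prop
  have hχ0 : ∀ s, 0 ≤ χ s := fun s => le_max_left _ _
  have hχ1 : ∀ s, χ s ≤ 1 := fun s => max_le zero_le_one (min_le_left _ _)
  have hχz : ∀ s, s ≤ c - η - 1 → χ s = 0 := fun s hs =>
    max_eq_left ((min_le_right _ _).trans (by linarith))
  have hχo : ∀ s, c - η ≤ s → χ s = 1 := fun s hs => by
    simp only [hχ]; rw [min_eq_left (by linarith), max_eq_right zero_le_one]
  set t := 1 / (2 * L) with ht
  have htp : 0 < t := by positivity
  set T : X → X := fun x => x - (t * χ (F x)) • g x with hT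
  have hTc : Continuous T := by fun_prop
  have hTdesc : ∀ x, F (T x) ≤ F x - t / 2 * χ (F x) * ‖g x‖ ^ 2 := by
    intro x
    have h1 := hdesc x (T x)
    have h2 : T x - x = -((t * χ (F x)) • g x) := by simp only [hT]; abel
    rw [h2, inner_neg_right, inner_smul_right, real_inner_self_eq_norm_sq, norm_neg, norm_smul,
      Real.norm_eq_abs, abs_of_nonneg (mul_nonneg htp.le (hχ0 _)), mul_pow] at h1
    have h3 : L * ((t * χ (F x)) ^ 2 * ‖g x‖ ^ 2) ≤ t / 2 * χ (F x) * ‖g x‖ ^ 2 := by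
      have : L * ((t * χ (F x)) ^ 2 * ‖g x‖ ^ 2)
          = t / 2 * χ (F x) * ‖g x‖ ^ 2 * χ (F x) := by
        rw [ht]; field_simp
      rw [this]
      have hnn : 0 ≤ t / 2 * χ (F x) * ‖g x‖ ^ 2 := by
        have := hχ0 (F x); positivity
      nlinarith [hχ1 (F x)]
    linarith
  have hTle : ∀ x, F (T x) ≤ F x := fun x => (hTdesc x).trans
    (sub_le_self _ (by have := hχ0 (F x); positivity))
  set ν := t / 2 * δ ^ 2 with hν
  have hνp : 0 < ν := by positivity
  have hTmem : ∀ γ ∈ linkMaps P, T ∘ γ ∈ linkMaps P := by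
    rintro γ ⟨hγc, B, hB⟩
    refine ⟨hTc.comp hγc, ?_⟩
    obtain ⟨R', hR'⟩ := hanti B (c - η - 1)
    obtain ⟨C, hC⟩ := (isCompact_closedBall (0 : X) R').bddAbove_image
      (f := fun x => ‖T (γ x) - x‖) (by fun_prop)
    refine ⟨max B C, fun x hx => ?_⟩
    rcases le_total R' ‖x‖ with h | h
    · have h1 := hR' x hx h (γ x - x) (hB x hx)
      rw [add_sub_cancel] at h1
      have : T (γ x) = γ x := by simp [hT, hχz _ h1]
      rw [Function.comp_apply, this]
      exact (hB x hx).trans (le_max_left _ _)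
    · exact (hC ⟨x, by simpa using h, rfl⟩).trans (le_max_right _ _)
  obtain ⟨b, ⟨γ, hγ, hγb⟩, hbc⟩ := exists_lt_of_csInf_lt (minimaxVal_nonempty hF hanti)
    (show minimaxVal P F < c + η by linarith)
  have hiter : ∀ j : ℕ, T^[j] ∘ γ ∈ linkMaps P ∧
      ∀ x, P x = x → F ((T^[j] ∘ γ) x) ≤ max (c - η) (c + η - j * ν) := by
    intro j
    induction j with
    | zero =>
      refine ⟨hγ, fun x hx => le_max_of_le_right ?_⟩
      simpa using (hγb x hx).trans hbc.le
    | succ j ih =>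
      have hcomp : T^[j + 1] ∘ γ = T ∘ (T^[j] ∘ γ) := by
        rw [Function.iterate_succ', Function.comp_assoc]
      rw [hcomp]
      refine ⟨hTmem _ ih.1, fun x hx => ?_⟩
      set y := (T^[j] ∘ γ) x with hy
      change F (T y) ≤ _
      have hyb := ih.2 x hx
      rw [← hy] at hyb
      by_cases hlow : F y ≤ c - η
      · exact le_max_of_le_left ((hTle y).trans hlow)
      · push Not at hlow
        have h1 : F y ≤ c + η - j * ν := by
          rcases le_max_iff.1 hyb with h | h
          · linarith
          · exact h
        have hjν : 0 ≤ (j : ℝ) * ν := by positivity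
        have h2 : δ ≤ ‖g y‖ := hgδ y (abs_le.2 ⟨by linarith, by linarith⟩)
        have h3 := hTdesc y
        rw [hχo _ hlow.le] at h3
        have h4 : ν ≤ t / 2 * 1 * ‖g y‖ ^ 2 := by
          rw [hν, mul_one]; gcongr
        refine le_max_of_le_right ?_
        push_cast
        linarith
  obtain ⟨j, hj⟩ := exists_nat_gt (2 * η / ν)
  have hj' : 2 * η < j * ν := (div_lt_iff₀ hνp).1 hj
  have h := minimaxVal_le hP (map_zero P) hlo (hiter j).1 (b := c - η)
    fun x hx => ((hiter j).2 x hx).trans (max_le le_rfl (by linarith))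
  linarith
end

/-- A compatible linear complex structure on a real inner product space. -/
structure LinSymp (E : Type*) [NormedAddCommGroup E] [InnerProductSpace ℝ E] where
  /-- the complex structure -/
  J : E →L[ℝ] E
  sq : ∀ v, J (J v) = -v
  skew : ∀ v w, inner ℝ (J v) w = -inner ℝ v (J w)

namespace LinSymp
variable {E : Type*} [NormedAddCommGroup E] [InnerProductSpace ℝ E]
variable (S : LinSymp E)

/-- Multiplication by `exp (θ J)`. -/
def rot (θ : ℝ) : E →L[ℝ] E := cos θ • ContinuousLinearMap.id ℝ E + sin θ • S.J

theorem rot_apply (θ : ℝ) (v : E) : S.rot θ v = cos θ • v + sin θ • S.J v := rfl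

theorem inner_J_self (v : E) : inner ℝ (S.J v) v = 0 := by
  have := S.skew v v
  rw [real_inner_comm (S.J v) v] at this
  linarith

theorem inner_J_J (v w : E) : inner ℝ (S.J v) (S.J w) = inner ℝ v w := by
  rw [S.skew, S.sq, inner_neg_right, neg_neg]

theorem norm_J (v : E) : ‖S.J v‖ = ‖v‖ := by
  have h := S.inner_J_J v v
  rw [real_inner_self_eq_norm_sq, real_inner_self_eq_norm_sq] at h
  exact (sq_eq_sq₀ (norm_nonneg _) (norm_nonneg _)).1 h

@[simp] theorem rot_zero (v : E) : S.rot 0 v = v := by simp [rot_apply]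

theorem rot_add (a b : ℝ) (v : E) : S.rot (a + b) v = S.rot a (S.rot b v) := by
  simp only [rot_apply, map_add, map_smul, S.sq, cos_add, sin_add]
  module

theorem rot_neg_rot (a : ℝ) (v : E) : S.rot (-a) (S.rot a v) = v := by
  rw [← rot_add, neg_add_cancel, rot_zero]

theorem rot_J (a : ℝ) (v : E) : S.rot a (S.J v) = S.J (S.rot a v) := by
  simp [rot_apply]

theorem inner_rot_left (a : ℝ) (v w : E) : inner ℝ (S.rot a v) w = inner ℝ v (S.rot (-a) w) := by
  simp only [rot_apply, inner_add_left, inner_add_right, inner_smul_left, inner_smul_right,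
    S.skew, cos_neg, sin_neg, RCLike.conj_to_real]
  ring

theorem inner_rot_rot (a : ℝ) (v w : E) : inner ℝ (S.rot a v) (S.rot a w) = inner ℝ v w := by
  rw [inner_rot_left, rot_neg_rot]

theorem norm_rot (a : ℝ) (v : E) : ‖S.rot a v‖ = ‖v‖ := by
  have h := S.inner_rot_rot a v v
  rw [real_inner_self_eq_norm_sq, real_inner_self_eq_norm_sq] at h
  exact (sq_eq_sq₀ (norm_nonneg _) (norm_nonneg _)).1 h

theorem rot_two_pi_int (k : ℤ) (v : E) : S.rot (2 * π * k) v = v := by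
  have h1 : cos (2 * π * k) = 1 := by rw [mul_comm]; exact cos_int_mul_two_pi k
  have h2 : sin (2 * π * k) = 0 := by
    have := sin_int_mul_pi (2 * k); push_cast at this; rw [← this]; ring_nf
  simp [rot_apply, h1, h2]

theorem rot_comm_of_comm {Q : E →L[ℝ] E} (hQ : ∀ v, Q (S.J v) = S.J (Q v)) (a : ℝ) (v : E) :
    Q (S.rot a v) = S.rot a (Q v) := by
  simp [rot_apply, hQ]

theorem hasDerivAt_rot (a : ℝ) (v : E) (t : ℝ) :
    HasDerivAt (fun t : ℝ => S.rot (a * t) v) (a • S.J (S.rot (a * t) v)) t := by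
  have h1 : HasDerivAt (fun t : ℝ => a * t) a t := by simpa using (hasDerivAt_id t).const_mul a
  have h := (h1.cos.smul_const v).add (h1.sin.smul_const (S.J v))
  refine h.congr_deriv ?_
  simp only [rot_apply, map_add, map_smul, S.sq]
  module

@[fun_prop]
theorem continuous_rot : Continuous S.rot := by
  unfold rot; fun_prop

theorem continuous_rot_apply {Y : Type*} [TopologicalSpace Y] {a : Y → ℝ} {f : Y → E}
    (ha : Continuous a) (hf : Continuous f) : Continuous fun y => S.rot (a y) (f y) :=
  (S.continuous_rot.comp ha).clm_apply hf

variable [FiniteDimensional ℝ E]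

theorem integral_rot (k : ℤ) (v : E) :
    ∫ t in (0 : ℝ)..1, S.rot (2 * π * k * t) v = if k = 0 then v else 0 := by
  split_ifs with hk
  · simp [hk]
  · have hk' : (2 * π * k : ℝ) ≠ 0 := by
      have : (k : ℝ) ≠ 0 := by exact_mod_cast hk
      positivity
    have hd : ∀ t ∈ uIcc (0 : ℝ) 1, HasDerivAt
        (fun t : ℝ => S.rot (2 * π * k * t) (-(2 * π * k : ℝ)⁻¹ • S.J v))
        (S.rot (2 * π * k * t) v) t := by
      intro t _
      refine (S.hasDerivAt_rot (2 * π * k) _ t).congr_deriv ?_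
      rw [map_smul, map_smul, smul_smul, rot_J, S.sq, mul_neg, mul_inv_cancel₀ hk']
      simp
    rw [intervalIntegral.integral_eq_sub_of_hasDerivAt hd
      ((S.continuous_rot_apply (by fun_prop) continuous_const).intervalIntegrable _ _)]
    simp [rot_two_pi_int]

/-- The `k`-th Fourier coefficient of a loop `[0,1] → E`. -/
def fc (k : ℤ) (f : ℝ → E) : E := ∫ t in (0 : ℝ)..1, S.rot (-(2 * π * k * t)) (f t)

/-- Indices of the Fourier modes in the `m`-th Galerkin space. -/
abbrev Modes (m : ℕ) := Finset.Icc (-(m : ℤ) - 1) (m + 1)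

/-- The `m`-th Galerkin space. -/
abbrev Gal (E : Type*) (m : ℕ) := PiLp 2 (fun _ : Modes m => E)

variable {m : ℕ}

/-- The loop with given Fourier modes. -/
def loop (x : Gal E m) (t : ℝ) : E := ∑ k : Modes m, S.rot (2 * π * (k : ℤ) * t) (x k)

theorem continuous_loop_uncurry : Continuous fun p : Gal E m × ℝ => S.loop p.1 p.2 := by
  unfold loop
  refine continuous_finsetSum _ fun k _ => S.continuous_rot_apply (by fun_prop) (by fun_prop)

theorem continuous_loop (x : Gal E m) : Continuous (S.loop x) :=
  continuous_finsetSum _ fun _ _ => S.continuous_rot_apply (by fun_prop) continuous_const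

theorem loop_add (x y : Gal E m) (t : ℝ) : S.loop (x + y) t = S.loop x t + S.loop y t := by
  simp [loop, Finset.sum_add_distrib]

theorem loop_sub (x y : Gal E m) (t : ℝ) : S.loop (x - y) t = S.loop x t - S.loop y t := by
  simp [loop, Finset.sum_sub_distrib]

theorem loop_one (x : Gal E m) : S.loop x 1 = S.loop x 0 := by
  simp [loop, rot_two_pi_int]

theorem integral_inner_const {f : ℝ → E} (hf : Continuous f) (v : E) :
    ∫ t in (0 : ℝ)..1, inner ℝ v (f t) = inner ℝ v (∫ t in (0 : ℝ)..1, f t) :=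
  ((innerSL ℝ v).intervalIntegral_comp_comm (hf.intervalIntegrable _ _))

theorem integral_inner_loop (x : Gal E m) {f : ℝ → E} (hf : Continuous f) :
    ∫ t in (0 : ℝ)..1, inner ℝ (S.loop x t) (f t) = ∑ k : Modes m, inner ℝ (x k) (S.fc k f) := by
  have hc : ∀ k : ℤ, Continuous fun t : ℝ => S.rot (-(2 * π * k * t)) (f t) := fun k =>
    S.continuous_rot_apply (by fun_prop) hf
  have : ∀ t, inner ℝ (S.loop x t) (f t)
      = ∑ k : Modes m, inner ℝ (x k) (S.rot (-(2 * π * (k : ℤ) * t)) (f t)) := by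
    intro t
    rw [loop, sum_inner]
    exact Finset.sum_congr rfl fun k _ => S.inner_rot_left _ _ _
  simp_rw [this]
  rw [intervalIntegral.integral_finsetSum (fun (k : Modes m) _ =>
    ((continuous_const.inner (hc k)).intervalIntegrable (μ := volume) 0 1))]
  exact Finset.sum_congr rfl fun k _ => integral_inner_const (hc k) _

theorem fc_loop (x : Gal E m) (k : Modes m) : S.fc k (S.loop x) = x k := by
  have : ∀ t, S.rot (-(2 * π * (k : ℤ) * t)) (S.loop x t)
      = ∑ j : Modes m, S.rot (2 * π * ((j - k : ℤ) : ℤ) * t) (x j) := by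
    intro t
    rw [loop, map_sum]
    refine Finset.sum_congr rfl fun j _ => ?_
    rw [← rot_add]; congr 2; push_cast; ring
  simp only [fc, this]
  rw [intervalIntegral.integral_finsetSum fun (j : Modes m) _ =>
    ((S.continuous_rot_apply (by fun_prop) continuous_const).intervalIntegrable _ _)]
  simp only [integral_rot, sub_eq_zero]
  rw [Finset.sum_eq_single k]
  · simp
  · intro j _ hj
    rw [if_neg]
    exact fun h => hj (Subtype.ext h)
  · simp

theorem integral_inner_loop_loop (x y : Gal E m) :
    ∫ t in (0 : ℝ)..1, inner ℝ (S.loop x t) (S.loop y t) = inner ℝ x y := by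
  rw [S.integral_inner_loop x (S.continuous_loop y), PiLp.inner_apply]
  exact Finset.sum_congr rfl fun k _ => by rw [fc_loop]

theorem integral_norm_sq_loop (x : Gal E m) :
    ∫ t in (0 : ℝ)..1, ‖S.loop x t‖ ^ 2 = ‖x‖ ^ 2 := by
  rw [← real_inner_self_eq_norm_sq, ← S.integral_inner_loop_loop]
  simp_rw [real_inner_self_eq_norm_sq]

/-- The operator acting by `T k` on the `k`-th mode. -/
def modeMap (m : ℕ) (T : ℤ → E →L[ℝ] E) : Gal E m →L[ℝ] Gal E m :=
  LinearMap.toContinuousLinearMap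
    { toFun := fun x => WithLp.toLp 2 fun k => T k (x k)
      map_add' := fun x y => by ext k; simp
      map_smul' := fun c x => by ext k; simp }

@[simp] theorem modeMap_apply (T : ℤ → E →L[ℝ] E) (x : Gal E m) (k : Modes m) :
    modeMap m T x k = T k (x k) := rfl

theorem loop_modeMap_const {Q : E →L[ℝ] E} (hQ : ∀ v, Q (S.J v) = S.J (Q v)) (x : Gal E m)
    (t : ℝ) : S.loop (modeMap m (fun _ => Q) x) t = Q (S.loop x t) := by
  simp [loop, S.rot_comm_of_comm hQ]

/-- The operator multiplying the `k`-th mode by `2πk`. -/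
def freq (m : ℕ) : Gal E m →L[ℝ] Gal E m :=
  modeMap m fun k => (2 * π * k : ℝ) • ContinuousLinearMap.id ℝ E

@[simp] theorem freq_apply (x : Gal E m) (k : Modes m) :
    freq m x k = (2 * π * (k : ℤ) : ℝ) • x k := rfl

theorem hasDerivAt_loop (x : Gal E m) (t : ℝ) :
    HasDerivAt (S.loop x) (S.J (S.loop (freq m x) t)) t := by
  have := HasDerivAt.fun_sum (u := Finset.univ) fun (k : Modes m) _ =>
    S.hasDerivAt_rot (2 * π * (k : ℤ)) (x k) t
  refine this.congr_deriv ?_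
  simp [loop]

end LinSymp

namespace LinSymp
variable {E : Type*} [NormedAddCommGroup E] [InnerProductSpace ℝ E] [FiniteDimensional ℝ E]
variable (S : LinSymp E) {m : ℕ}

/-- Hamiltonians `K` with Lipschitz gradient `G` that are, up to a bounded error, equal to
the quadratic form `π ⟪Q x, x⟫`, with `Q` pinched between `κ` and `κ + 1`. -/
structure Adm (κ : ℤ) (Q : E →L[ℝ] E) (d : ℝ) (K : E → ℝ) (G : E → E) : Prop where
  comm : ∀ v, Q (S.J v) = S.J (Q v)
  pos : 0 < d
  lower : ∀ v, (κ + d) * ‖v‖ ^ 2 ≤ inner ℝ (Q v) v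
  upper : ∀ v, inner ℝ (Q v) v ≤ (κ + 1 - d) * ‖v‖ ^ 2
  grad : ∀ x, HasGradientAt K (G x) x
  lip : ∃ l : NNReal, LipschitzWith l G
  bdG : ∃ B, ∀ x, ‖G x - (2 * π) • Q x‖ ≤ B
  bdK : ∃ B, ∀ x, |K x - π * inner ℝ (Q x) x| ≤ B

/-- The projection to the modes `≤ κ`. -/
def proj (m : ℕ) (κ : ℤ) : Gal E m →L[ℝ] Gal E m :=
  modeMap m fun k => if k ≤ κ then ContinuousLinearMap.id ℝ E else 0

theorem proj_apply (κ : ℤ) (x : Gal E m) (k : Modes m) :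
    proj m κ x k = if (k : ℤ) ≤ κ then x k else 0 := by
  simp only [proj, modeMap_apply]; split_ifs <;> simp

theorem proj_proj (κ : ℤ) (x : Gal E m) : proj m κ (proj m κ x) = proj m κ x := by
  ext k; simp only [proj_apply]; split_ifs <;> rfl

/-- The vector of Fourier coefficients of a loop. -/
def coef (m : ℕ) (f : ℝ → E) : Gal E m := WithLp.toLp 2 fun k : Modes m => S.fc k f

theorem inner_coef {f : ℝ → E} (hf : Continuous f) (x : Gal E m) :
    inner ℝ (S.coef m f) x = ∫ t in (0 : ℝ)..1, inner ℝ (f t) (S.loop x t) := by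
  simp_rw [fun t => real_inner_comm (S.loop x t) (f t)]
  rw [S.integral_inner_loop x hf, PiLp.inner_apply]
  exact Finset.sum_congr rfl fun k _ => real_inner_comm _ _

/-- The Hamiltonian action functional on the `m`-th Galerkin space. -/
def action (m : ℕ) (K : E → ℝ) (x : Gal E m) : ℝ :=
  2⁻¹ * inner ℝ (freq m x) x - ∫ t in (0 : ℝ)..1, K (S.loop x t)

/-- The gradient of `action`. -/
def gradAction (m : ℕ) (G : E → E) (x : Gal E m) : Gal E m :=
  freq m x - S.coef m fun t => G (S.loop x t)

/-- The quadratic part of the action. -/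
def quadAction (m : ℕ) (Q : E →L[ℝ] E) (x : Gal E m) : ℝ :=
  2⁻¹ * inner ℝ (freq m x) x - ∫ t in (0 : ℝ)..1, π * inner ℝ (Q (S.loop x t)) (S.loop x t)

theorem quadAction_eq {Q : E →L[ℝ] E} (hQ : ∀ v, Q (S.J v) = S.J (Q v)) (x : Gal E m) :
    S.quadAction m Q x
      = ∑ k : Modes m, π * ((k : ℤ) * ‖x k‖ ^ 2 - inner ℝ (Q (x k)) (x k)) := by
  unfold quadAction
  rw [intervalIntegral.integral_const_mul]
  simp_rw [← S.loop_modeMap_const hQ]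
  rw [integral_inner_loop_loop, PiLp.inner_apply, PiLp.inner_apply, Finset.mul_sum,
    Finset.mul_sum, ← Finset.sum_sub_distrib]
  refine Finset.sum_congr rfl fun k _ => ?_
  rw [freq_apply, modeMap_apply, real_inner_smul_left, real_inner_self_eq_norm_sq]
  ring

variable {S} {κ : ℤ} {Q Q' : E →L[ℝ] E} {d d' : ℝ} {K K' : E → ℝ} {G G' : E → E}

namespace Adm

theorem continuous_ham (h : S.Adm κ Q d K G) : Continuous K :=
  continuous_iff_continuousAt.2 fun x => (h.grad x).continuousAt

theorem continuous_grad (h : S.Adm κ Q d K G) : Continuous G :=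
  let ⟨_, hl⟩ := h.lip; hl.continuous

theorem mode_low (h : S.Adm κ Q d K G) {k : ℤ} (hk : k ≤ κ) (v : E) :
    (k : ℝ) * ‖v‖ ^ 2 - inner ℝ (Q v) v ≤ -(d * ‖v‖ ^ 2) := by
  have h1 := h.lower v
  have h2 : (k : ℝ) ≤ κ := by exact_mod_cast hk
  nlinarith [sq_nonneg ‖v‖]

theorem mode_high (h : S.Adm κ Q d K G) {k : ℤ} (hk : κ < k) (v : E) :
    d * ‖v‖ ^ 2 ≤ (k : ℝ) * ‖v‖ ^ 2 - inner ℝ (Q v) v := by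
  have h1 := h.upper v
  have h2 : (κ : ℝ) + 1 ≤ k := by exact_mod_cast hk
  nlinarith [sq_nonneg ‖v‖]

theorem quadAction_le (h : S.Adm κ Q d K G) {x : Gal E m} (hx : proj m κ x = x) :
    S.quadAction m Q x ≤ -(π * d * ‖x‖ ^ 2) := by
  rw [S.quadAction_eq h.comm, PiLp.norm_sq_eq_of_L2, Finset.mul_sum, ← Finset.sum_neg_distrib]
  refine Finset.sum_le_sum fun k _ => ?_
  by_cases hk : (k : ℤ) ≤ κ
  · have := mul_le_mul_of_nonneg_left (h.mode_low hk (x k)) pi_pos.le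
    linarith
  · have h0 : x k = 0 := by rw [← hx, proj_apply, if_neg hk]
    simp [h0]

theorem le_quadAction (h : S.Adm κ Q d K G) {x : Gal E m} (hx : proj m κ x = 0) :
    π * d * ‖x‖ ^ 2 ≤ S.quadAction m Q x := by
  rw [S.quadAction_eq h.comm, PiLp.norm_sq_eq_of_L2, Finset.mul_sum]
  refine Finset.sum_le_sum fun k _ => ?_
  by_cases hk : (k : ℤ) ≤ κ
  · have h0 : x k = 0 := by
      have := congrArg (fun y : Gal E m => y k) hx
      simpa [proj_apply, hk] using this
    simp [h0]
  · have := mul_le_mul_of_nonneg_left (h.mode_high (not_le.1 hk) (x k)) pi_pos.le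
    linarith

end Adm

theorem intervalIntegrable_comp_loop (hK : Continuous K) (x : Gal E m) :
    IntervalIntegrable (fun t => K (S.loop x t)) volume 0 1 :=
  (hK.comp (S.continuous_loop x)).intervalIntegrable _ _

theorem action_le_action (hK : Continuous K) (hK' : Continuous K') {ε : ℝ}
    (hle : ∀ x, K' x ≤ K x + ε) (x : Gal E m) : S.action m K x ≤ S.action m K' x + ε := by
  unfold action
  have h1 : ∫ t in (0 : ℝ)..1, K' (S.loop x t) ≤ ∫ t in (0 : ℝ)..1, (K (S.loop x t) + ε) :=
    intervalIntegral.integral_mono_on zero_le_one (intervalIntegrable_comp_loop hK' x)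
      ((intervalIntegrable_comp_loop hK x).add intervalIntegrable_const) fun t _ => hle _
  rw [intervalIntegral.integral_add (intervalIntegrable_comp_loop hK x) intervalIntegrable_const]
    at h1
  simp at h1
  linarith

theorem continuous_quad (Q : E →L[ℝ] E) : Continuous fun v => π * inner ℝ (Q v) v := by
  fun_prop

theorem continuous_action (hK : Continuous K) : Continuous (S.action m K) := by
  unfold action
  refine Continuous.sub (by fun_prop) ?_
  refine intervalIntegral.continuous_parametric_intervalIntegral_of_continuous'
    (f := fun (x : Gal E m) t => K (S.loop x t)) ?_ 0 1
  exact hK.comp S.continuous_loop_uncurry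

theorem action_le_quadAction (hK : Continuous K) {B : ℝ}
    (hle : ∀ x, π * inner ℝ (Q x) x - B ≤ K x) (x : Gal E m) :
    S.action m K x ≤ S.quadAction m Q x + B :=
  action_le_action hK (continuous_quad Q) (fun x => by linarith [hle x]) x

theorem quadAction_le_action (hK : Continuous K) {B : ℝ}
    (hle : ∀ x, K x ≤ π * inner ℝ (Q x) x - B) (x : Gal E m) :
    S.quadAction m Q x + B ≤ S.action m K x := by
  have := action_le_action (S := S) (continuous_quad Q) hK (ε := -B) (fun x => by linarith [hle x]) x
  change S.quadAction m Q x ≤ _ at this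
  linarith

theorem quadAction_add_le (m : ℕ) (S : LinSymp E) (Q : E →L[ℝ] E)
    (hQ : ∀ v, Q (S.J v) = S.J (Q v)) :
    ∃ C, 0 ≤ C ∧ ∀ v w : Gal E m,
      S.quadAction m Q (v + w) ≤ S.quadAction m Q v + C * (‖v‖ * ‖w‖ + ‖w‖ ^ 2) := by
  set T : Gal E m →L[ℝ] Gal E m := (2 : ℝ)⁻¹ • freq m - π • modeMap m (fun _ => Q) with hT
  have hq : ∀ x, S.quadAction m Q x = inner ℝ (T x) x := by
    intro x
    unfold quadAction
    rw [intervalIntegral.integral_const_mul]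
    simp_rw [← S.loop_modeMap_const hQ]
    rw [integral_inner_loop_loop]
    simp [hT, inner_sub_left, real_inner_smul_left]
  refine ⟨2 * ‖T‖, by positivity, fun v w => ?_⟩
  rw [hq, hq, map_add, inner_add_left, inner_add_right, inner_add_right]
  have h1 : ∀ a b : Gal E m, inner ℝ (T a) b ≤ ‖T‖ * (‖a‖ * ‖b‖) := fun a b =>
    (real_inner_le_norm _ _).trans (by
      rw [← mul_assoc]; exact mul_le_mul_of_nonneg_right (T.le_opNorm a) (norm_nonneg _))
  have := h1 v w
  have := h1 w v
  have := h1 w w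
  have : 0 ≤ ‖T‖ * ‖w‖ ^ 2 := by positivity
  nlinarith

namespace Adm

theorem antiCoercive (h : S.Adm κ Q d K G) (m : ℕ) :
    AntiCoercive (proj m κ) (S.action m K) := by
  intro B b
  obtain ⟨B', hB'⟩ := h.bdK
  obtain ⟨C, hC0, hC⟩ := quadAction_add_le m S Q h.comm
  set B1 := max B 0
  have hd : 0 < π * d := mul_pos pi_pos h.pos
  set A := C * B1 + C * B1 ^ 2 + B' + |b|
  have hB'0 : 0 ≤ B' := (abs_nonneg _).trans (hB' 0)
  have hA : 0 ≤ A := by positivity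
  refine ⟨A / (π * d) + 1, fun v hv hR w hw => ?_⟩
  have hw1 : ‖w‖ ≤ B1 := hw.trans (le_max_left _ _)
  have h1 := action_le_quadAction (S := S) (m := m) (Q := Q) (B := B') h.continuous_ham
    (fun x => by linarith [(abs_le.1 (hB' x)).1]) (v + w)
  have h2 := h.quadAction_le hv
  have h3 := hC v w
  have hv1 : 1 ≤ ‖v‖ := le_trans (by linarith [div_nonneg hA hd.le]) hR
  have h4 : A ≤ π * d * ‖v‖ := by
    have : A / (π * d) ≤ ‖v‖ := by linarith
    rw [div_le_iff₀ hd] at this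
    linarith
  have h5 : C * (‖v‖ * ‖w‖ + ‖w‖ ^ 2) ≤ ‖v‖ * (C * B1 + C * B1 ^ 2) := by
    have e1 : ‖v‖ * ‖w‖ ≤ ‖v‖ * B1 := by gcongr
    have e2 : ‖w‖ ^ 2 ≤ ‖v‖ * B1 ^ 2 := by
      have : ‖w‖ ^ 2 ≤ B1 ^ 2 := by gcongr
      nlinarith [sq_nonneg B1]
    calc C * (‖v‖ * ‖w‖ + ‖w‖ ^ 2) ≤ C * (‖v‖ * B1 + ‖v‖ * B1 ^ 2) := by gcongr
      _ = _ := by ring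
  have h6 : ‖v‖ * A ≤ π * d * ‖v‖ ^ 2 := by nlinarith
  have h7 : B' + |b| ≤ ‖v‖ * (B' + |b|) := by
    nlinarith [abs_nonneg b]
  have h8 : ‖v‖ * A = ‖v‖ * (C * B1 + C * B1 ^ 2) + ‖v‖ * (B' + |b|) := by ring
  linarith [neg_abs_le b]

theorem neg_le_action (h : S.Adm κ Q d K G) {B : ℝ}
    (hB : ∀ x, K x ≤ π * inner ℝ (Q x) x + B) {x : Gal E m} (hx : proj m κ x = 0) :
    -B ≤ S.action m K x := by
  have h1 := quadAction_le_action (S := S) (m := m) (Q := Q) (B := -B) h.continuous_ham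
    (fun x => by linarith [hB x]) x
  have h2 := h.le_quadAction hx
  have : 0 ≤ π * d * ‖x‖ ^ 2 := by have := h.pos; positivity
  linarith

theorem exists_lower (h : S.Adm κ Q d K G) :
    ∃ lo, ∀ m, ∀ x : Gal E m, proj m κ x = 0 → lo ≤ S.action m K x := by
  obtain ⟨B, hB⟩ := h.bdK
  exact ⟨-B, fun m x hx => h.neg_le_action (fun y => by linarith [(abs_le.1 (hB y)).2]) hx⟩

theorem inner_gradAction (h : S.Adm κ Q d K G) (x y : Gal E m) :
    inner ℝ (S.gradAction m G x) y
      = inner ℝ (freq m x) y - ∫ t in (0 : ℝ)..1, inner ℝ (G (S.loop x t)) (S.loop y t) := by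
  unfold gradAction
  rw [inner_sub_left, S.inner_coef (f := fun t => G (S.loop x t))
    (h.continuous_grad.comp (S.continuous_loop x))]

theorem continuous_gradAction (h : S.Adm κ Q d K G) : Continuous (S.gradAction m G) := by
  unfold gradAction coef fc
  refine Continuous.sub (by fun_prop) ?_
  refine (PiLp.continuous_toLp 2 _).comp (continuous_pi fun k => ?_)
  refine intervalIntegral.continuous_parametric_intervalIntegral_of_continuous' ?_ 0 1
  exact S.continuous_rot_apply (by fun_prop) (h.continuous_grad.comp S.continuous_loop_uncurry)

theorem ham_taylor (h : S.Adm κ Q d K G) :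
    ∃ l : ℝ, 0 ≤ l ∧ ∀ x y, |K y - K x - inner ℝ (G x) (y - x)| ≤ l * ‖y - x‖ ^ 2 := by
  obtain ⟨l, hl⟩ := h.lip
  refine ⟨l, l.2, fun x y => ?_⟩
  obtain ⟨z, hz, hzd⟩ := domain_mvt (f := K) (s := univ) (x := x) (y := y)
    (f' := fun z => InnerProductSpace.toDual ℝ E (G z))
    (fun z _ => (h.grad z).hasFDerivAt.hasFDerivWithinAt) convex_univ (mem_univ _) (mem_univ _)
  rw [hzd, InnerProductSpace.toDual_apply_apply, ← inner_sub_left]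
  refine (abs_real_inner_le_norm _ _).trans ?_
  have h1 := hl.dist_le_mul z x
  rw [dist_eq_norm, dist_eq_norm] at h1
  have h2 : ‖z - x‖ ≤ ‖y - x‖ := by
    obtain ⟨θ, hθ, rfl⟩ := segment_eq_image' ℝ x y ▸ hz
    simp only [add_sub_cancel_left, norm_smul, Real.norm_eq_abs, abs_of_nonneg hθ.1]
    nlinarith [hθ.2, norm_nonneg (y - x)]
  calc ‖G z - G x‖ * ‖y - x‖ ≤ (l * ‖y - x‖) * ‖y - x‖ := by gcongr; exact h1.trans (by gcongr)
    _ = l * ‖y - x‖ ^ 2 := by ring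

theorem action_descent (h : S.Adm κ Q d K G) (m : ℕ) :
    ∃ L : ℝ, 0 < L ∧ ∀ x y : Gal E m, S.action m K y ≤ S.action m K x
      + inner ℝ (S.gradAction m G x) (y - x) + L * ‖y - x‖ ^ 2 := by
  obtain ⟨l, hl0, hl⟩ := h.ham_taylor
  refine ⟨‖freq (E := E) m‖ + l + 1, by positivity, fun x y => ?_⟩
  set w := y - x with hw
  have hy : y = x + w := by rw [hw]; abel
  have hsymm : inner ℝ (freq m w) x = inner ℝ (freq m x) w := by
    rw [PiLp.inner_apply, PiLp.inner_apply]
    refine Finset.sum_congr rfl fun k _ => ?_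
    rw [freq_apply, freq_apply, real_inner_smul_left, real_inner_smul_left, real_inner_comm]
  have hintg : ∀ {f : ℝ → ℝ}, Continuous f → IntervalIntegrable f volume 0 1 :=
    fun hf => hf.intervalIntegrable _ _
  have hcx := S.continuous_loop x
  have hcw := S.continuous_loop w
  have hK := h.continuous_ham
  have hG := h.continuous_grad
  have h1 : ∫ t in (0 : ℝ)..1, (K (S.loop x t) + inner ℝ (G (S.loop x t)) (S.loop w t)
      - l * ‖S.loop w t‖ ^ 2) ≤ ∫ t in (0 : ℝ)..1, K (S.loop y t) := by
    refine intervalIntegral.integral_mono_on zero_le_one (hintg (by fun_prop))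
      (intervalIntegrable_comp_loop hK y) fun t _ => ?_
    have := (abs_le.1 (hl (S.loop x t) (S.loop y t))).1
    rw [← loop_sub, ← hw] at this
    linarith
  rw [intervalIntegral.integral_sub (hintg (by fun_prop)) (hintg (by fun_prop)),
    intervalIntegral.integral_add (hintg (by fun_prop)) (hintg (by fun_prop)),
    intervalIntegral.integral_const_mul, integral_norm_sq_loop] at h1
  rw [h.inner_gradAction]
  unfold action
  have h2 : inner ℝ (freq m y) y = inner ℝ (freq m x) x + 2 * inner ℝ (freq m x) w
      + inner ℝ (freq m w) w := by
    rw [hy, map_add, inner_add_left, inner_add_right, inner_add_right, hsymm]; ring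
  have h3 : inner ℝ (freq m w) w ≤ ‖freq (E := E) m‖ * ‖w‖ ^ 2 := by
    refine (real_inner_le_norm _ _).trans ?_
    rw [pow_two, ← mul_assoc]
    exact mul_le_mul_of_nonneg_right ((freq (E := E) m).le_opNorm w) (norm_nonneg _)
  have h4 : 0 ≤ ‖freq (E := E) m‖ * ‖w‖ ^ 2 := by positivity
  have h5 : 0 ≤ ‖w‖ ^ 2 := by positivity
  rw [h2]
  nlinarith

/-- Coercivity of the gradient, uniformly in the Galerkin dimension. -/
theorem gradAction_coercive (h : S.Adm κ Q d K G) :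
    ∃ C, 0 ≤ C ∧ ∀ (m : ℕ) (x : Gal E m),
      π * d * ‖x‖ ^ 2 ≤ ‖S.gradAction m G x‖ * ‖x‖ + C := by
  obtain ⟨B, hB⟩ := h.bdG
  have hd := h.pos
  have hB0 : 0 ≤ B := (norm_nonneg _).trans (hB 0)
  refine ⟨B ^ 2 / (4 * π * d), by positivity, fun m x => ?_⟩
  set y : Gal E m := x - (2 : ℝ) • proj m κ x with hy
  have hyk : ∀ k : Modes m, y k = if (k : ℤ) ≤ κ then -x k else x k := by
    intro k
    simp only [hy, PiLp.sub_apply, PiLp.smul_apply, proj_apply]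
    split_ifs <;> module
  have hyn : ‖y‖ ^ 2 = ‖x‖ ^ 2 := by
    rw [PiLp.norm_sq_eq_of_L2, PiLp.norm_sq_eq_of_L2]
    refine Finset.sum_congr rfl fun k _ => ?_
    rw [hyk]; split_ifs <;> simp
  have hyn' : ‖y‖ = ‖x‖ := (sq_eq_sq₀ (norm_nonneg _) (norm_nonneg _)).1 hyn
  have h1 : inner ℝ (S.gradAction m G x) y ≤ ‖S.gradAction m G x‖ * ‖x‖ := by
    rw [← hyn']; exact real_inner_le_norm _ _
  rw [h.inner_gradAction] at h1
  have hcx := S.continuous_loop x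
  have hcy := S.continuous_loop y
  have hG := h.continuous_grad
  have hintg : ∀ {f : ℝ → ℝ}, Continuous f → IntervalIntegrable f volume 0 1 :=
    fun hf => hf.intervalIntegrable _ _
  have h2 : ∫ t in (0 : ℝ)..1, inner ℝ (G (S.loop x t)) (S.loop y t)
      ≤ ∫ t in (0 : ℝ)..1, ((2 * π) * inner ℝ (Q (S.loop x t)) (S.loop y t)
        + (π * d * ‖S.loop y t‖ ^ 2 + B ^ 2 / (4 * π * d))) := by
    refine intervalIntegral.integral_mono_on zero_le_one (hintg (by fun_prop))
      (hintg (by fun_prop)) fun t _ => ?_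
    have e1 := real_inner_le_norm (G (S.loop x t) - (2 * π) • Q (S.loop x t)) (S.loop y t)
    rw [inner_sub_left, real_inner_smul_left] at e1
    have e2 := mul_le_mul_of_nonneg_right (hB (S.loop x t)) (norm_nonneg (S.loop y t))
    have e3 : B * ‖S.loop y t‖ ≤ π * d * ‖S.loop y t‖ ^ 2 + B ^ 2 / (4 * π * d) := by
      have hp : 0 < 4 * π * d := by positivity
      have : 0 ≤ (2 * (π * d) * ‖S.loop y t‖ - B) ^ 2 / (4 * π * d) := by positivity
      have e4 : (2 * (π * d) * ‖S.loop y t‖ - B) ^ 2 / (4 * π * d)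
          = π * d * ‖S.loop y t‖ ^ 2 + B ^ 2 / (4 * π * d) - B * ‖S.loop y t‖ := by
        field_simp; ring
      linarith
    linarith
  rw [intervalIntegral.integral_add (hintg (by fun_prop)) (hintg (by fun_prop)),
    intervalIntegral.integral_add (hintg (by fun_prop)) (hintg (by fun_prop)),
    intervalIntegral.integral_const_mul, intervalIntegral.integral_const_mul,
    integral_norm_sq_loop, hyn] at h2
  simp_rw [← S.loop_modeMap_const h.comm] at h2
  rw [integral_inner_loop_loop] at h2
  have h3 : 2 * (π * d) * ‖x‖ ^ 2
      ≤ inner ℝ (freq m x) y - 2 * π * inner ℝ (modeMap m (fun _ => Q) x) y := by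
    rw [PiLp.inner_apply, PiLp.inner_apply, PiLp.norm_sq_eq_of_L2, Finset.mul_sum,
      Finset.mul_sum, ← Finset.sum_sub_distrib]
    refine Finset.sum_le_sum fun k _ => ?_
    rw [freq_apply, modeMap_apply, hyk, real_inner_smul_left]
    split_ifs with hk
    · have := mul_le_mul_of_nonneg_left (h.mode_low hk (x k)) pi_pos.le
      rw [inner_neg_right, inner_neg_right, real_inner_self_eq_norm_sq]
      linarith
    · have := mul_le_mul_of_nonneg_left (h.mode_high (not_le.1 hk) (x k)) pi_pos.le
      rw [real_inner_self_eq_norm_sq]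
      linarith
  simp at h2
  linarith

theorem exists_critical (h : S.Adm κ Q d K G) (m : ℕ) {η : ℝ} (hη : 0 < η) :
    ∃ x : Gal E m, S.gradAction m G x = 0 ∧
      |S.action m K x - minimaxVal (proj m κ) (S.action m K)| ≤ η := by
  obtain ⟨lo, hlo⟩ := h.exists_lower
  obtain ⟨L, hL, hdesc⟩ := h.action_descent m
  obtain ⟨C, hC0, hC⟩ := h.gradAction_coercive
  have hd : 0 < π * d := mul_pos pi_pos h.pos
  refine exists_critical_near_minimaxVal (proj_proj κ) (continuous_action h.continuous_ham)
    (h.antiCoercive m) (hlo m) h.continuous_gradAction hL hdesc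
    (R := (C + 1) / (π * d) + 1) (fun x hx => ?_) hη
  have h1 := hC m x
  have hq : 0 ≤ (C + 1) / (π * d) := by positivity
  have h2 : C + 1 ≤ π * d * ‖x‖ := by
    have : (C + 1) / (π * d) ≤ ‖x‖ := by linarith
    rw [div_le_iff₀ hd] at this
    linarith
  have hx1 : 1 ≤ ‖x‖ := by linarith
  by_contra hlt
  push Not at hlt
  nlinarith

end Adm
end LinSymp

namespace LinSymp
variable {E : Type*} [NormedAddCommGroup E] [InnerProductSpace ℝ E] [FiniteDimensional ℝ E]
variable (S : LinSymp E) {m : ℕ}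

/-- The complex linear functional with real part `⟪·, v⟫`. -/
def cfun (v w : E) : ℂ := (inner ℝ w v : ℝ) - Complex.I * (inner ℝ (S.J w) v : ℝ)

theorem cfun_rot (v w : E) (a : ℝ) :
    S.cfun v (S.rot a w) = Complex.exp (a * Complex.I) * S.cfun v w := by
  simp only [cfun, rot_apply, map_add, map_smul, S.sq, inner_add_left, inner_smul_left,
    inner_neg_left, RCLike.conj_to_real, Complex.exp_mul_I]
  push_cast
  linear_combination ((Complex.sin a) * (inner ℝ (S.J w) v : ℝ)) * Complex.I_sq

theorem continuous_cfun (v : E) : Continuous (S.cfun v) := by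
  unfold cfun; fun_prop

theorem integral_cfun (v : E) {f : ℝ → E} (hf : Continuous f) :
    ∫ t in (0 : ℝ)..1, S.cfun v (f t) = S.cfun v (∫ t in (0 : ℝ)..1, f t) := by
  have h1 : ∫ t in (0 : ℝ)..1, inner ℝ (f t) v = inner ℝ (∫ t in (0 : ℝ)..1, f t) v := by
    simp_rw [real_inner_comm v]; exact integral_inner_const hf v
  have h2 : ∫ t in (0 : ℝ)..1, inner ℝ (S.J (f t)) v
      = inner ℝ (S.J (∫ t in (0 : ℝ)..1, f t)) v := by
    simp_rw [S.skew, real_inner_comm (S.J v)]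
    rw [intervalIntegral.integral_neg, integral_inner_const hf]
  unfold cfun
  rw [← h1, ← h2, intervalIntegral.integral_sub, intervalIntegral.integral_const_mul,
    intervalIntegral.integral_ofReal, intervalIntegral.integral_ofReal]
  all_goals exact Continuous.intervalIntegrable (by fun_prop) _ _

/-- A continuous loop with vanishing Fourier coefficients vanishes. -/
theorem eq_zero_of_fc_eq_zero {f : ℝ → E} (hf : Continuous f) (h01 : f 0 = f 1)
    (h : ∀ k, S.fc k f = 0) {t : ℝ} (ht : t ∈ Icc (0 : ℝ) 1) : f t = 0 := by
  have key : ∀ t ∈ Ico (0 : ℝ) 1, f t = 0 := by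
    intro t ht
    have : Fact ((0 : ℝ) < 1) := ⟨one_pos⟩
    have hv : ∀ v, S.cfun v (f t) = 0 := by
      intro v
      set g : ℝ → ℂ := fun s => S.cfun v (f s) with hg
      have hgc : Continuous g := (S.continuous_cfun v).comp hf
      let F : C(AddCircle (1 : ℝ), ℂ) := ⟨AddCircle.liftIco 1 0 g,
        AddCircle.liftIco_zero_continuous (by simp [hg, h01]) hgc.continuousOn⟩
      have hF : ∀ k, fourierCoeff F k = 0 := by
        intro k
        change fourierCoeff (AddCircle.liftIco 1 0 g) k = 0
        rw [fourierCoeff_liftIco_eq, fourierCoeffOn_eq_integral]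
        have : ∀ x : ℝ, (fourier (-k) (x : AddCircle ((0 : ℝ) + 1 - 0))) • g x
            = S.cfun v (S.rot (-(2 * π * k * x)) (f x)) := by
          intro x
          rw [cfun_rot, fourier_coe_apply, smul_eq_mul]
          congr 2
          push_cast
          ring
        simp_rw [this]
        rw [zero_add, S.integral_cfun v (S.continuous_rot_apply (by fun_prop) hf)]
        have h0 := h k
        unfold fc at h0
        rw [h0]
        simp [cfun]
      have h1 := hasSum_fourier_series_of_summable (f := F)
        (by rw [show fourierCoeff F = 0 from funext hF]; exact summable_zero)
      simp_rw [hF, zero_smul] at h1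
      have h2 : F = 0 := h1.unique hasSum_zero
      have h3 := congrArg (fun F : C(AddCircle (1 : ℝ), ℂ) => F (t : AddCircle (1 : ℝ))) h2
      change AddCircle.liftIco 1 0 g t = 0 at h3
      rwa [AddCircle.liftIco_zero_coe_apply ht] at h3
    have := congrArg Complex.re (hv (f t))
    rw [cfun, inner_J_self, real_inner_self_eq_norm_sq] at this
    simpa [← Complex.ofReal_pow] using this
  rcases eq_or_lt_of_le ht.2 with h1 | h1
  · rw [h1, ← h01]; exact key 0 ⟨le_rfl, one_pos⟩
  · exact key t ⟨ht.1, h1⟩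

/-- The minimax value of the action on the `m`-th Galerkin space. -/
def specSeq (κ : ℤ) (K : E → ℝ) (m : ℕ) : ℝ := minimaxVal (proj m κ) (S.action m K)

/-- The spectral value of a Hamiltonian. -/
def specVal (κ : ℤ) (K : E → ℝ) : ℝ := limUnder (hyperfilter ℕ : Filter ℕ) (S.specSeq κ K)

variable {S} {κ : ℤ} {Q Q' : E →L[ℝ] E} {d d' : ℝ} {K K' : E → ℝ} {G G' : E → E}

namespace Adm

theorem le_specSeq (h : S.Adm κ Q d K G) {B : ℝ} (hB : ∀ x, K x ≤ π * inner ℝ (Q x) x + B)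
    (m : ℕ) : -B ≤ S.specSeq κ K m :=
  le_minimaxVal (proj_proj κ) (continuous_action h.continuous_ham) (h.antiCoercive m)
    (map_zero _) fun _ hx => h.neg_le_action hB hx

theorem specSeq_le (h : S.Adm κ Q d K G) {B : ℝ} (hB : ∀ x, π * inner ℝ (Q x) x - B ≤ K x)
    (m : ℕ) : S.specSeq κ K m ≤ B := by
  obtain ⟨lo, hlo⟩ := h.exists_lower
  refine minimaxVal_le (proj_proj κ) (map_zero _) (hlo m) id_mem_linkMaps fun x hx => ?_
  have h1 := action_le_quadAction (S := S) (m := m) (Q := Q) h.continuous_ham hB x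
  have h2 := h.quadAction_le hx
  have : 0 ≤ π * d * ‖x‖ ^ 2 := by have := h.pos; positivity
  linarith

theorem tendsto_specSeq (h : S.Adm κ Q d K G) :
    Tendsto (S.specSeq κ K) (hyperfilter ℕ : Filter ℕ) (𝓝 (S.specVal κ K)) := by
  obtain ⟨B, hB⟩ := h.bdK
  have hmem : ∀ m, S.specSeq κ K m ∈ Icc (-B) B := fun m =>
    ⟨h.le_specSeq (fun x => by linarith [(abs_le.1 (hB x)).2]) m,
      h.specSeq_le (fun x => by linarith [(abs_le.1 (hB x)).1]) m⟩
  obtain ⟨c, -, hc⟩ := (isCompact_Icc (a := -B) (b := B)).ultrafilter_le_nhds'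
    ((hyperfilter ℕ).map (S.specSeq κ K)) (Ultrafilter.mem_map.2 (univ_mem' hmem))
  exact tendsto_nhds_limUnder ⟨c, hc⟩

theorem le_specVal (h : S.Adm κ Q d K G) {b : ℝ} (hb : ∀ᶠ m in atTop, b ≤ S.specSeq κ K m) :
    b ≤ S.specVal κ K :=
  ge_of_tendsto h.tendsto_specSeq (Nat.hyperfilter_le_atTop hb)

theorem specVal_le (h : S.Adm κ Q d K G) {b : ℝ} (hb : ∀ᶠ m in atTop, S.specSeq κ K m ≤ b) :
    S.specVal κ K ≤ b :=
  le_of_tendsto h.tendsto_specSeq (Nat.hyperfilter_le_atTop hb)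

theorem specVal_le_of_quad_le (h : S.Adm κ Q d K G) {B : ℝ}
    (hB : ∀ x, π * inner ℝ (Q x) x - B ≤ K x) : S.specVal κ K ≤ B :=
  h.specVal_le (Eventually.of_forall (h.specSeq_le hB))

theorem le_specVal_of_le_quad (h : S.Adm κ Q d K G) {B : ℝ}
    (hB : ∀ x, K x ≤ π * inner ℝ (Q x) x - B) : B ≤ S.specVal κ K :=
  h.le_specVal (Eventually.of_forall fun m => by
    simpa using h.le_specSeq (B := -B) (fun x => by linarith [hB x]) m)

theorem specVal_le_add (h : S.Adm κ Q d K G) (h' : S.Adm κ Q' d' K' G') {ε : ℝ}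
    (hle : ∀ x, K' x ≤ K x + ε) : S.specVal κ K ≤ S.specVal κ K' + ε := by
  refine le_of_tendsto_of_tendsto' h.tendsto_specSeq (h'.tendsto_specSeq.add_const ε) fun m => ?_
  obtain ⟨lo, hlo⟩ := h.exists_lower
  exact minimaxVal_le_add (proj_proj κ) (continuous_action h'.continuous_ham) (h'.antiCoercive m)
    (hlo m) (action_le_action h.continuous_ham h'.continuous_ham hle)

theorem specVal_anti (h : S.Adm κ Q d K G) (h' : S.Adm κ Q' d' K' G') (hle : ∀ x, K' x ≤ K x) :
    S.specVal κ K ≤ S.specVal κ K' := by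
  simpa using specVal_le_add h h' (ε := 0) (fun x => by simpa using hle x)

theorem abs_specVal_sub_le (h : S.Adm κ Q d K G) (h' : S.Adm κ Q' d' K' G') {ε : ℝ}
    (hle : ∀ x, |K x - K' x| ≤ ε) : |S.specVal κ K - S.specVal κ K'| ≤ ε := by
  have h1 := specVal_le_add h h' (ε := ε) fun x => by linarith [(abs_le.1 (hle x)).1]
  have h2 := specVal_le_add h' h (ε := ε) fun x => by linarith [(abs_le.1 (hle x)).2]
  rw [abs_le]; constructor <;> linarith

end Adm

theorem norm_sub_le_of_integral_sq_le {f f' : ℝ → E} (hf : ∀ t, HasDerivAt f (f' t) t)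
    (hf' : Continuous f') {C : ℝ} (hC : ∫ t in (0 : ℝ)..1, ‖f' t‖ ^ 2 ≤ C) {l : ℝ} (hl : 0 < l)
    {s t : ℝ} (hs : s ∈ Icc (0 : ℝ) 1) (ht : t ∈ Icc (0 : ℝ) 1) :
    ‖f t - f s‖ ≤ l * |t - s| / 2 + C / (2 * l) := by
  wlog hst : s ≤ t generalizing s t
  · rw [norm_sub_rev, abs_sub_comm]
    exact this ht hs (not_le.1 hst).le
  rw [← intervalIntegral.integral_eq_sub_of_hasDerivAt (fun x _ => hf x)
    (hf'.intervalIntegrable _ _), abs_of_nonneg (sub_nonneg.2 hst)]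
  refine (intervalIntegral.norm_integral_le_integral_norm hst).trans ?_
  have h1 : ∫ x in s..t, ‖f' x‖ ≤ ∫ x in s..t, (l / 2 + ‖f' x‖ ^ 2 / (2 * l)) := by
    refine intervalIntegral.integral_mono_on hst (hf'.norm.intervalIntegrable _ _)
      (Continuous.intervalIntegrable (by fun_prop) _ _) fun x _ => ?_
    have : 0 ≤ (l - ‖f' x‖) ^ 2 / (2 * l) := by positivity
    have e : (l - ‖f' x‖) ^ 2 / (2 * l) = l / 2 + ‖f' x‖ ^ 2 / (2 * l) - ‖f' x‖ := by
      field_simp; ring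
    linarith
  have h2 : ∫ x in s..t, ‖f' x‖ ^ 2 ≤ ∫ x in (0 : ℝ)..1, ‖f' x‖ ^ 2 :=
    intervalIntegral.integral_mono_interval hs.1 hst ht.2 (ae_of_all _ fun x => by positivity)
      (Continuous.intervalIntegrable (by fun_prop) _ _)
  rw [intervalIntegral.integral_add intervalIntegrable_const
    (Continuous.intervalIntegrable (by fun_prop) _ _)] at h1
  simp only [intervalIntegral.integral_const, intervalIntegral.integral_div, smul_eq_mul] at h1
  have h3 : (∫ x in s..t, ‖f' x‖ ^ 2) / (2 * l) ≤ C / (2 * l) := by gcongr; exact h2.trans hC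
  linarith

namespace Adm

/-- Bounds on critical points, uniformly in the Galerkin dimension. -/
theorem critical_bounds (h : S.Adm κ Q d K G) :
    ∃ C, 0 ≤ C ∧ ∀ (m : ℕ) (x : Gal E m), S.gradAction m G x = 0 →
      ‖x‖ ^ 2 ≤ C ∧ ‖freq m x‖ ^ 2 ≤ C := by
  obtain ⟨C, hC0, hC⟩ := h.gradAction_coercive
  obtain ⟨B, hB⟩ := h.bdG
  have hd : 0 < π * d := mul_pos pi_pos h.pos
  have hB0 : 0 ≤ B := (norm_nonneg _).trans (hB 0)
  set q := 2 * π * ‖Q‖ with hq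
  have hq0 : 0 ≤ q := by positivity
  have hC1 : 0 ≤ C / (π * d) := by positivity
  refine ⟨C / (π * d) + (2 * q ^ 2 * (C / (π * d)) + 2 * B ^ 2), by positivity,
    fun m x hx => ?_⟩
  have h1 : ‖x‖ ^ 2 ≤ C / (π * d) := by
    have := hC m x
    rw [hx, norm_zero, zero_mul, zero_add] at this
    rw [le_div_iff₀ hd]; linarith
  refine ⟨by nlinarith [sq_nonneg B, sq_nonneg q, mul_nonneg (sq_nonneg q) hC1], ?_⟩
  have h2 := h.inner_gradAction x (freq m x)
  rw [hx, inner_zero_left, real_inner_self_eq_norm_sq] at h2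
  have hcx := S.continuous_loop x
  have hcy := S.continuous_loop (freq m x)
  have hG := h.continuous_grad
  have hintg : ∀ {f : ℝ → ℝ}, Continuous f → IntervalIntegrable f volume 0 1 :=
    fun hf => hf.intervalIntegrable _ _
  have h3 : ∫ t in (0 : ℝ)..1, inner ℝ (G (S.loop x t)) (S.loop (freq m x) t)
      ≤ ∫ t in (0 : ℝ)..1, (q ^ 2 * ‖S.loop x t‖ ^ 2 + B ^ 2
        + 2⁻¹ * ‖S.loop (freq m x) t‖ ^ 2) := by
    refine intervalIntegral.integral_mono_on zero_le_one (hintg (by fun_prop))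
      (hintg (by fun_prop)) fun t _ => ?_
    have e1 := real_inner_le_norm (G (S.loop x t)) (S.loop (freq m x) t)
    have e2 : ‖G (S.loop x t)‖ ≤ q * ‖S.loop x t‖ + B := by
      have := norm_le_norm_add_norm_sub' (G (S.loop x t)) ((2 * π) • Q (S.loop x t))
      have e3 := hB (S.loop x t)
      have e4 : ‖(2 * π) • Q (S.loop x t)‖ ≤ q * ‖S.loop x t‖ := by
        rw [norm_smul, Real.norm_of_nonneg (by positivity), hq, mul_assoc (2 * π)]
        gcongr
        exact Q.le_opNorm _
      linarith
    set a := ‖G (S.loop x t)‖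
    set b := ‖S.loop (freq m x) t‖
    set c := ‖S.loop x t‖
    have ha : 0 ≤ a := norm_nonneg _
    have e5 : a ^ 2 ≤ (q * c + B) ^ 2 := by gcongr
    nlinarith [sq_nonneg (a - b), sq_nonneg (q * c - B)]
  rw [intervalIntegral.integral_add (hintg (by fun_prop)) (hintg (by fun_prop)),
    intervalIntegral.integral_add (hintg (by fun_prop)) (hintg (by fun_prop)),
    intervalIntegral.integral_const_mul, intervalIntegral.integral_const_mul,
    integral_norm_sq_loop, integral_norm_sq_loop] at h3
  simp at h3
  nlinarith [sq_nonneg q, mul_le_mul_of_nonneg_left h1 (sq_nonneg q)]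

end Adm
end LinSymp

namespace LinSymp
variable {E : Type*} [NormedAddCommGroup E] [InnerProductSpace ℝ E] [FiniteDimensional ℝ E]
variable {S : LinSymp E} {m : ℕ}
variable {κ : ℤ} {Q Q' : E →L[ℝ] E} {d d' : ℝ} {K K' : E → ℝ} {G G' : E → E}

/-- The restriction of a loop to the unit interval. -/
def toBdd (f : ℝ → E) (hf : Continuous f) : BoundedContinuousFunction unitInterval E :=
  BoundedContinuousFunction.mkOfCompact ⟨fun t => f t, hf.comp continuous_subtype_val⟩

/-- The extension of a function on the unit interval to the line. -/
def ext01 (f : BoundedContinuousFunction unitInterval E) (t : ℝ) : E :=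
  f (projIcc 0 1 zero_le_one t)

theorem continuous_ext01_uncurry :
    Continuous fun p : BoundedContinuousFunction unitInterval E × ℝ => ext01 p.1 p.2 := by
  unfold ext01
  fun_prop

theorem continuous_ext01 (f : BoundedContinuousFunction unitInterval E) :
    Continuous (ext01 f) :=
  continuous_ext01_uncurry.comp (continuous_const.prodMk continuous_id)

theorem ext01_toBdd {f : ℝ → E} (hf : Continuous f) {t : ℝ} (ht : t ∈ Icc (0 : ℝ) 1) :
    ext01 (toBdd f hf) t = f t := by
  change f (projIcc 0 1 zero_le_one t : unitInterval) = f t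
  rw [projIcc_of_mem _ ht]

theorem integral_ext01_toBdd {F : Type*} [NormedAddCommGroup F] [NormedSpace ℝ F]
    {f : ℝ → E} (hf : Continuous f) (Φ : ℝ → E → F) :
    ∫ t in (0 : ℝ)..1, Φ t (ext01 (toBdd f hf) t) = ∫ t in (0 : ℝ)..1, Φ t (f t) := by
  refine intervalIntegral.integral_congr fun t ht => ?_
  rw [uIcc_of_le zero_le_one] at ht
  simp only [ext01_toBdd hf ht]

theorem tendsto_integral_ext01 {F : Type*} [NormedAddCommGroup F] [NormedSpace ℝ F]
    {Φ : ℝ → E → F} (hΦ : Continuous (Function.uncurry Φ)) {ι : Type*} {l : Filter ι}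
    {f : ι → ℝ → E} (hf : ∀ i, Continuous (f i))
    {z : BoundedContinuousFunction unitInterval E}
    (hz : Tendsto (fun i => toBdd (f i) (hf i)) l (𝓝 z)) :
    Tendsto (fun i => ∫ t in (0 : ℝ)..1, Φ t (f i t)) l
      (𝓝 (∫ t in (0 : ℝ)..1, Φ t (ext01 z t))) := by
  have hc : Continuous fun z : BoundedContinuousFunction unitInterval E =>
      ∫ t in (0 : ℝ)..1, Φ t (ext01 z t) := by
    refine intervalIntegral.continuous_parametric_intervalIntegral_of_continuous'
      (f := fun (z : BoundedContinuousFunction unitInterval E) t => Φ t (ext01 z t)) ?_ 0 1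
    exact hΦ.comp (continuous_snd.prodMk continuous_ext01_uncurry)
  have := (hc.tendsto z).comp hz
  refine this.congr fun i => ?_
  exact integral_ext01_toBdd (hf i) Φ

/-- A sequence of curves with bounded energy has a convergent ultrafilter limit. -/
theorem exists_ultralimit {f f' : ℕ → ℝ → E} (hf : ∀ i t, HasDerivAt (f i) (f' i t) t)
    (hfc : ∀ i, Continuous (f i)) (hf' : ∀ i, Continuous (f' i)) {C : ℝ}
    (h1 : ∀ i, ∫ t in (0 : ℝ)..1, ‖f i t‖ ^ 2 ≤ C)
    (h2 : ∀ i, ∫ t in (0 : ℝ)..1, ‖f' i t‖ ^ 2 ≤ C) :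
    ∃ z, Tendsto (fun i => toBdd (f i) (hfc i)) (hyperfilter ℕ : Filter ℕ) (𝓝 z) := by
  have hC0 : 0 ≤ C := le_trans
    (intervalIntegral.integral_nonneg zero_le_one fun t _ => by positivity) (h1 0)
  have hosc : ∀ i {l : ℝ}, 0 < l → ∀ {s t : ℝ}, s ∈ Icc (0 : ℝ) 1 → t ∈ Icc (0 : ℝ) 1 →
      ‖f i t - f i s‖ ≤ l * |t - s| / 2 + C / (2 * l) := fun i l hl s t hs ht =>
    norm_sub_le_of_integral_sq_le (hf i) (hf' i) (h2 i) hl hs ht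
  set A : Set (BoundedContinuousFunction unitInterval E) :=
    range fun i => toBdd (f i) (hfc i) with hA
  have hbd : ∀ i {t : ℝ}, t ∈ Icc (0 : ℝ) 1 → ‖f i t‖ ≤ 2 + 2 * C := by
    intro i t ht
    have h3 : ∫ s in (0 : ℝ)..1, ‖f i t‖ ≤ ∫ s in (0 : ℝ)..1, (2 + C + ‖f i s‖ ^ 2) := by
      refine intervalIntegral.integral_mono_on zero_le_one intervalIntegrable_const
        (Continuous.intervalIntegrable (by have := hfc i; fun_prop) _ _) fun s hs => ?_
      have e1 := hosc i one_pos hs ht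
      have e2 := norm_le_norm_add_norm_sub' (f i t) (f i s)
      have e3 : |t - s| ≤ 1 := abs_le.2 ⟨by linarith [hs.2, ht.1], by linarith [ht.2, hs.1]⟩
      nlinarith [sq_nonneg (‖f i s‖ - 1)]
    rw [intervalIntegral.integral_add intervalIntegrable_const
      (Continuous.intervalIntegrable (by have := hfc i; fun_prop) _ _)] at h3
    simp at h3
    linarith [h1 i]
  have hcomp : IsCompact (closure A) := by
    refine BoundedContinuousFunction.arzela_ascoli (closedBall (0 : E) (2 + 2 * C))
      (isCompact_closedBall _ _) A ?_ ?_
    · rintro _ t ⟨i, rfl⟩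
      rw [mem_closedBall_zero_iff]
      exact hbd i t.2
    · refine Metric.uniformEquicontinuous_iff.2 (fun ε hε => ?_) |>.equicontinuous
      refine ⟨ε ^ 2 / (2 * (C + 1)), by positivity, fun s t hst => ?_⟩
      rintro ⟨_, i, rfl⟩
      rw [Subtype.dist_eq, Real.dist_eq, abs_sub_comm] at hst
      have e1 := hosc i (l := (C + 1) / ε) (by positivity) s.2 t.2
      have e2 : (C + 1) / ε * |(t : ℝ) - s| / 2 ≤ ε / 4 := by
        calc (C + 1) / ε * |(t : ℝ) - s| / 2 ≤ (C + 1) / ε * (ε ^ 2 / (2 * (C + 1))) / 2 := by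
              gcongr
          _ = ε / 4 := by field_simp; norm_num
      have e3 : C / (2 * ((C + 1) / ε)) ≤ ε / 2 := by
        rw [div_le_iff₀ (by positivity)]
        have : ε / 2 * (2 * ((C + 1) / ε)) = C + 1 := by field_simp
        linarith
      rw [dist_eq_norm, norm_sub_rev]
      exact lt_of_le_of_lt e1 (by linarith)
  obtain ⟨z, -, hz⟩ := hcomp.ultrafilter_le_nhds'
    ((hyperfilter ℕ).map fun i => toBdd (f i) (hfc i))
    (Ultrafilter.mem_map.2 (univ_mem' fun i => subset_closure ⟨i, rfl⟩))
  exact ⟨z, hz⟩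

theorem fc_primitive {X g : ℝ → E} (hX : ∀ t, HasDerivAt X (S.J (g t)) t) (hg : Continuous g)
    (h01 : X 0 = X 1) (k : ℤ) : (2 * π * k : ℝ) • S.fc k X = S.fc k g := by
  have hXc : Continuous X := continuous_iff_continuousAt.2 fun t => (hX t).continuousAt
  have hd : ∀ t, HasDerivAt (fun t : ℝ => S.J (S.rot (-(2 * π * k) * t) (X t)))
      ((2 * π * k : ℝ) • S.rot (-(2 * π * k) * t) (X t) - S.rot (-(2 * π * k) * t) (g t)) t := by
    intro t
    have h1 : HasDerivAt (fun t : ℝ => -(2 * π * k) * t) (-(2 * π * k)) t := by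
      simpa using (hasDerivAt_id t).const_mul (-(2 * π * k))
    have h2 := (h1.cos.fun_smul (hX t)).add (h1.sin.fun_smul (S.J.hasFDerivAt.comp_hasDerivAt t (hX t)))
    refine (S.J.hasFDerivAt.comp_hasDerivAt t h2).congr_deriv ?_
    simp only [rot_apply, map_add, map_smul, S.sq, map_neg, Function.comp]
    module
  have hc : ∀ {f : ℝ → E}, Continuous f → Continuous fun t : ℝ => S.rot (-(2 * π * k) * t) (f t) :=
    fun hf => S.continuous_rot_apply (by fun_prop) hf
  have h3 := intervalIntegral.integral_eq_sub_of_hasDerivAt (a := 0) (b := 1)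
    (fun t _ => hd t) (((hc hXc).const_smul _).sub (hc hg) |>.intervalIntegrable _ _)
  rw [intervalIntegral.integral_sub (((hc hXc).fun_const_smul _).intervalIntegrable _ _)
    ((hc hg).intervalIntegrable _ _), intervalIntegral.integral_smul] at h3
  have h4 : S.rot (-(2 * π * k) * 1) (X 1) = X 1 := by
    have := S.rot_two_pi_int (-k) (X 1)
    have e : 2 * π * ((-k : ℤ) : ℝ) = -(2 * π * k) * 1 := by push_cast; ring
    rwa [e] at this
  rw [h4, mul_zero, rot_zero, h01, sub_self, sub_eq_zero] at h3
  simpa [fc] using h3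

namespace Adm

/-- The spectral value is the action of a one-periodic orbit. -/
theorem exists_orbit (h : S.Adm κ Q d K G) :
    ∃ x : ℝ → E, (∀ t ∈ Icc (0 : ℝ) 1, HasDerivAt x (S.J (G (x t))) t) ∧ x 0 = x 1 ∧
      ∫ t in (0 : ℝ)..1, (2⁻¹ * inner ℝ (G (x t)) (x t) - K (x t)) = S.specVal κ K := by
  have hKc := h.continuous_ham
  have hGc := h.continuous_grad
  obtain ⟨C, hC0, hC⟩ := h.critical_bounds
  choose ξ hξ0 hξ using fun m : ℕ => h.exists_critical m (η := 1 / ((m : ℝ) + 1)) (by positivity)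
  have hlim : Tendsto (fun m => S.action m K (ξ m)) (hyperfilter ℕ : Filter ℕ)
      (𝓝 (S.specVal κ K)) := by
    have h1 : Tendsto (fun m => S.action m K (ξ m) - S.specSeq κ K m)
        (hyperfilter ℕ : Filter ℕ) (𝓝 0) :=
      (squeeze_zero_norm (fun m => hξ m) tendsto_one_div_add_atTop_nhds_zero_nat).mono_left
        Nat.hyperfilter_le_atTop
    simpa using h1.add h.tendsto_specSeq
  have hfreq : ∀ m, freq m (ξ m) = S.coef m fun t => G (S.loop (ξ m) t) := fun m =>
    sub_eq_zero.1 (hξ0 m)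
  obtain ⟨z, hz⟩ := exists_ultralimit (fun m t => S.hasDerivAt_loop (ξ m) t)
    (fun m => S.continuous_loop (ξ m)) (fun m => S.J.continuous.comp (S.continuous_loop _))
    (C := C) (fun m => by rw [integral_norm_sq_loop]; exact (hC m _ (hξ0 m)).1)
    (fun m => by simp_rw [S.norm_J]; rw [integral_norm_sq_loop]; exact (hC m _ (hξ0 m)).2)
  set X := ext01 z with hX
  have hXc : Continuous X := continuous_ext01 z
  have hfc : ∀ k : ℤ, (2 * π * k : ℝ) • S.fc k X = S.fc k fun t => G (X t) := by
    intro k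
    have e1 : Tendsto (fun m => (2 * π * k : ℝ) • S.fc k (S.loop (ξ m)))
        (hyperfilter ℕ : Filter ℕ) (𝓝 ((2 * π * k : ℝ) • S.fc k X)) :=
      (tendsto_integral_ext01 (Φ := fun t v => S.rot (-(2 * π * k * t)) v)
        (S.continuous_rot_apply (by fun_prop) (by fun_prop)) _ hz).const_smul _
    have e2 : Tendsto (fun m => S.fc k fun t => G (S.loop (ξ m) t))
        (hyperfilter ℕ : Filter ℕ) (𝓝 (S.fc k fun t => G (X t))) :=
      tendsto_integral_ext01 (Φ := fun t v => S.rot (-(2 * π * k * t)) (G v))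
        (S.continuous_rot_apply (by fun_prop) (by fun_prop)) _ hz
    refine tendsto_nhds_unique_of_eventuallyEq e1 e2 (Nat.hyperfilter_le_atTop ?_)
    filter_upwards [eventually_ge_atTop k.natAbs] with m hm
    have hk : k ∈ Finset.Icc (-(m : ℤ) - 1) (m + 1) := by
      rw [Finset.mem_Icc]; omega
    have h1 := congrArg (fun y : Gal E m => y ⟨k, hk⟩) (hfreq m)
    simp only [freq_apply, coef] at h1
    rw [S.fc_loop (ξ m) ⟨k, hk⟩]
    exact h1
  have hX01 : X 0 = X 1 := by
    have e1 : ∀ t : ℝ, Tendsto (fun m => ext01 (toBdd (S.loop (ξ m)) (S.continuous_loop _)) t)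
        (hyperfilter ℕ : Filter ℕ) (𝓝 (X t)) := fun t =>
      ((continuous_ext01_uncurry.comp (continuous_id.prodMk continuous_const)).tendsto z).comp hz
    refine tendsto_nhds_unique_of_eventuallyEq (e1 0) (e1 1) (Eventually.of_forall fun m => ?_)
    simp only [ext01_toBdd (S.continuous_loop (ξ m)) (left_mem_Icc.2 zero_le_one),
      ext01_toBdd (S.continuous_loop (ξ m)) (right_mem_Icc.2 zero_le_one), loop_one]
  set g : ℝ → E := fun t => G (X t) with hg
  have hgc : Continuous g := hGc.comp hXc
  set Y : ℝ → E := fun t => ∫ s in (0 : ℝ)..t, S.J (g s) with hY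
  have hYd : ∀ t, HasDerivAt Y (S.J (g t)) t := fun t =>
    intervalIntegral.integral_hasDerivAt_right
      ((S.J.continuous.comp hgc).intervalIntegrable _ _)
      ((S.J.continuous.comp hgc).stronglyMeasurableAtFilter _ _)
      (S.J.continuous.comp hgc).continuousAt
  have hYc : Continuous Y := continuous_iff_continuousAt.2 fun t => (hYd t).continuousAt
  have hY01 : Y 0 = Y 1 := by
    have h0 := hfc 0
    simp only [fc, Int.cast_zero, mul_zero, zero_mul, neg_zero, rot_zero, zero_smul] at h0
    have : Y 1 = S.J (∫ s in (0 : ℝ)..1, g s) :=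
      S.J.intervalIntegral_comp_comm (hgc.intervalIntegrable _ _)
    rw [this, ← h0, map_zero]
    simp [hY]
  have hfcY := fc_primitive hYd hgc hY01
  set a := S.fc 0 X - S.fc 0 Y with ha
  have hfc_lin : ∀ k : ℤ, S.fc k (fun t => X t - Y t - a)
      = S.fc k X - S.fc k Y - if k = 0 then a else 0 := by
    intro k
    have hc : ∀ {f : ℝ → E}, Continuous f → IntervalIntegrable
        (fun t : ℝ => S.rot (-(2 * π * k * t)) (f t)) volume 0 1 :=
      fun hf => (S.continuous_rot_apply (by fun_prop) hf).intervalIntegrable _ _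
    unfold fc
    simp only [map_sub]
    rw [intervalIntegral.integral_sub ((hc hXc).sub (hc hYc)) (hc continuous_const),
      intervalIntegral.integral_sub (hc hXc) (hc hYc)]
    congr 1
    have := S.integral_rot (-k) a
    simp only [neg_eq_zero] at this
    rw [← this]
    push_cast
    simp only [mul_neg, neg_mul]
  have hzero : ∀ t ∈ Icc (0 : ℝ) 1, X t - Y t - a = 0 := by
    intro t ht
    refine S.eq_zero_of_fc_eq_zero (f := fun t => X t - Y t - a) (by fun_prop)
      (by simp only [hX01, hY01]) (fun k => ?_) ht
    rw [hfc_lin]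
    split_ifs with hk
    · rw [hk, ha, sub_self]
    · have hk' : (2 * π * k : ℝ) ≠ 0 := by
        have : (k : ℝ) ≠ 0 := by exact_mod_cast hk
        positivity
      have : (2 * π * k : ℝ) • (S.fc k X - S.fc k Y) = 0 := by
        rw [smul_sub, hfc, hfcY, sub_self]
      rw [sub_zero]
      exact (smul_eq_zero.1 this).resolve_left hk'
  have hXY : ∀ t ∈ Icc (0 : ℝ) 1, Y t + a = X t := fun t ht => by
    have := hzero t ht
    rw [sub_sub, sub_eq_zero] at this
    exact this.symm
  refine ⟨fun t => Y t + a, fun t ht => ?_, by simp only [hY01], ?_⟩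
  · simp only [hXY t ht]
    exact (hYd t).add_const a
  · have e1 : Tendsto (fun m => S.action m K (ξ m)) (hyperfilter ℕ : Filter ℕ)
        (𝓝 (∫ t in (0 : ℝ)..1, (2⁻¹ * inner ℝ (G (X t)) (X t) - K (X t)))) := by
      refine (tendsto_integral_ext01 (Φ := fun _ v => 2⁻¹ * inner ℝ (G v) v - K v)
        (by unfold Function.uncurry; fun_prop) (fun m => S.continuous_loop (ξ m)) hz).congr
          fun m => ?_
      have hcl := S.continuous_loop (ξ m)
      rw [intervalIntegral.integral_sub (Continuous.intervalIntegrable (by fun_prop) _ _)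
        (Continuous.intervalIntegrable (by fun_prop) _ _), intervalIntegral.integral_const_mul]
      unfold action
      rw [hfreq m, S.inner_coef (f := fun t => G (S.loop (ξ m) t)) (by fun_prop)]
    rw [← tendsto_nhds_unique e1 hlim]
    refine intervalIntegral.integral_congr fun t ht => ?_
    rw [uIcc_of_le zero_le_one] at ht
    simp only [hXY t ht]

end Adm
end LinSymp

namespace LinSymp
variable {E : Type*} [NormedAddCommGroup E] [InnerProductSpace ℝ E] [FiniteDimensional ℝ E]
variable {S : LinSymp E} {m : ℕ}
variable {κ : ℤ} {Q Q' : E →L[ℝ] E} {d d' : ℝ} {K K' : E → ℝ} {G G' : E → E}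

/-- The loop `v` in mode `1`. -/
def mode1 (m : ℕ) (v : E) : Gal E m :=
  WithLp.toLp 2 (Pi.single ⟨1, by rw [Finset.mem_Icc]; omega⟩ v)

theorem mode1_apply (v : E) (k : Modes m) : mode1 m v k = if (k : ℤ) = 1 then v else 0 := by
  simp only [mode1, Pi.single_apply, Subtype.ext_iff]

theorem loop_mode1 (v : E) (t : ℝ) : S.loop (mode1 m v) t = S.rot (2 * π * t) v := by
  unfold loop
  rw [Finset.sum_eq_single ⟨1, by rw [Finset.mem_Icc]; omega⟩]
  · simp [mode1_apply]
  · intro k _ hk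
    have : (k : ℤ) ≠ 1 := fun h => hk (Subtype.ext h)
    simp [mode1_apply, this]
  · simp

theorem sum_mode_one (c : ℝ) : ∑ k : Modes m, (if (k : ℤ) = 1 then c else 0) = c := by
  rw [Finset.sum_eq_single ⟨1, by rw [Finset.mem_Icc]; omega⟩]
  · simp
  · intro k _ hk
    have : (k : ℤ) ≠ 1 := fun h => hk (Subtype.ext h)
    simp [this]
  · simp

theorem le_norm_sq_of_quad_lt (hQ : ∀ v, Q (S.J v) = S.J (Q v))
    (hpos : ∀ v, 0 ≤ inner ℝ (Q v) v) {e : E} (he : ‖e‖ = 1)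
    {ν : ℝ} (hν : 0 < ν) (hQe : Q e = ν • e) {M c C b : ℝ} (hM : 0 < M)
    (hMc : 4 * c ≤ M ^ 2 * ν) (hMC : 4 * C * ‖Q‖ ≤ b * (M ^ 2 * ν)) (hC : 0 ≤ C)
    (a : ℝ) {w : E} (hlt : inner ℝ (Q (S.rot a (M • e) + w)) (S.rot a (M • e) + w) < c) :
    C ≤ b * ‖w‖ ^ 2 := by
  set p := S.rot a (M • e)
  have h1 : inner ℝ (Q p) p = M ^ 2 * ν := by
    rw [S.rot_comm_of_comm hQ, S.inner_rot_rot, map_smul, hQe]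
    simp only [inner_smul_left, inner_smul_right, real_inner_self_eq_norm_sq, he,
      RCLike.conj_to_real]
    ring
  have h2 := hpos (p + w + w)
  have h3 : inner ℝ (Q (p + w + w)) (p + w + w)
      = 2 * inner ℝ (Q (p + w)) (p + w) + 2 * inner ℝ (Q w) w - inner ℝ (Q p) p := by
    simp only [map_add, inner_add_left, inner_add_right]; ring
  have h4 : inner ℝ (Q w) w ≤ ‖Q‖ * ‖w‖ ^ 2 := by
    refine (real_inner_le_norm _ _).trans ?_
    rw [pow_two, ← mul_assoc]
    exact mul_le_mul_of_nonneg_right (Q.le_opNorm w) (norm_nonneg _)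
  have h5 : M ^ 2 * ν ≤ 4 * (‖Q‖ * ‖w‖ ^ 2) := by linarith
  have h6 : 0 < M ^ 2 * ν := by positivity
  have h7 : C * (M ^ 2 * ν) ≤ b * ‖w‖ ^ 2 * (M ^ 2 * ν) := by
    calc C * (M ^ 2 * ν) ≤ C * (4 * (‖Q‖ * ‖w‖ ^ 2)) := by gcongr
      _ = (4 * C * ‖Q‖) * ‖w‖ ^ 2 := by ring
      _ ≤ (b * (M ^ 2 * ν)) * ‖w‖ ^ 2 := by gcongr
      _ = _ := by ring
  exact le_of_mul_le_mul_right h7 h6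

namespace Adm

/-- Lower bound for the spectral value, by testing with a large loop in the first mode. -/
theorem le_specVal_of_mode_one (h : S.Adm 1 Q d K G) {d₁ : ℝ} (hd₁ : 0 < d₁)
    (hQ₁ : ∀ v, inner ℝ (Q v) v ≤ (2 - d₁) * ‖v‖ ^ 2) {e : E} (he : ‖e‖ = 1) {ν : ℝ} (hν : 0 < ν)
    (hQe : Q e = ν • e) {M c C b : ℝ} (hM : 0 < M) (hMc : 4 * c ≤ M ^ 2 * ν)
    (hMC : 4 * C * ‖Q‖ ≤ π * d₁ * (M ^ 2 * ν)) (hC : 0 ≤ C)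
    (hK : ∀ x, K x ≤ π * inner ℝ (Q x) x - b ∨
      (inner ℝ (Q x) x < c ∧ K x ≤ π * inner ℝ (Q x) x - b + C)) :
    b - π * M ^ 2 * (ν - 1) ≤ S.specVal 1 K := by
  have hd := h.pos
  have hpd : 0 < π * d₁ := mul_pos pi_pos hd₁
  have hpos : ∀ v, 0 ≤ inner ℝ (Q v) v := fun v =>
    le_trans (by push_cast; positivity) (h.lower v)
  refine h.le_specVal (Eventually.of_forall fun m => ?_)
  set p : Gal E m := mode1 m (M • e) with hp
  have hpp : proj m 1 p = p := by
    ext k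
    rw [proj_apply]
    by_cases hk : (k : ℤ) = 1
    · simp [hk]
    · simp [hp, mode1_apply, hk]
  refine le_minimaxVal (proj_proj 1) (continuous_action h.continuous_ham) (h.antiCoercive m)
    hpp fun x hx => ?_
  set w := x - p with hw
  have hxw : x = p + w := by rw [hw]; abel
  have hcx := S.continuous_loop x
  have hcw := S.continuous_loop w
  have hKc := h.continuous_ham
  have hintg : ∀ {f : ℝ → ℝ}, Continuous f → IntervalIntegrable f volume 0 1 :=
    fun hf => hf.intervalIntegrable _ _
  have h1 : ∫ t in (0 : ℝ)..1, K (S.loop x t) ≤ ∫ t in (0 : ℝ)..1,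
      (π * inner ℝ (Q (S.loop x t)) (S.loop x t) - b + π * d₁ * ‖S.loop w t‖ ^ 2) := by
    refine intervalIntegral.integral_mono_on zero_le_one (hintg (by fun_prop))
      (hintg (by fun_prop)) fun t _ => ?_
    have hnn : 0 ≤ π * d₁ * ‖S.loop w t‖ ^ 2 := by positivity
    rcases hK (S.loop x t) with hh | ⟨hlt, hh⟩
    · linarith
    · rw [hxw, loop_add, hp, loop_mode1] at hlt
      have := le_norm_sq_of_quad_lt h.comm hpos he hν hQe hM hMc hMC hC _ hlt
      linarith
  rw [intervalIntegral.integral_add (hintg (by fun_prop)) (hintg (by fun_prop)),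
    intervalIntegral.integral_sub (hintg (by fun_prop)) intervalIntegrable_const,
    intervalIntegral.integral_const_mul (π * d₁), integral_norm_sq_loop] at h1
  have h2 : π * d₁ * ‖w‖ ^ 2 - π * M ^ 2 * (ν - 1) ≤ S.quadAction m Q x := by
    rw [S.quadAction_eq h.comm, PiLp.norm_sq_eq_of_L2, Finset.mul_sum,
      ← sum_mode_one (m := m) (π * M ^ 2 * (ν - 1)), ← Finset.sum_sub_distrib]
    refine Finset.sum_le_sum fun k _ => ?_
    have hxk : (k : ℤ) ≤ 1 → x k = p k := fun hk => by rw [← hx, proj_apply, if_pos hk]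
    have hwk : w k = x k - p k := rfl
    rcases lt_trichotomy (k : ℤ) 1 with hk | hk | hk
    · have h0 : p k = 0 := by simp [hp, mode1_apply, hk.ne]
      simp [hwk, hxk hk.le, h0, hk.ne]
    · have h0 : p k = M • e := by simp [hp, mode1_apply, hk]
      simp only [hwk, hxk hk.le, h0, hk, map_smul, hQe, norm_smul, he, inner_smul_left,
        inner_smul_right, real_inner_self_eq_norm_sq, Real.norm_eq_abs, mul_pow, sq_abs]
      simp
      nlinarith
    · have h0 : p k = 0 := by simp [hp, mode1_apply, hk.ne']
      have hk2 : (2 : ℝ) ≤ (k : ℤ) := by exact_mod_cast hk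
      have e1 : d₁ * ‖x k‖ ^ 2 ≤ (k : ℤ) * ‖x k‖ ^ 2 - inner ℝ (Q (x k)) (x k) := by
        nlinarith [hQ₁ (x k), sq_nonneg ‖x k‖]
      have := mul_le_mul_of_nonneg_left e1 pi_pos.le
      rw [hwk, h0, sub_zero, if_neg hk.ne']
      linarith
  unfold quadAction at h2
  unfold action
  simp only [intervalIntegral.integral_const, smul_eq_mul, sub_zero, one_mul] at h1
  linarith

/-- Upper bound for the spectral value, by testing with a large loop in the first mode. -/
theorem specVal_le_of_mode_one (h : S.Adm 0 Q d K G) {d₁ : ℝ} (hd₁ : 0 < d₁)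
    (hQ₁ : ∀ v, d₁ * ‖v‖ ^ 2 ≤ inner ℝ (Q v) v) {e : E} (he : ‖e‖ = 1) {ν : ℝ} (hν : 0 < ν)
    (hQe : Q e = ν • e) {M c C b : ℝ} (hM : 0 < M) (hMc : 4 * c ≤ M ^ 2 * ν)
    (hMC : 4 * C * ‖Q‖ ≤ π * d₁ * (M ^ 2 * ν)) (hC : 0 ≤ C)
    (hK : ∀ x, π * inner ℝ (Q x) x - b ≤ K x ∨
      (inner ℝ (Q x) x < c ∧ π * inner ℝ (Q x) x - b - C ≤ K x)) :
    S.specVal 0 K ≤ b + π * M ^ 2 * (1 - ν) := by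
  have hd := h.pos
  have hpd : 0 < π * d₁ := mul_pos pi_pos hd₁
  have hpos : ∀ v, 0 ≤ inner ℝ (Q v) v := fun v =>
    le_trans (by push_cast; positivity) (h.lower v)
  refine h.specVal_le (Eventually.of_forall fun m => ?_)
  set p : Gal E m := mode1 m (M • e) with hp
  obtain ⟨lo, hlo⟩ := h.exists_lower
  refine minimaxVal_le (γ := fun v => v + p) (proj_proj 0) (map_zero _) (hlo m)
    ⟨by fun_prop, ‖p‖, fun x _ => by simp⟩ fun w hw => ?_
  set x := w + p with hx
  have hxw : x = p + w := by rw [hx, add_comm]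
  have hcx := S.continuous_loop x
  have hcw := S.continuous_loop w
  have hKc := h.continuous_ham
  have hintg : ∀ {f : ℝ → ℝ}, Continuous f → IntervalIntegrable f volume 0 1 :=
    fun hf => hf.intervalIntegrable _ _
  have h1 : ∫ t in (0 : ℝ)..1,
      (π * inner ℝ (Q (S.loop x t)) (S.loop x t) - b - π * d₁ * ‖S.loop w t‖ ^ 2)
      ≤ ∫ t in (0 : ℝ)..1, K (S.loop x t) := by
    refine intervalIntegral.integral_mono_on zero_le_one (hintg (by fun_prop))
      (hintg (by fun_prop)) fun t _ => ?_
    have hnn : 0 ≤ π * d₁ * ‖S.loop w t‖ ^ 2 := by positivity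
    rcases hK (S.loop x t) with hh | ⟨hlt, hh⟩
    · linarith
    · rw [hxw, loop_add, hp, loop_mode1] at hlt
      have := le_norm_sq_of_quad_lt h.comm hpos he hν hQe hM hMc hMC hC _ hlt
      linarith
  rw [intervalIntegral.integral_sub (hintg (by fun_prop)) (hintg (by fun_prop)),
    intervalIntegral.integral_sub (hintg (by fun_prop)) intervalIntegrable_const,
    intervalIntegral.integral_const_mul (π * d₁), integral_norm_sq_loop] at h1
  have h2 : S.quadAction m Q x ≤ π * M ^ 2 * (1 - ν) - π * d₁ * ‖w‖ ^ 2 := by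
    rw [S.quadAction_eq h.comm, PiLp.norm_sq_eq_of_L2, Finset.mul_sum,
      ← sum_mode_one (m := m) (π * M ^ 2 * (1 - ν)), ← Finset.sum_sub_distrib]
    refine Finset.sum_le_sum fun k _ => ?_
    have hwk0 : 0 < (k : ℤ) → w k = 0 := fun hk => by
      rw [← hw, proj_apply, if_neg (not_le.2 hk)]
    have hxk : x k = w k + p k := rfl
    rcases lt_trichotomy (k : ℤ) 1 with hk | hk | hk
    · have h0 : p k = 0 := by simp [hp, mode1_apply, hk.ne]
      have hk2 : ((k : ℤ) : ℝ) ≤ 0 := by exact_mod_cast (by omega : (k : ℤ) ≤ 0)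
      have e1 : (k : ℤ) * ‖w k‖ ^ 2 - inner ℝ (Q (w k)) (w k) ≤ -(d₁ * ‖w k‖ ^ 2) := by
        nlinarith [hQ₁ (w k), sq_nonneg ‖w k‖]
      have := mul_le_mul_of_nonneg_left e1 pi_pos.le
      rw [hxk, h0, add_zero, if_neg hk.ne]
      linarith
    · have h0 : p k = M • e := by simp [hp, mode1_apply, hk]
      simp only [hxk, hwk0 (by omega), zero_add, h0, hk, map_smul, hQe, norm_smul, he,
        inner_smul_left,
        inner_smul_right, real_inner_self_eq_norm_sq, Real.norm_eq_abs, mul_pow, sq_abs]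
      simp
      nlinarith
    · have h0 : p k = 0 := by simp [hp, mode1_apply, hk.ne']
      simp [hxk, hwk0 (by omega), h0, hk.ne']
  unfold quadAction at h2
  unfold action
  simp only [intervalIntegral.integral_const, smul_eq_mul, sub_zero, one_mul] at h1
  linarith

end Adm
end LinSymp

namespace LinSymp
variable {E : Type*} [NormedAddCommGroup E] [InnerProductSpace ℝ E] [FiniteDimensional ℝ E]
variable {S : LinSymp E} {ι : Type*} [Fintype ι] [DecidableEq ι]

/-- A positive quadratic form diagonalised by `J`-invariant orthogonal projections. -/
structure Ell (S : LinSymp E) (ι : Type*) [Fintype ι] [DecidableEq ι] where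
  /-- the projections -/
  P : ι → E →L[ℝ] E
  /-- the eigenvalues -/
  μ : ι → ℝ
  sum : ∀ x, ∑ i, P i x = x
  comm : ∀ i v, P i (S.J v) = S.J (P i v)
  symm : ∀ i v w, inner ℝ (P i v) w = inner ℝ v (P i w)
  mul : ∀ i j v, P i (P j v) = if i = j then P j v else 0
  pos : ∀ i, 0 < μ i

namespace Ell
variable (A : Ell S ι)

/-- The symmetric operator of the quadratic form. -/
def D : E →L[ℝ] E := ∑ i, A.μ i • A.P i

/-- The quadratic form. -/
def N (x : E) : ℝ := inner ℝ (A.D x) x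

theorem D_apply (x : E) : A.D x = ∑ i, A.μ i • A.P i x := by
  simp [D]

theorem D_comm (v : E) : A.D (S.J v) = S.J (A.D v) := by
  simp [D_apply, A.comm, map_sum]

theorem D_symm (v w : E) : inner ℝ (A.D v) w = inner ℝ v (A.D w) := by
  simp [D_apply, sum_inner, inner_sum, inner_smul_left, inner_smul_right, A.symm]

theorem D_P (i : ι) (v : E) : A.D (A.P i v) = A.μ i • A.P i v := by
  simp [D_apply, A.mul]

theorem inner_P_self (i : ι) (v : E) : inner ℝ (A.P i v) v = ‖A.P i v‖ ^ 2 := by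
  rw [← real_inner_self_eq_norm_sq, A.symm i v (A.P i v), A.mul, if_pos rfl,
    real_inner_comm]

theorem N_eq (v : E) : A.N v = ∑ i, A.μ i * ‖A.P i v‖ ^ 2 := by
  simp [N, D_apply, sum_inner, inner_smul_left, A.inner_P_self]

theorem norm_sq_eq (v : E) : ‖v‖ ^ 2 = ∑ i, ‖A.P i v‖ ^ 2 := by
  rw [← real_inner_self_eq_norm_sq]
  nth_rw 1 [← A.sum v]
  simp [sum_inner, A.inner_P_self]

theorem N_nonneg (v : E) : 0 ≤ A.N v := by
  rw [N_eq]; exact Finset.sum_nonneg fun i _ => mul_nonneg (A.pos i).le (sq_nonneg _)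

theorem mul_norm_sq_le_N {c : ℝ} (hc : ∀ i, c ≤ A.μ i) (v : E) : c * ‖v‖ ^ 2 ≤ A.N v := by
  rw [A.norm_sq_eq, N_eq, Finset.mul_sum]
  exact Finset.sum_le_sum fun i _ => mul_le_mul_of_nonneg_right (hc i) (sq_nonneg _)

theorem N_le_mul_norm_sq {c : ℝ} (hc : ∀ i, A.μ i ≤ c) (v : E) : A.N v ≤ c * ‖v‖ ^ 2 := by
  rw [A.norm_sq_eq, N_eq, Finset.mul_sum]
  exact Finset.sum_le_sum fun i _ => mul_le_mul_of_nonneg_right (hc i) (sq_nonneg _)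

theorem exists_lower_bound : ∃ c > 0, ∀ i, c ≤ A.μ i := by
  rcases isEmpty_or_nonempty ι with h | h
  · exact ⟨1, one_pos, fun i => h.elim i⟩
  · obtain ⟨i, hi⟩ := Finite.exists_min A.μ
    exact ⟨A.μ i, A.pos i, hi⟩

theorem contDiff_N : ContDiff ℝ ∞ A.N := by
  unfold N; exact A.D.contDiff.inner ℝ contDiff_id

theorem continuous_N : Continuous A.N := A.contDiff_N.continuous

theorem hasFDerivAt_N (x : E) : HasFDerivAt A.N ((2 : ℝ) • innerSL ℝ (A.D x)) x := by
  have h := (A.D.hasFDerivAt (x := x)).inner ℝ (hasFDerivAt_id x)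
  refine h.congr_fderiv ?_
  ext v
  simp [fderivInnerCLM_apply, A.D_symm v x]
  rw [real_inner_comm v (A.D x)]; ring

theorem hasGradientAt_comp {F : ℝ → ℝ} {f' : ℝ} {x : E} (hF : HasDerivAt F f' (A.N x)) :
    HasGradientAt (fun x => F (A.N x)) ((2 * f') • A.D x) x := by
  rw [hasGradientAt_iff_hasFDerivAt]
  refine (hF.comp_hasFDerivAt x (A.hasFDerivAt_N x)).congr_fderiv ?_
  ext v
  simp; ring

theorem isCompact_sublevel (c : ℝ) : IsCompact {x | A.N x ≤ c} := by
  obtain ⟨δ, hδ, h⟩ := A.exists_lower_bound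
  refine Metric.isCompact_of_isClosed_isBounded (isClosed_le A.continuous_N continuous_const) ?_
  refine (Metric.isBounded_iff_subset_closedBall 0).2 ⟨c / δ + 1, fun x hx => ?_⟩
  have h1 := (A.mul_norm_sq_le_N h x).trans hx
  rw [mem_closedBall_zero_iff]
  have h2 : ‖x‖ ^ 2 ≤ c / δ := by rw [le_div_iff₀ hδ]; linarith
  nlinarith [norm_nonneg x, sq_nonneg (‖x‖ - 1)]

theorem adm {κ : ℤ} {α d : ℝ} (hd : 0 < d) (hlo : ∀ i, κ + d ≤ α * A.μ i)
    (hup : ∀ i, α * A.μ i ≤ κ + 1 - d) {H : E → ℝ} {gH : E → E}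
    (hH : ∀ x, HasGradientAt H (gH x) x) (hgH : ContDiff ℝ 1 gH) (hsupp : HasCompactSupport gH)
    (hHb : ∃ B, ∀ x, |H x| ≤ B) {F f : ℝ → ℝ} (hF : ∀ y, HasDerivAt F (f y) y)
    (hf : ContDiff ℝ 1 f) {Y : ℝ} (hY : ∀ y, Y ≤ y → f y = α) (b h : ℝ) :
    S.Adm κ (α • A.D) d (fun x => b + h * H x + π * F (A.N x))
      (fun x => h • gH x + (2 * π * f (A.N x)) • A.D x) := by
  have hQ : ∀ v, inner ℝ ((α • A.D) v) v = ∑ i, α * A.μ i * ‖A.P i v‖ ^ 2 := fun v => by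
    rw [_root_.smul_apply, real_inner_smul_left]
    change α * A.N v = _
    rw [A.N_eq, Finset.mul_sum]; simp_rw [mul_assoc]
  have hQN : ∀ v, inner ℝ ((α • A.D) v) v = α * A.N v := fun v => by
    rw [_root_.smul_apply, real_inner_smul_left]; rfl
  -- the difference of the gradient and its linear part
  set W : E → E := fun x => h • gH x + (2 * π * (f (A.N x) - α)) • A.D x with hW
  have hWc : ContDiff ℝ 1 W := by
    have h1 : ContDiff ℝ 1 A.N := A.contDiff_N.of_le (by norm_cast)
    have h2 : ContDiff ℝ 1 fun x => f (A.N x) := hf.comp h1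
    exact (contDiff_const.smul hgH).add
      ((contDiff_const.mul (h2.sub contDiff_const)).smul A.D.contDiff)
  have hWs : HasCompactSupport W := by
    refine HasCompactSupport.add (hsupp.smul_left (f := fun _ => h)) ?_
    refine HasCompactSupport.intro (A.isCompact_sublevel Y) fun x hx => ?_
    simp only [mem_ofPred_eq, not_le] at hx
    simp [hY _ hx.le]
  have hWe : ∀ x, h • gH x + (2 * π * f (A.N x)) • A.D x - (2 * π) • (α • A.D) x = W x := by
    intro x
    simp only [hW, _root_.smul_apply]
    module
  have hFc : Continuous F := continuous_iff_continuousAt.2 fun y => (hF y).continuousAt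
  refine ⟨fun v => by simp [A.D_comm], hd, fun v => ?_, fun v => ?_, fun x => ?_, ?_, ?_, ?_⟩
  · rw [hQ, A.norm_sq_eq, Finset.mul_sum]
    exact Finset.sum_le_sum fun i _ => mul_le_mul_of_nonneg_right (hlo i) (sq_nonneg _)
  · rw [hQ, A.norm_sq_eq, Finset.mul_sum]
    exact Finset.sum_le_sum fun i _ => mul_le_mul_of_nonneg_right (hup i) (sq_nonneg _)
  · have h1 := (hasGradientAt_iff_hasFDerivAt.1 (hH x)).const_mul h
    have h2 := (hasGradientAt_iff_hasFDerivAt.1 (A.hasGradientAt_comp (hF (A.N x)))).const_mul π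
    rw [hasGradientAt_iff_hasFDerivAt]
    refine (((hasFDerivAt_const b x).add h1).add h2).congr_fderiv ?_
    ext v
    simp; ring
  · obtain ⟨l, hl⟩ := hWc.lipschitzWith_of_hasCompactSupport hWs one_ne_zero
    have h3 := hl.add ((2 * π) • (α • A.D) : E →L[ℝ] E).lipschitz
    refine ⟨l + ‖((2 * π) • (α • A.D) : E →L[ℝ] E)‖₊, ?_⟩
    have e : (fun x => h • gH x + (2 * π * f (A.N x)) • A.D x) =
        fun x => W x + ((2 * π) • (α • A.D) : E →L[ℝ] E) x := by
      funext x; rw [← hWe x]; exact (sub_add_cancel _ _).symm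
    rw [e]; exact h3
  · obtain ⟨B, hB⟩ := hWc.continuous.bounded_above_of_compact_support hWs
    exact ⟨B, fun x => by rw [hWe]; exact hB x⟩
  · obtain ⟨B, hB⟩ := hHb
    set Z := max Y 0
    obtain ⟨C, hC⟩ := (isCompact_Icc (a := (0 : ℝ)) (b := Z)).exists_bound_of_continuousOn
      (f := fun y => F y - α * y) (by fun_prop)
    have hfar : ∀ y, 0 ≤ y → |F y - α * y| ≤ C := by
      intro y hy
      rcases le_total y Z with h1 | h1
      · exact hC y ⟨hy, h1⟩
      · have hder : ∀ z ∈ Ici Z, HasDerivWithinAt (fun y => F y - α * y) 0 (Ici Z) z := by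
          intro z hz
          have h2 := (hF z).sub ((hasDerivAt_id z).const_mul α)
          rw [hY z ((le_max_left _ _).trans hz)] at h2
          exact (h2.congr_deriv (by simp)).hasDerivWithinAt
        have h3 := (convex_Ici Z).norm_image_sub_le_of_norm_hasDerivWithin_le (C := 0) hder
          (by simp) (mem_Ici.2 le_rfl) (mem_Ici.2 h1)
        have h4 : F y - α * y = F Z - α * Z := by
          have : ‖F y - α * y - (F Z - α * Z)‖ ≤ 0 := by simpa using h3
          exact sub_eq_zero.1 (norm_le_zero_iff.1 this)
        rw [h4]
        exact hC Z ⟨le_max_right _ _, le_rfl⟩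
    refine ⟨|b| + |h| * B + π * C, fun x => ?_⟩
    rw [hQN]
    have h1 := hfar _ (A.N_nonneg x)
    have h2 := hB x
    have e : b + h * H x + π * F (A.N x) - π * (α * A.N x) =
      b + h * H x + π * (F (A.N x) - α * A.N x) := by ring
    rw [e]
    refine (abs_add_le _ _).trans (add_le_add ((abs_add_le _ _).trans
      (add_le_add le_rfl ?_)) ?_)
    · rw [abs_mul]; gcongr
    · rw [abs_mul, abs_of_pos pi_pos]; gcongr

end Ell

/-- Uniqueness of orbits on `[0, 1]`. -/
theorem orbit_unique {G : E → E} {l : NNReal} (hG : LipschitzWith l G) {x y : ℝ → E}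
    (hx : ∀ t ∈ Icc (0 : ℝ) 1, HasDerivAt x (S.J (G (x t))) t)
    (hy : ∀ t ∈ Icc (0 : ℝ) 1, HasDerivAt y (S.J (G (y t))) t) (h0 : x 0 = y 0) :
    ∀ t ∈ Icc (0 : ℝ) 1, x t = y t := by
  have hL : LipschitzWith (‖S.J‖₊ * l) fun z => S.J (G z) := S.J.lipschitz.comp hG
  refine ODE_solution_unique_of_mem_Icc_right (v := fun _ z => S.J (G z)) (s := fun _ => univ)
    (fun t _ => hL.lipschitzOnWith) (fun t ht => (hx t ht).continuousAt.continuousWithinAt)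
    (fun t ht => (hx t (Ico_subset_Icc_self ht)).hasDerivWithinAt) (fun _ _ => mem_univ _)
    (fun t ht => (hy t ht).continuousAt.continuousWithinAt)
    (fun t ht => (hy t (Ico_subset_Icc_self ht)).hasDerivWithinAt) (fun _ _ => mem_univ _) h0

/-- Constant orbits. -/
theorem orbit_eq_const {G : E → E} {l : NNReal} (hG : LipschitzWith l G) {x : ℝ → E}
    (hx : ∀ t ∈ Icc (0 : ℝ) 1, HasDerivAt x (S.J (G (x t))) t) (h0 : G (x 0) = 0) :
    ∀ t ∈ Icc (0 : ℝ) 1, x t = x 0 :=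
  orbit_unique (S := S) hG hx (y := fun _ => x 0)
    (fun t _ => by simpa [h0] using hasDerivAt_const t (x 0)) rfl

namespace Ell
variable (A : Ell S ι)

/-- The linear flow generated by `s π N`. -/
def flow (s : ℝ) (z : E) (t : ℝ) : E := ∑ i, S.rot (2 * π * s * A.μ i * t) (A.P i z)

theorem P_flow (s : ℝ) (z : E) (t : ℝ) (i : ι) :
    A.P i (A.flow s z t) = S.rot (2 * π * s * A.μ i * t) (A.P i z) := by
  simp only [flow, map_sum]
  rw [Finset.sum_eq_single i]
  · rw [S.rot_comm_of_comm (A.comm i), A.mul, if_pos rfl]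
  · intro j _ hj
    rw [S.rot_comm_of_comm (A.comm i), A.mul, if_neg (Ne.symm hj), map_zero]
  · simp

theorem N_flow (s : ℝ) (z : E) (t : ℝ) : A.N (A.flow s z t) = A.N z := by
  simp [N_eq, P_flow, S.norm_rot]

theorem flow_zero (s : ℝ) (z : E) : A.flow s z 0 = z := by simp [flow, A.sum]

theorem hasDerivAt_flow (s : ℝ) (z : E) (t : ℝ) :
    HasDerivAt (A.flow s z) (S.J ((2 * π * s) • A.D (A.flow s z t))) t := by
  have h := HasDerivAt.fun_sum (u := Finset.univ) fun i _ =>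
    S.hasDerivAt_rot (2 * π * s * A.μ i) (A.P i z) t
  refine h.congr_deriv ?_
  rw [D_apply, map_smul, map_sum, Finset.smul_sum]
  refine Finset.sum_congr rfl fun i _ => ?_
  rw [P_flow, map_smul, smul_smul]

/-- Periodic orbits along which the Hamiltonian is radial: the slope is integral over one of the
eigenvalues, and the quadratic form is preserved. -/
theorem far_orbit {G : E → E} {l : NNReal} (hG : LipschitzWith l G) {x : ℝ → E}
    (hx : ∀ t ∈ Icc (0 : ℝ) 1, HasDerivAt x (S.J (G (x t))) t) (h01 : x 0 = x 1) {s : ℝ}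
    (hs : ∀ y, A.N y = A.N (x 0) → G y = (2 * π * s) • A.D y) (h0 : x 0 ≠ 0) :
    (∀ t ∈ Icc (0 : ℝ) 1, A.N (x t) = A.N (x 0)) ∧ ∃ i, ∃ k : ℤ, s * A.μ i = k := by
  have h := orbit_unique (S := S) hG hx (y := A.flow s (x 0)) (fun t _ => by
    rw [hs _ (A.N_flow _ _ _)]; exact A.hasDerivAt_flow _ _ _) (A.flow_zero _ _).symm
  refine ⟨fun t ht => by rw [h t ht, A.N_flow], ?_⟩
  obtain ⟨i, hi⟩ : ∃ i, A.P i (x 0) ≠ 0 := by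
    by_contra hcon
    push Not at hcon
    exact h0 (by rw [← A.sum (x 0)]; simp [hcon])
  refine ⟨i, ?_⟩
  have h1 : S.rot (2 * π * s * A.μ i) (A.P i (x 0)) = A.P i (x 0) := by
    have := A.P_flow s (x 0) 1 i
    rw [← h 1 (by simp), ← h01, mul_one] at this
    exact this.symm
  have h2 : cos (2 * π * s * A.μ i) = 1 := by
    have h3 := congrArg (fun v => inner ℝ v (A.P i (x 0))) h1
    simp only [S.rot_apply, inner_add_left, real_inner_smul_left, S.inner_J_self, mul_zero,
      add_zero] at h3
    have h4 : inner ℝ (A.P i (x 0)) (A.P i (x 0)) ≠ 0 := inner_self_ne_zero.2 hi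
    field_simp at h3
    linarith
  obtain ⟨k, hk⟩ := (Real.cos_eq_one_iff _).1 h2
  refine ⟨k, ?_⟩
  have : 2 * π ≠ 0 := by positivity
  apply mul_left_cancel₀ this
  linarith

end Ell
end LinSymp

/-- A smooth step from `0` (left of `c`) to `1` (right of `c + τ`). -/
def stepFn (c τ y : ℝ) : ℝ := smoothTransition ((y - c) / τ)

/-- A smoothed convex corner: its slope increases from `0` to `α` on `[c, c + τ]`. -/
def corner (α c τ y : ℝ) : ℝ := ∫ s in c..y, α * stepFn c τ s

section Profiles
variable {α c τ y : ℝ}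

theorem contDiff_stepFn : ContDiff ℝ ∞ (stepFn c τ) := by
  unfold stepFn
  exact smoothTransition.contDiff.comp (by fun_prop)

theorem stepFn_nonneg : 0 ≤ stepFn c τ y := smoothTransition.nonneg _

theorem stepFn_le_one : stepFn c τ y ≤ 1 := smoothTransition.le_one _

theorem stepFn_of_le (hτ : 0 < τ) (h : y ≤ c) : stepFn c τ y = 0 :=
  smoothTransition.zero_of_nonpos (div_nonpos_of_nonpos_of_nonneg (by linarith) hτ.le)

theorem stepFn_of_ge (hτ : 0 < τ) (h : c + τ ≤ y) : stepFn c τ y = 1 :=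
  smoothTransition.one_of_one_le (by rw [le_div_iff₀ hτ]; linarith)

theorem monotone_stepFn (hτ : 0 < τ) : Monotone (stepFn c τ) := fun a b hab =>
  smoothTransition.monotone (by gcongr)

theorem hasDerivAt_corner : HasDerivAt (corner α c τ) (α * stepFn c τ y) y := by
  have hc : Continuous fun s => α * stepFn c τ s := by
    have := (contDiff_stepFn (c := c) (τ := τ)).continuous
    fun_prop
  exact intervalIntegral.integral_hasDerivAt_right (hc.intervalIntegrable _ _)
    (hc.stronglyMeasurableAtFilter _ _) hc.continuousAt

theorem intervalIntegrable_stepFn (a b : ℝ) :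
    IntervalIntegrable (fun s => α * stepFn c τ s) volume a b := by
  have := (contDiff_stepFn (c := c) (τ := τ)).continuous
  exact (Continuous.intervalIntegrable (by fun_prop) _ _)

theorem corner_of_le (hτ : 0 < τ) (h : y ≤ c) : corner α c τ y = 0 := by
  unfold corner
  rw [intervalIntegral.integral_congr (g := fun _ => 0)]
  · simp
  · intro s hs
    rw [uIcc_of_ge h] at hs
    simp [stepFn_of_le hτ hs.2]

theorem corner_nonneg (hα : 0 ≤ α) (hτ : 0 < τ) : 0 ≤ corner α c τ y := by
  rcases le_total y c with h | h
  · rw [corner_of_le hτ h]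
  · exact intervalIntegral.integral_nonneg h fun s _ => mul_nonneg hα stepFn_nonneg

theorem corner_le (hα : 0 ≤ α) (hτ : 0 < τ) (h : c ≤ y) :
    corner α c τ y ≤ α * stepFn c τ y * (y - c) := by
  calc corner α c τ y ≤ ∫ _ in c..y, α * stepFn c τ y :=
        intervalIntegral.integral_mono_on h (intervalIntegrable_stepFn _ _) (by simp)
          fun s hs => mul_le_mul_of_nonneg_left (monotone_stepFn hτ hs.2) hα
    _ = _ := by simp; ring

theorem corner_le' (hα : 0 ≤ α) (hτ : 0 < τ) (h : c ≤ y) : corner α c τ y ≤ α * (y - c) := by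
  refine (corner_le hα hτ h).trans (mul_le_mul_of_nonneg_right ?_ (by linarith))
  exact mul_le_of_le_one_right hα stepFn_le_one

theorem le_corner (hα : 0 ≤ α) (hτ : 0 < τ) : α * (y - c - τ) ≤ corner α c τ y := by
  rcases le_total y (c + τ) with h | h
  · exact (mul_nonpos_of_nonneg_of_nonpos hα (by linarith)).trans (corner_nonneg hα hτ)
  · have h1 : corner α c τ y = corner α c τ (c + τ) + ∫ s in (c + τ)..y, α * stepFn c τ s :=
      (intervalIntegral.integral_add_adjacent_intervals (intervalIntegrable_stepFn _ _)
        (intervalIntegrable_stepFn _ _)).symm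
    have h2 : ∫ s in (c + τ)..y, α * stepFn c τ s = α * (y - c - τ) := by
      rw [intervalIntegral.integral_congr (g := fun _ => α)]
      · simp; ring
      · intro s hs
        rw [uIcc_of_le h] at hs
        simp [stepFn_of_ge hτ hs.1]
    rw [h1, h2]
    linarith [corner_nonneg (c := c) (y := c + τ) hα hτ]

/-- The Legendre transform of a corner only depends on the slope. -/
theorem corner_legendre (hτ : 0 < τ) {y z : ℝ} (h : stepFn c τ y = stepFn c τ z) :
    α * stepFn c τ y * y - corner α c τ y = α * stepFn c τ z * z - corner α c τ z := by
  wlog hyz : y ≤ z generalizing y z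
  · exact (this h.symm (not_le.1 hyz).le).symm
  have h1 : corner α c τ z = corner α c τ y + ∫ s in y..z, α * stepFn c τ s :=
    (intervalIntegral.integral_add_adjacent_intervals (intervalIntegrable_stepFn _ _)
      (intervalIntegrable_stepFn _ _)).symm
  have h2 : ∫ s in y..z, α * stepFn c τ s = α * stepFn c τ y * (z - y) := by
    rw [intervalIntegral.integral_congr (g := fun _ => α * stepFn c τ y)]
    · simp; ring
    · intro s hs
      rw [uIcc_of_le hyz] at hs
      have h3 := monotone_stepFn (c := c) hτ hs.1
      have h4 := monotone_stepFn (c := c) hτ hs.2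
      simp only
      rw [le_antisymm (h4.trans h.symm.le) h3]
  rw [h1, h2, ← h]; ring

theorem hasDerivAt_stepFn : HasDerivAt (stepFn c τ) (deriv (stepFn c τ) y) y :=
  ((contDiff_stepFn.differentiable (by simp)) y).hasDerivAt

theorem contDiff_deriv_stepFn : ContDiff ℝ 1 (deriv (stepFn c τ)) :=
  (contDiff_stepFn.of_le (by norm_cast) : ContDiff ℝ 2 (stepFn c τ)).deriv' (n := 1)

theorem deriv_stepFn_nonneg (hτ : 0 < τ) : 0 ≤ deriv (stepFn c τ) y :=
  (monotone_stepFn hτ).deriv_nonneg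

theorem deriv_stepFn_of_le (hτ : 0 < τ) (h : y ≤ c) : deriv (stepFn c τ) y = 0 :=
  IsLocalMin.deriv_eq_zero (Eventually.of_forall fun z => by
    rw [stepFn_of_le hτ h]; exact stepFn_nonneg)

theorem deriv_stepFn_of_ge (hτ : 0 < τ) (h : c + τ ≤ y) : deriv (stepFn c τ) y = 0 :=
  IsLocalMax.deriv_eq_zero (Eventually.of_forall fun z => by
    rw [stepFn_of_ge hτ h]; exact stepFn_le_one)

end Profiles

namespace LinSymp
variable {E : Type*} [NormedAddCommGroup E] [InnerProductSpace ℝ E] [FiniteDimensional ℝ E]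
variable {S : LinSymp E} {ι : Type*} [Fintype ι] [DecidableEq ι]

/-- Value of the action along a periodic orbit on a level where the Hamiltonian is radial. -/
theorem Ell.far_value (A : Ell S ι) {H : E → ℝ} {gH : E → E} {F f : ℝ → ℝ} {b h H₀ : ℝ}
    {l : NNReal} (hG : LipschitzWith l fun x => h • gH x + (2 * π * f (A.N x)) • A.D x)
    {x : ℝ → E} (hx : ∀ t ∈ Icc (0 : ℝ) 1,
      HasDerivAt x (S.J (h • gH (x t) + (2 * π * f (A.N (x t))) • A.D (x t))) t)
    (h01 : x 0 = x 1) (hlev : ∀ y, A.N y = A.N (x 0) → gH y = 0 ∧ H y = H₀) :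
    (∫ t in (0 : ℝ)..1, (2⁻¹ * inner ℝ (h • gH (x t) + (2 * π * f (A.N (x t))) • A.D (x t)) (x t) -
      (b + h * H (x t) + π * F (A.N (x t)))) =
      π * (f (A.N (x 0)) * A.N (x 0) - F (A.N (x 0))) - b - h * H₀) ∧
    (x 0 = 0 ∨ ∃ i, ∃ k : ℤ, f (A.N (x 0)) * A.μ i = k) := by
  have key : (∀ t ∈ Icc (0 : ℝ) 1, A.N (x t) = A.N (x 0)) ∧
      (x 0 = 0 ∨ ∃ i, ∃ k : ℤ, f (A.N (x 0)) * A.μ i = k) := by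
    by_cases h0 : x 0 = 0
    · have := orbit_eq_const (S := S) hG hx (by
        simp only [(hlev (x 0) rfl).1, smul_zero, zero_add]; rw [h0, map_zero, smul_zero])
      exact ⟨fun t ht => by rw [this t ht], Or.inl h0⟩
    · have := A.far_orbit hG hx h01 (s := f (A.N (x 0))) (fun y hy => by
        simp only [(hlev y hy).1, smul_zero, zero_add, hy]) h0
      exact ⟨this.1, Or.inr this.2⟩
  refine ⟨?_, key.2⟩
  rw [intervalIntegral.integral_congr (g := fun _ =>
    π * (f (A.N (x 0)) * A.N (x 0) - F (A.N (x 0))) - b - h * H₀)]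
  · simp
  · intro t ht
    rw [uIcc_of_le zero_le_one] at ht
    have h1 := key.1 t ht
    have h2 := hlev (x t) h1
    simp only [h2.1, h2.2, h1, smul_zero, zero_add, real_inner_smul_left]
    have h3 : inner ℝ (A.D (x t)) (x t) = A.N (x 0) := h1
    rw [h3]; ring

/-- A function that jumps across an embedded standard shell, with the behaviour of its
Hamiltonian flow. -/
structure Barrier (A : Ell S ι) (u w s₁ s₂ H₀ H₁ : ℝ) (H : E → ℝ) (gH : E → E) : Prop where
  grad : ∀ x, HasGradientAt H (gH x) x
  smooth : ContDiff ℝ 1 gH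
  supp : ∀ x, gH x ≠ 0 → A.N x ∈ Ioo u w
  mem : ∀ x, H x ∈ Icc (0 : ℝ) 1
  dich : ∀ x, gH x = 0 → H x = 0 ∨ H x = 1
  inside : ∀ x, A.N x ≤ u → H x = H₀
  outside : ∀ x, w ≤ A.N x → H x = H₁
  orbit : ∀ h : ℝ, 0 < h → ∀ x, gH x ≠ 0 → ∃ y : ℝ → E, y 0 = x ∧
    (∀ t, HasDerivAt y (S.J (h • gH (y t))) t) ∧ (∀ t, gH (y t) ≠ 0 ∧ H (y t) = H x) ∧
    (y 0 = y 1 → ∃ k : ℕ, 1 ≤ k ∧ ∃ s ∈ Ioo s₁ s₂,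
      ∫ t in (0 : ℝ)..1, 2⁻¹ * inner ℝ (h • gH (y t)) (y t) = k * π * s)

namespace Barrier
variable {A : Ell S ι} {u w s₁ s₂ H₀ H₁ : ℝ} {H : E → ℝ} {gH : E → E}

theorem hasCompactSupport (hB : Barrier A u w s₁ s₂ H₀ H₁ H gH) : HasCompactSupport gH := by
  refine HasCompactSupport.intro (A.isCompact_sublevel w) fun x hx => ?_
  by_contra h
  exact hx (hB.supp x h).2.le

theorem gH_eq_zero (hB : Barrier A u w s₁ s₂ H₀ H₁ H gH) {x : E} (hx : w ≤ A.N x) : gH x = 0 := by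
  by_contra h
  exact absurd (hB.supp x h).2 (not_lt.2 hx)

theorem adm (hB : Barrier A u w s₁ s₂ H₀ H₁ H gH) {κ : ℤ} {α d τ : ℝ} (hd : 0 < d)
    (hlo : ∀ i, κ + d ≤ α * A.μ i) (hup : ∀ i, α * A.μ i ≤ κ + 1 - d) (hτ : 0 < τ) (b h : ℝ) :
    S.Adm κ (α • A.D) d (fun x => b + h * H x + π * corner α w τ (A.N x))
      (fun x => h • gH x + (2 * π * (α * stepFn w τ (A.N x))) • A.D x) :=
  A.adm hd hlo hup hB.grad hB.smooth hB.hasCompactSupport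
    ⟨1, fun x => abs_le.2 ⟨by linarith [(hB.mem x).1], (hB.mem x).2⟩⟩
    (F := corner α w τ) (f := fun y => α * stepFn w τ y) (fun y => hasDerivAt_corner)
    (contDiff_const.mul (contDiff_stepFn.of_le (by norm_cast))) (Y := w + τ)
    (fun y hy => by rw [stepFn_of_ge hτ hy, mul_one]) b h

/-- The possible spectral values of a barrier Hamiltonian. -/
theorem specVal_cases (hB : Barrier A u w s₁ s₂ H₀ H₁ H gH) {κ : ℤ} {α d τ : ℝ} (hd : 0 < d)
    (hlo : ∀ i, κ + d ≤ α * A.μ i) (hup : ∀ i, α * A.μ i ≤ κ + 1 - d) (hτ : 0 < τ)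
    (hw : 0 < w) (b : ℝ) {h : ℝ} (hh : 0 < h) {c : ℝ}
    (hc : S.specVal κ (fun x => b + h * H x + π * corner α w τ (A.N x)) = c) :
    (c = -b ∨ c = -b - h) ∨
    (∃ k : ℕ, 1 ≤ k ∧ ∃ s ∈ Ioo s₁ s₂, ∃ η ∈ Icc (0 : ℝ) 1, c = k * π * s - b - h * η) ∨
    ∃ y, w ≤ y ∧ c = π * (α * stepFn w τ y * y - corner α w τ y) - b - h * H₁ ∧
      ∃ i, ∃ k : ℤ, α * stepFn w τ y * A.μ i = k := by
  have hadm := hB.adm hd hlo hup hτ b h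
  obtain ⟨x, hx, h01, hval⟩ := hadm.exists_orbit
  rw [hc] at hval
  obtain ⟨l, hl⟩ := hadm.lip
  by_cases hw' : w ≤ A.N (x 0)
  · right; right
    obtain ⟨h1, h2⟩ := A.far_value (H := H) (F := corner α w τ)
      (f := fun y => α * stepFn w τ y) (b := b) (H₀ := H₁) hl hx h01
      (fun y hy => ⟨hB.gH_eq_zero (hy ▸ hw'), hB.outside y (hy ▸ hw')⟩)
    refine ⟨A.N (x 0), hw', hval.symm.trans h1, h2.resolve_left fun h0 => ?_⟩
    rw [h0] at hw'
    simp [Ell.N] at hw'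
    linarith
  push Not at hw'
  by_cases hg : gH (x 0) = 0
  · left
    have h1 := orbit_eq_const (S := S) hl hx (by
      simp [hg, stepFn_of_le hτ hw'.le])
    have h2 : c = -b - h * H (x 0) := by
      rw [← hval, intervalIntegral.integral_congr (g := fun _ => -b - h * H (x 0))]
      · simp
      · intro t ht
        rw [uIcc_of_le zero_le_one] at ht
        simp only [h1 t ht, hg, stepFn_of_le hτ hw'.le, corner_of_le hτ hw'.le]
        simp; ring
    rcases hB.dich _ hg with h3 | h3 <;> rw [h3] at h2
    · left; linarith
    · right; linarith
  · right; left
    obtain ⟨y, hy0, hy, hyg, hyk⟩ := hB.orbit h hh _ hg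
    have hstep : ∀ t, stepFn w τ (A.N (y t)) = 0 := fun t =>
      stepFn_of_le hτ (hB.supp _ (hyg t).1).2.le
    have h1 := orbit_unique (S := S) hl hx (y := y) (fun t _ => by
      simpa [hstep t] using hy t) hy0.symm
    obtain ⟨k, hk, s, hs, hintg⟩ := hyk (by
      rw [← h1 0 (by simp), ← h1 1 (by simp), h01])
    refine ⟨k, hk, s, hs, H (x 0), hB.mem _, ?_⟩
    have hyc : Continuous y := continuous_iff_continuousAt.2 fun t => (hy t).continuousAt
    have hgc := hB.smooth.continuous
    rw [← hval, intervalIntegral.integral_congr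
      (g := fun t => 2⁻¹ * inner ℝ (h • gH (y t)) (y t) - (b + h * H (x 0)))]
    · rw [intervalIntegral.integral_sub (Continuous.intervalIntegrable (by fun_prop) _ _)
        (by simp), hintg]
      simp; ring
    · intro t ht
      rw [uIcc_of_le zero_le_one] at ht
      simp only [h1 t ht, hstep t, (hyg t).2, corner_of_le hτ (hB.supp _ (hyg t).1).2.le]
      simp

end Barrier
end LinSymp

namespace LinSymp
variable {E : Type*} [NormedAddCommGroup E] [InnerProductSpace ℝ E] [FiniteDimensional ℝ E]
variable {S : LinSymp E} {ι : Type*} [Fintype ι] [DecidableEq ι]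

theorem Ell.inner_smul_D (A : Ell S ι) (α : ℝ) (x : E) :
    inner ℝ ((α • A.D) x) x = α * A.N x := by
  rw [_root_.smul_apply, real_inner_smul_left]; rfl

namespace Barrier
variable {A : Ell S ι} {u w s₁ s₂ : ℝ} {H : E → ℝ} {gH : E → E}

theorem dual_aux (hB : Barrier A u w s₁ s₂ 0 1 H gH) (hu : 0 < u) (huw : u < w) (hs₁ : 0 < s₁)
    (hμ : ∀ i, A.μ i ≤ 1) {e : E} (he : ‖e‖ = 1) (hDe : A.D e = e) {δ : ℝ} (hδ : 0 < δ)
    (hδ1 : δ ≤ 1) : s₁ ≤ w + δ := by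
  have hπ := pi_pos
  have hw : 0 < w := hu.trans huw
  set h := π * (u + w + 2) with hh
  have hh0 : 0 < h := by positivity
  obtain ⟨m, hm0, hm⟩ := A.exists_lower_bound
  set d₁ := m / 2 with hd₁
  have hd₁0 : 0 < d₁ := by positivity
  -- the size of the test loop
  obtain ⟨M, hM0, hM1, hM2⟩ : ∃ M : ℝ, 0 < M ∧ 8 * w ≤ M ^ 2 ∧
      8 * h * ‖A.D‖ ≤ π * d₁ * M ^ 2 := by
    set T := 8 * w + 8 * h * ‖A.D‖ / (π * d₁) with hT
    have hT0 : 0 < T := by positivity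
    refine ⟨√T, Real.sqrt_pos.2 hT0, ?_, ?_⟩
    · rw [Real.sq_sqrt hT0.le]
      have : 0 ≤ 8 * h * ‖A.D‖ / (π * d₁) := by positivity
      linarith
    · rw [Real.sq_sqrt hT0.le, hT, mul_add, mul_div_cancel₀ _ (by positivity)]
      have : 0 ≤ π * d₁ * (8 * w) := by positivity
      linarith
  obtain ⟨α, hα1, hα2, hα3⟩ : ∃ α : ℝ, 1 / 2 ≤ α ∧ α < 1 ∧ M ^ 2 * (1 - α) ≤ δ / 2 := by
    refine ⟨1 - min (1 / 2) (δ / 2 / M ^ 2), by linarith [min_le_left (1 / 2) (δ / 2 / M ^ 2)],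
      ?_, ?_⟩
    · have : 0 < min (1 / 2) (δ / 2 / M ^ 2) := lt_min (by norm_num) (by positivity)
      linarith
    · rw [sub_sub_cancel]
      calc M ^ 2 * min (1 / 2) (δ / 2 / M ^ 2) ≤ M ^ 2 * (δ / 2 / M ^ 2) := by
            gcongr; exact min_le_right _ _
        _ = δ / 2 := by field_simp
  have hα0 : 0 < α := by linarith
  set d := min (α * m) (1 - α) with hd
  have hd0 : 0 < d := lt_min (by positivity) (by linarith)
  have hlo : ∀ i, ((0 : ℤ) : ℝ) + d ≤ α * A.μ i := fun i => by
    push_cast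
    have := mul_le_mul_of_nonneg_left (hm i) hα0.le
    linarith [min_le_left (α * m) (1 - α)]
  have hup : ∀ i, α * A.μ i ≤ ((0 : ℤ) : ℝ) + 1 - d := fun i => by
    push_cast
    have := mul_le_mul_of_nonneg_left (hμ i) hα0.le
    linarith [min_le_right (α * m) (1 - α)]
  set τ := δ / 2 with hτ
  have hτ0 : 0 < τ := by positivity
  have hadm := hB.adm hd0 hlo hup hτ0 (-h) h
  set K : E → ℝ := fun x => -h + h * H x + π * corner α w τ (A.N x) with hK
  have hcor0 : ∀ y, 0 ≤ corner α w τ y := fun y => corner_nonneg hα0.le hτ0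
  have hlower : π * α * u ≤ S.specVal 0 K := by
    refine hadm.le_specVal_of_le_quad fun x => ?_
    rw [A.inner_smul_D]
    simp only [hK]
    rcases le_total (A.N x) u with hx | hx
    · rw [hB.inside x hx]
      have h1 : corner α w τ (A.N x) ≤ α * A.N x := by
        rcases le_total (A.N x) w with h2 | h2
        · rw [corner_of_le hτ0 h2]; exact mul_nonneg hα0.le (A.N_nonneg x)
        · refine (corner_le' hα0.le hτ0 h2).trans ?_
          gcongr; linarith
      have h3 : π * corner α w τ (A.N x) ≤ π * (α * A.N x) := by gcongr
      have h4 : π * α * u ≤ h := by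
        rw [hh]; nlinarith [mul_pos hπ hu, mul_pos hπ hw]
      linarith
    · have h1 : corner α w τ (A.N x) ≤ α * (A.N x - u) := by
        rcases le_total (A.N x) w with h2 | h2
        · rw [corner_of_le hτ0 h2]; exact mul_nonneg hα0.le (by linarith)
        · refine (corner_le' hα0.le hτ0 h2).trans ?_
          gcongr
      have h3 : π * corner α w τ (A.N x) ≤ π * (α * (A.N x - u)) := by gcongr
      have h4 : h * H x ≤ h := mul_le_of_le_one_right hh0.le (hB.mem x).2
      linarith
  have hQ₁ : ∀ v, d₁ * ‖v‖ ^ 2 ≤ inner ℝ ((α • A.D) v) v := fun v => by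
    rw [A.inner_smul_D]
    have h1 := A.mul_norm_sq_le_N hm v
    have h2 : 0 ≤ m * ‖v‖ ^ 2 := by positivity
    rw [hd₁]; nlinarith
  have hupper : S.specVal 0 K ≤ π * α * (w + τ) + π * M ^ 2 * (1 - α) := by
    refine hadm.specVal_le_of_mode_one hd₁0 hQ₁ he hα0 (by rw [_root_.smul_apply, hDe]) hM0
      (c := w) (C := h) ?_ ?_ hh0.le fun x => ?_
    · nlinarith
    · rw [norm_smul, Real.norm_of_nonneg hα0.le]
      have h1 : 4 * h * (α * ‖A.D‖) ≤ 4 * h * ‖A.D‖ := by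
        gcongr; exact mul_le_of_le_one_left (norm_nonneg _) hα2.le
      have h2 : π * d₁ * (M ^ 2 * (1 / 2)) ≤ π * d₁ * (M ^ 2 * α) := by gcongr
      linarith
    · rw [A.inner_smul_D]
      simp only [hK]
      have h1 := le_corner (c := w) (y := A.N x) hα0.le hτ0
      have h2 : π * (α * (A.N x - w - τ)) ≤ π * corner α w τ (A.N x) := by gcongr
      rcases le_or_gt w (A.N x) with hx | hx
      · left
        rw [hB.outside x hx]
        linarith
      · right
        refine ⟨?_, ?_⟩
        · nlinarith [A.N_nonneg x]
        · have h3 : 0 ≤ h * H x := mul_nonneg hh0.le (hB.mem x).1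
          linarith
  have hup2 : S.specVal 0 K ≤ π * (w + δ) := by
    have h1 : π * α * (w + τ) ≤ π * (w + τ) := by
      rw [mul_assoc]; gcongr; exact mul_le_of_le_one_left (by positivity) hα2.le
    have h2 : π * M ^ 2 * (1 - α) ≤ π * (δ / 2) := by rw [mul_assoc]; gcongr
    calc _ ≤ _ := hupper
      _ ≤ π * (w + τ) + π * (δ / 2) := add_le_add h1 h2
      _ = _ := by rw [hτ]; ring
  have hlow0 : 0 < S.specVal 0 K := lt_of_lt_of_le (by positivity) hlower
  have hlth : S.specVal 0 K < h := by
    refine hup2.trans_lt ?_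
    rw [hh]
    apply mul_lt_mul_of_pos_left _ hπ
    linarith
  rcases hB.specVal_cases hd0 hlo hup hτ0 hw (-h) hh0 rfl with hc | hc | hc
  · rcases hc with hc | hc <;> change S.specVal 0 K = _ at hc <;> linarith
  · obtain ⟨k, hk, s, hs, η, hη, hc⟩ := hc
    change S.specVal 0 K = _ at hc
    have hk' : (1 : ℝ) ≤ k := by exact_mod_cast hk
    have h1 : π * s ≤ k * π * s := by
      have : 0 < π * s := mul_pos hπ (hs₁.trans hs.1)
      nlinarith
    have h2 : h * η ≤ h := mul_le_of_le_one_right hh0.le hη.2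
    have h3 : π * s ≤ π * (w + δ) := by linarith
    have h4 := le_of_mul_le_mul_left h3 hπ
    linarith [hs.1]
  · obtain ⟨y, hy, hc, i, k, hk⟩ := hc
    change S.specVal 0 K = _ at hc
    exfalso
    have h1 : 0 ≤ α * stepFn w τ y * A.μ i :=
      mul_nonneg (mul_nonneg hα0.le stepFn_nonneg) (A.pos i).le
    have h2 : α * stepFn w τ y * A.μ i < 1 := by
      have h3 : α * stepFn w τ y ≤ α := mul_le_of_le_one_right hα0.le stepFn_le_one
      have h4 := mul_le_mul h3 (hμ i) (A.pos i).le hα0.le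
      linarith
    rw [hk] at h1 h2
    have h3 : k = 0 := by
      have : (0 : ℤ) ≤ k := by exact_mod_cast h1
      have : k < (1 : ℤ) := by exact_mod_cast h2
      omega
    rw [h3, Int.cast_zero] at hk
    have h4 : α * stepFn w τ y = 0 := (mul_eq_zero.1 hk).resolve_right (A.pos i).ne'
    have h5 := corner_le hα0.le hτ0 hy
    rw [h4, zero_mul] at h5
    have h6 := le_antisymm h5 (hcor0 y)
    rw [h4, h6] at hc
    linarith

/-- Upper bound on the size of a shell, by the dual spectral value. -/
theorem le_outer (hB : Barrier A u w s₁ s₂ 0 1 H gH) (hu : 0 < u) (huw : u < w) (hs₁ : 0 < s₁)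
    (hμ : ∀ i, A.μ i ≤ 1) {e : E} (he : ‖e‖ = 1) (hDe : A.D e = e) : s₁ ≤ w := by
  refine le_of_forall_pos_le_add fun δ hδ => ?_
  rcases le_total δ 1 with h | h
  · exact hB.dual_aux hu huw hs₁ hμ he hDe hδ h
  · exact (hB.dual_aux hu huw hs₁ hμ he hDe one_pos le_rfl).trans (by linarith)

end Barrier
end LinSymp

namespace LinSymp
variable {E : Type*} [NormedAddCommGroup E] [InnerProductSpace ℝ E] [FiniteDimensional ℝ E]
variable {S : LinSymp E} {ι : Type*} [Fintype ι] [DecidableEq ι]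

namespace Ell
variable (A : Ell S ι)

/-- The radial comparison Hamiltonian: a convex corner followed by a jump of height `h`. -/
def model (α c τ h : ℝ) (x : E) : ℝ :=
  0 + 0 * (0 : ℝ) + π * (corner α c τ (A.N x) + h / π * stepFn (c + τ) τ (A.N x))

theorem model_eq (α c τ h : ℝ) (x : E) :
    A.model α c τ h x = π * corner α c τ (A.N x) + h * stepFn (c + τ) τ (A.N x) := by
  unfold model; field_simp; ring

/-- The slope of the comparison Hamiltonian. -/
def modelSlope (α c τ h y : ℝ) : ℝ :=
  α * stepFn c τ y + h / π * deriv (stepFn (c + τ) τ) y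

theorem adm_model {κ : ℤ} {α d c τ : ℝ} (hd : 0 < d)
    (hlo : ∀ i, κ + d ≤ α * A.μ i) (hup : ∀ i, α * A.μ i ≤ κ + 1 - d) (hτ : 0 < τ) (h : ℝ) :
    S.Adm κ (α • A.D) d (A.model α c τ h)
      (fun x => (0 : ℝ) • (0 : E) + (2 * π * modelSlope α c τ h (A.N x)) • A.D x) :=
  A.adm (H := fun _ => 0) (gH := fun _ => 0) hd hlo hup (fun x => by
      rw [hasGradientAt_iff_hasFDerivAt, map_zero]; exact hasFDerivAt_const _ _)
    contDiff_const HasCompactSupport.zero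
    ⟨0, fun x => by simp⟩
    (F := fun y => corner α c τ y + h / π * stepFn (c + τ) τ y)
    (f := modelSlope α c τ h)
    (fun y => hasDerivAt_corner.add (hasDerivAt_stepFn.const_mul _))
    ((contDiff_const.mul (contDiff_stepFn.of_le (by norm_cast))).add
      (contDiff_const.mul contDiff_deriv_stepFn)) (Y := c + τ + τ)
    (fun y hy => by
      rw [modelSlope, stepFn_of_ge hτ (by linarith), deriv_stepFn_of_ge hτ hy]; ring) 0 0

/-- A finite set containing the Legendre values of a corner. -/
theorem exists_finite_legendre {α c τ : ℝ} (hτ : 0 < τ) : ∃ T : Set ℝ, T.Finite ∧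
    ∀ y i, α * stepFn c τ y * A.μ i = 1 → π * (α * stepFn c τ y * y - corner α c τ y) ∈ T := by
  classical
  refine ⟨⋃ i, {v | ∃ y, α * stepFn c τ y * A.μ i = 1 ∧
    v = π * (α * stepFn c τ y * y - corner α c τ y)}, ?_, fun y i hy =>
    mem_iUnion.2 ⟨i, y, hy, rfl⟩⟩
  refine Set.finite_iUnion fun i => Set.Subsingleton.finite ?_
  rintro _ ⟨y, hy, rfl⟩ _ ⟨z, hz, rfl⟩
  have hα : α ≠ 0 := by rintro rfl; simp at hy
  have h1 : stepFn c τ y = stepFn c τ z := by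
    have := hy.trans hz.symm
    exact mul_left_cancel₀ hα (mul_right_cancel₀ (A.pos i).ne' this)
  rw [corner_legendre hτ h1]

/-- The possible spectral values of the comparison Hamiltonian. -/
theorem specVal_model_cases {α d c τ h : ℝ} (hd : 0 < d)
    (hlo : ∀ i, ((1 : ℤ) : ℝ) + d ≤ α * A.μ i) (hup : ∀ i, α * A.μ i ≤ ((1 : ℤ) : ℝ) + 1 - d)
    (hα2 : α ≤ 2) (hμ : ∀ i, A.μ i ≤ 1) (hc : 0 < c) (hτ : 0 < τ) (hh : 0 ≤ h) :
    S.specVal 1 (A.model α c τ h) ≤ 0 ∨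
    (∃ y i, α * stepFn c τ y * A.μ i = 1 ∧
      S.specVal 1 (A.model α c τ h) = π * (α * stepFn c τ y * y - corner α c τ y)) ∨
    2 * π * c - h ≤ S.specVal 1 (A.model α c τ h) := by
  have hπ := pi_pos
  push_cast at hlo hup
  have hadm := A.adm_model (κ := 1) (c := c) hd (by exact_mod_cast hlo) (by exact_mod_cast hup) hτ h
  obtain ⟨x, hx, h01, hval⟩ := hadm.exists_orbit
  obtain ⟨l, hl⟩ := hadm.lip
  obtain ⟨h1, h2⟩ := A.far_value (H := fun _ => 0) (gH := fun _ => 0)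
    (F := fun y => corner α c τ y + h / π * stepFn (c + τ) τ y)
    (f := modelSlope α c τ h) (b := 0) (H₀ := 0) (h := 0) hl hx h01
    (fun y _ => ⟨rfl, rfl⟩)
  have hval2 := hval.symm.trans h1
  clear hval h1
  set v := S.specVal 1 (A.model α c τ h)
  set y := A.N (x 0) with hy
  have hy0 : 0 ≤ y := A.N_nonneg _
  have hstep0 : 0 ≤ h * stepFn (c + τ) τ y := mul_nonneg hh stepFn_nonneg
  have hstep1 : h * stepFn (c + τ) τ y ≤ h := mul_le_of_le_one_right hh stepFn_le_one
  have hv : v = π * (modelSlope α c τ h y * y - corner α c τ y) - h * stepFn (c + τ) τ y := by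
    rw [hval2]; field_simp; ring
  rcases h2 with h2 | ⟨i, k, hk⟩
  · left
    have hy00 : y = 0 := by rw [hy, h2]; simp [Ell.N]
    rw [hv, hy00, corner_of_le hτ hc.le, mul_zero, sub_zero, mul_zero, zero_sub]
    rw [hy00] at hstep0; linarith
  have hαi : 1 < α * A.μ i := by linarith [hlo i]
  have hα0 : 0 < α := by
    by_contra hcon
    push Not at hcon
    have := mul_nonpos_of_nonpos_of_nonneg hcon (A.pos i).le
    linarith
  rcases le_total y (c + τ) with hyc | hyc
  · have hs : modelSlope α c τ h y = α * stepFn c τ y := by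
      rw [modelSlope, deriv_stepFn_of_le hτ hyc]; ring
    rw [stepFn_of_le hτ hyc, mul_zero, sub_zero, hs] at hv
    rw [hs] at hk
    have h3 : 0 ≤ α * stepFn c τ y * A.μ i :=
      mul_nonneg (mul_nonneg hα0.le stepFn_nonneg) (A.pos i).le
    have h4 : α * stepFn c τ y * A.μ i < 2 := by
      have h5 : α * stepFn c τ y ≤ α := mul_le_of_le_one_right hα0.le stepFn_le_one
      have h6 := mul_le_mul_of_nonneg_right h5 (A.pos i).le
      linarith [hup i]
    rw [hk] at h3 h4
    have h5 : (0 : ℤ) ≤ k := by exact_mod_cast h3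
    have h6 : k < (2 : ℤ) := by exact_mod_cast h4
    obtain rfl | rfl : k = 0 ∨ k = 1 := by omega
    · left
      rw [Int.cast_zero] at hk
      have h7 : α * stepFn c τ y = 0 := (mul_eq_zero.1 hk).resolve_right (A.pos i).ne'
      rw [hv, h7]
      have := mul_nonneg hπ.le (corner_nonneg (c := c) (y := y) hα0.le hτ)
      linarith
    · right; left
      exact ⟨y, i, by rw [hk]; simp, hv⟩
  · right; right
    have hs : α ≤ modelSlope α c τ h y := by
      rw [modelSlope, stepFn_of_ge hτ hyc, mul_one]
      have : 0 ≤ h / π * deriv (stepFn (c + τ) τ) y :=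
        mul_nonneg (div_nonneg hh hπ.le) (deriv_stepFn_nonneg hτ)
      linarith
    have h3 : 1 < modelSlope α c τ h y * A.μ i :=
      hαi.trans_le (mul_le_mul_of_nonneg_right hs (A.pos i).le)
    rw [hk] at h3
    have h4 : (2 : ℤ) ≤ k := by
      have : (1 : ℤ) < k := by exact_mod_cast h3
      omega
    have h5 : (2 : ℝ) ≤ k := by exact_mod_cast h4
    have h6 : 2 ≤ modelSlope α c τ h y := by
      rw [← hk] at h5
      exact h5.trans (mul_le_of_le_one_right (by linarith) (hμ i))
    have h7 := corner_le' (c := c) (y := y) hα0.le hτ (by linarith)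
    have h8 : 2 * c ≤ modelSlope α c τ h y * y - corner α c τ y := by
      have h9 : 2 * y ≤ modelSlope α c τ h y * y := mul_le_mul_of_nonneg_right h6 hy0
      have h10 : α * (y - c) ≤ 2 * (y - c) := mul_le_mul_of_nonneg_right hα2 (by linarith)
      linarith
    have h9 := mul_le_mul_of_nonneg_left h8 hπ.le
    rw [hv]; linarith

/-- Rigidity of the spectral value of the comparison Hamiltonian in the height of the jump. -/
theorem specVal_model_eq {α d c τ h : ℝ} (hd : 0 < d)
    (hlo : ∀ i, ((1 : ℤ) : ℝ) + d ≤ α * A.μ i) (hup : ∀ i, α * A.μ i ≤ ((1 : ℤ) : ℝ) + 1 - d)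
    (hα2 : α ≤ 2) (hμ : ∀ i, A.μ i ≤ 1) (hc : 0 < c) (hτ : 0 < τ) (hh : 0 ≤ h)
    (h0 : 0 < S.specVal 1 (A.model α c τ 0))
    (h1 : S.specVal 1 (A.model α c τ 0) < 2 * π * c - h) :
    S.specVal 1 (A.model α c τ h) = S.specVal 1 (A.model α c τ 0) := by
  set v : ℝ → ℝ := fun h => S.specVal 1 (A.model α c τ h) with hv
  have hadm : ∀ h, S.Adm 1 (α • A.D) d (A.model α c τ h) _ := fun h =>
    A.adm_model (κ := 1) (c := c) hd hlo hup hτ h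
  have hLip : ∀ a b, |v a - v b| ≤ |a - b| := fun a b =>
    (hadm a).abs_specVal_sub_le (hadm b) fun x => by
      rw [model_eq, model_eq]
      have e : π * corner α c τ (A.N x) + a * stepFn (c + τ) τ (A.N x) -
        (π * corner α c τ (A.N x) + b * stepFn (c + τ) τ (A.N x)) =
        (a - b) * stepFn (c + τ) τ (A.N x) := by ring
      rw [e, abs_mul, abs_of_nonneg stepFn_nonneg]
      exact mul_le_of_le_one_right (abs_nonneg _) stepFn_le_one
  have hcont : Continuous v := by
    have : LipschitzWith 1 v := LipschitzWith.of_dist_le_mul fun a b => by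
      simpa [Real.dist_eq] using hLip a b
    exact this.continuous
  have hle : v h ≤ v 0 := (hadm h).specVal_anti (hadm 0) fun x => by
    rw [model_eq, model_eq]
    have := mul_nonneg hh (stepFn_nonneg (c := c + τ) (τ := τ) (y := A.N x))
    linarith
  by_contra hne
  have hlt : v h < v 0 := lt_of_le_of_ne hle hne
  obtain ⟨T, hT, hT'⟩ := A.exists_finite_legendre (α := α) (c := c) hτ
  have hlt2 : max (v h) 0 < v 0 := max_lt hlt h0
  obtain ⟨z, hz, hzT⟩ := ((Ioo_infinite hlt2).sdiff hT).nonempty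
  have hzm : z ∈ Icc (v h) (v 0) := ⟨(le_max_left _ _).trans hz.1.le, hz.2.le⟩
  obtain ⟨a, ha, hva⟩ := intermediate_value_Icc' hh hcont.continuousOn hzm
  rcases A.specVal_model_cases hd hlo hup hα2 hμ hc hτ ha.1 with h2 | ⟨y, i, hy, h2⟩ | h2
  · change v a ≤ 0 at h2
    have := (le_max_right (v h) 0).trans_lt hz.1
    linarith
  · change v a = _ at h2
    exact hzT (by rw [← hva, h2]; exact hT' y i hy)
  · change _ ≤ v a at h2
    change v 0 < _ at h1
    linarith [hz.2, ha.2]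

end Ell
end LinSymp

namespace LinSymp
variable {E : Type*} [NormedAddCommGroup E] [InnerProductSpace ℝ E] [FiniteDimensional ℝ E]
variable {S : LinSymp E} {ι : Type*} [Fintype ι] [DecidableEq ι]

/-- Lower bound for the spectral value of a corner Hamiltonian. -/
theorem Ell.le_specVal_corner (A : Ell S ι) {X α d d₁ c τ M : ℝ} (hd : 0 < d) (hd₁ : 0 < d₁)
    (hlo : ∀ i, ((1 : ℤ) : ℝ) + d ≤ α * A.μ i) (hup : ∀ i, α * A.μ i ≤ ((1 : ℤ) : ℝ) + 1 - d)
    (hμ : ∀ i, A.μ i ≤ 1) (hX : 0 < X) (hαX : X ≤ α) (hα2 : α ≤ 2 - d₁) (hc : 0 < c) (hτ : 0 < τ)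
    {e : E} (he : ‖e‖ = 1) (hDe : A.D e = X⁻¹ • e) (hM : 0 < M) (hM1 : 8 * c ≤ M ^ 2)
    (hM2 : 16 * c * ‖A.D‖ ≤ d₁ * M ^ 2) :
    π * α * c - π * M ^ 2 * (α / X - 1) ≤ S.specVal 1 (A.model α c τ 0) := by
  have hπ := pi_pos
  have hα0 : 0 < α := hX.trans_le hαX
  have hadm := A.adm_model (κ := 1) (c := c) hd hlo hup hτ 0
  have hαX' : 1 ≤ α / X := (one_le_div hX).2 hαX
  have hα2' : α ≤ 2 := by linarith
  have hQ₁ : ∀ v, inner ℝ ((α • A.D) v) v ≤ (2 - d₁) * ‖v‖ ^ 2 := fun v => by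
    rw [A.inner_smul_D]
    have h1 := A.N_le_mul_norm_sq hμ v
    calc α * A.N v ≤ (2 - d₁) * (1 * ‖v‖ ^ 2) :=
          mul_le_mul hα2 h1 (A.N_nonneg v) (hα0.le.trans hα2)
      _ = _ := by ring
  refine hadm.le_specVal_of_mode_one hd₁ hQ₁ he (ν := α / X) (by positivity)
    (by rw [_root_.smul_apply, hDe, smul_smul, div_eq_mul_inv]) hM (c := α * c) (C := π * α * c)
    ?_ ?_ (by positivity) fun x => ?_
  · have h1 : M ^ 2 ≤ M ^ 2 * (α / X) := le_mul_of_one_le_right (sq_nonneg _) hαX'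
    have h2 : α * c ≤ 2 * c := by gcongr
    linarith
  · rw [norm_smul, Real.norm_of_nonneg hα0.le]
    have h1 : M ^ 2 ≤ M ^ 2 * (α / X) := le_mul_of_one_le_right (sq_nonneg _) hαX'
    have h2 : π * d₁ * M ^ 2 ≤ π * d₁ * (M ^ 2 * (α / X)) := by gcongr
    have h3 : 4 * (π * α * c) * (α * ‖A.D‖) ≤ 4 * (π * 2 * c) * (2 * ‖A.D‖) := by gcongr
    have h4 : π * (16 * c * ‖A.D‖) ≤ π * (d₁ * M ^ 2) := by gcongr
    linarith
  · rw [A.inner_smul_D, A.model_eq]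
    rcases le_or_gt c (A.N x) with hx | hx
    · left
      have h1 := corner_le' hα0.le hτ hx
      have h2 : π * corner α c τ (A.N x) ≤ π * (α * (A.N x - c)) := by gcongr
      linarith
    · right
      refine ⟨by gcongr, ?_⟩
      rw [corner_of_le hτ hx.le]
      have h3 : 0 ≤ π * (α * A.N x) := mul_nonneg hπ.le (mul_nonneg hα0.le (A.N_nonneg x))
      linarith

namespace Barrier
variable {A : Ell S ι} {u w s₁ s₂ : ℝ} {H : E → ℝ} {gH : E → E}

/-- Lower bound on the size of a shell, by the primal spectral value. -/
theorem inner_le (hB : Barrier A u w s₁ s₂ 0 1 H gH) (hu : 0 < u) (huw : u < w) (hs₁ : 0 < s₁)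
    (hμ : ∀ i, A.μ i ≤ 1) {X : ℝ} (hX1 : 1 < X) (hX2 : X < 2) (hμX : ∀ i, X⁻¹ ≤ A.μ i)
    {e : E} (he : ‖e‖ = 1) (hDe : A.D e = X⁻¹ • e) (h1 : X * (w - u) < (2 - X) * u)
    (h2 : X * (2 * w - u) < 2 * s₁) : X * u ≤ s₂ := by
  by_contra hcon
  push Not at hcon
  have hπ := pi_pos
  have hX0 : 0 < X := by linarith
  have hw : 0 < w := hu.trans huw
  obtain ⟨h, hh1, hh2⟩ : ∃ h, π * (X * (w - u)) < h ∧
      h < min (π * ((2 - X) * u)) (2 * π * s₁ - π * X * w) := by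
    refine exists_between (lt_min (mul_lt_mul_of_pos_left h1 hπ) ?_)
    have := mul_lt_mul_of_pos_left h2 hπ
    linarith
  obtain ⟨hh2, hh3⟩ := lt_min_iff.1 hh2
  have hh0 : 0 < h := lt_trans (mul_pos hπ (mul_pos hX0 (by linarith))) hh1
  set d₁ := (2 - X) / 2 with hd₁
  have hd₁0 : 0 < d₁ := by rw [hd₁]; linarith
  obtain ⟨M, hM0, hM1, hM2⟩ : ∃ M : ℝ, 0 < M ∧ 8 * u ≤ M ^ 2 ∧ 16 * u * ‖A.D‖ ≤ d₁ * M ^ 2 := by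
    set T := 8 * u + 16 * u * ‖A.D‖ / d₁ with hT
    have hT0 : 0 < T := by positivity
    refine ⟨√T, Real.sqrt_pos.2 hT0, ?_, ?_⟩
    · rw [Real.sq_sqrt hT0.le]
      have : 0 ≤ 16 * u * ‖A.D‖ / d₁ := by positivity
      linarith
    · rw [Real.sq_sqrt hT0.le, hT, mul_add, mul_div_cancel₀ _ (by positivity)]
      have : 0 ≤ d₁ * (8 * u) := by positivity
      linarith
  -- choose the small parameter
  set L : ℝ → ℝ := fun t => π * (X + t) * (u - 2 * t) - π * M ^ 2 * ((X + t) / X - 1) with hL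
  have hL0 : L 0 = π * X * u := by simp [hL, hX0.ne']
  have hLc : Continuous L := by simp only [hL]; fun_prop
  have hev : ∀ {f g : ℝ → ℝ}, Continuous f → Continuous g → f 0 < g 0 →
      ∀ᶠ t in 𝓝[>] (0 : ℝ), f t < g t := fun hf hg hlt =>
    (hf.continuousAt.eventually_lt hg.continuousAt hlt).filter_mono nhdsWithin_le_nhds
  have c1 := hev (f := fun t => X + t) (g := fun _ => 2 - d₁) (by fun_prop) (by fun_prop)
    (by simp only [hd₁]; linarith)
  have c2 := hev (f := fun t => π * (X + t) * (u - t)) (g := fun t => 2 * π * (u - 2 * t) - h)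
    (by fun_prop) (by fun_prop) (by simp only [add_zero, sub_zero, mul_zero]; linarith)
  have c3 := hev (f := fun _ => π * s₂) (g := L) (by fun_prop) hLc
    (by rw [hL0, mul_assoc]; exact mul_lt_mul_of_pos_left hcon hπ)
  have c4 := hev (f := fun t => π * X * (w + t) - h) (g := L) (by fun_prop) hLc
    (by rw [hL0]; simp only [add_zero]; linarith)
  have c5 := hev (f := fun _ => 0) (g := L) (by fun_prop) hLc (by rw [hL0]; positivity)
  have c6 := hev (f := fun t => π * (X + t) * (w + t)) (g := fun _ => 2 * π * s₁ - h)
    (by fun_prop) (by fun_prop) (by simp only [add_zero]; linarith)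
  have c7 := hev (f := fun _ => 0) (g := fun t => u - 2 * t) (by fun_prop) (by fun_prop)
    (by simpa using hu)
  obtain ⟨t, ⟨⟨⟨⟨⟨⟨c1, c2⟩, c3⟩, c4⟩, c5⟩, c6⟩, c7⟩, ht⟩ :=
    ((((((c1.and c2).and c3).and c4).and c5).and c6).and c7 |>.and self_mem_nhdsWithin).exists
  have ht : 0 < t := ht
  clear hev
  set α := X + t with hα
  set c := u - 2 * t with hc
  have hα0 : 0 < α := by linarith
  have hαX : X ≤ α := by linarith
  set d := min (α / X - 1) (2 - α) with hd
  have hαX' : 1 < α / X := (one_lt_div hX0).2 (by linarith)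
  have hd0 : 0 < d := lt_min (by linarith) (by linarith)
  have hlo : ∀ i, ((1 : ℤ) : ℝ) + d ≤ α * A.μ i := fun i => by
    push_cast
    have h3 := mul_le_mul_of_nonneg_left (hμX i) hα0.le
    rw [← div_eq_mul_inv] at h3
    linarith [min_le_left (α / X - 1) (2 - α)]
  have hup : ∀ i, α * A.μ i ≤ ((1 : ℤ) : ℝ) + 1 - d := fun i => by
    push_cast
    have h3 := mul_le_mul_of_nonneg_left (hμ i) hα0.le
    linarith [min_le_right (α / X - 1) (2 - α)]
  -- the comparison Hamiltonian
  have hm0 : L t ≤ S.specVal 1 (A.model α c t 0) := by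
    refine A.le_specVal_corner hd0 hd₁0 hlo hup hμ hX0 hαX c1.le c7 ht he hDe hM0 ?_ ?_
    · linarith
    · refine le_trans ?_ hM2
      gcongr; linarith
  have hm1 : S.specVal 1 (A.model α c t 0) ≤ π * α * (c + t) := by
    refine (A.adm_model (κ := 1) (c := c) hd0 hlo hup ht 0).specVal_le_of_quad_le fun x => ?_
    rw [A.inner_smul_D, A.model_eq]
    have h3 := le_corner (c := c) (y := A.N x) hα0.le ht
    have h4 := mul_le_mul_of_nonneg_left h3 hπ.le
    linarith
  have hmh := A.specVal_model_eq (c := c) (h := h) hd0 hlo hup (by linarith) hμ c7 ht hh0.le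
    (by linarith) (by
      have e : c + t = u - t := by rw [hc]; ring
      rw [e] at hm1; linarith)
  -- the barrier Hamiltonian
  have hadm := hB.adm (κ := 1) hd0 hlo hup ht 0 h
  set K : E → ℝ := fun x => 0 + h * H x + π * corner α w t (A.N x) with hK
  have hKlow : L t ≤ S.specVal 1 K := by
    rw [← hmh] at hm0
    refine hm0.trans ((A.adm_model (κ := 1) (c := c) hd0 hlo hup ht h).specVal_anti hadm
      fun x => ?_)
    rw [A.model_eq]
    simp only [hK]
    have hcc : 0 ≤ corner α c t (A.N x) := corner_nonneg hα0.le ht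
    rcases le_or_gt (A.N x) u with hx | hx
    · rw [hB.inside x hx, corner_of_le ht (hx.trans huw.le)]
      have h3 := mul_nonneg hπ.le hcc
      have h4 := mul_nonneg hh0.le (stepFn_nonneg (c := c + t) (τ := t) (y := A.N x))
      linarith
    · rw [stepFn_of_ge ht (by linarith)]
      have h3 : h * H x ≤ h := mul_le_of_le_one_right hh0.le (hB.mem x).2
      have h4 : corner α w t (A.N x) ≤ corner α c t (A.N x) := by
        rcases le_total (A.N x) w with h5 | h5
        · rwa [corner_of_le ht h5]
        · refine (corner_le' hα0.le ht h5).trans (le_trans ?_ (le_corner hα0.le ht))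
          gcongr ?_ * ?_
          linarith
      have h5 := mul_le_mul_of_nonneg_left h4 hπ.le
      linarith
  have hKup : S.specVal 1 K ≤ π * α * (w + t) := by
    refine hadm.specVal_le_of_quad_le fun x => ?_
    rw [A.inner_smul_D]
    simp only [hK]
    have h3 := le_corner (c := w) (y := A.N x) hα0.le ht
    have h4 := mul_le_mul_of_nonneg_left h3 hπ.le
    have h5 := mul_nonneg hh0.le (hB.mem x).1
    linarith
  rcases hB.specVal_cases hd0 hlo hup ht hw 0 hh0 rfl with hv | hv | hv
  · rcases hv with hv | hv <;> change S.specVal 1 K = _ at hv <;> linarith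
  · obtain ⟨k, hk, s, hs, η, hη, hv⟩ := hv
    change S.specVal 1 K = _ at hv
    have h3 : 0 ≤ h * η := mul_nonneg hh0.le hη.1
    have h4 : h * η ≤ h := mul_le_of_le_one_right hh0.le hη.2
    have hs0 : 0 < s := hs₁.trans hs.1
    rcases hk.eq_or_lt with hk1 | hk1
    · rw [← hk1, Nat.cast_one] at hv
      have h5 : π * s < π * s₂ := mul_lt_mul_of_pos_left hs.2 hπ
      linarith
    · have h5 : (2 : ℝ) ≤ k := by exact_mod_cast hk1
      have h6 : 2 * (π * s₁) ≤ k * (π * s) := by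
        have := hs.1.le
        gcongr
      linarith
  · obtain ⟨y, hy, hv, i, k, hk⟩ := hv
    change S.specVal 1 K = _ at hv
    have hst0 : 0 ≤ α * stepFn w t y := mul_nonneg hα0.le stepFn_nonneg
    have hstα : α * stepFn w t y ≤ α := mul_le_of_le_one_right hα0.le stepFn_le_one
    have hcor0 : 0 ≤ corner α w t y := corner_nonneg hα0.le ht
    have h3 : 0 ≤ α * stepFn w t y * A.μ i := mul_nonneg hst0 (A.pos i).le
    have h4 : α * stepFn w t y * A.μ i ≤ α * A.μ i :=
      mul_le_mul_of_nonneg_right hstα (A.pos i).le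
    have h4' : α * A.μ i < 2 := by have := hup i; push_cast at this; linarith
    have h4'' : 1 < α * A.μ i := by have := hlo i; push_cast at this; linarith
    have h5 : (0 : ℤ) ≤ k := by rw [hk] at h3; exact_mod_cast h3
    have h6 : k < (2 : ℤ) := by
      have := h4.trans_lt h4'
      rw [hk] at this; exact_mod_cast this
    have hle : α * stepFn w t y ≤ X := by
      obtain rfl | rfl : k = 0 ∨ k = 1 := by omega
      · rw [Int.cast_zero] at hk
        rw [(mul_eq_zero.1 hk).resolve_right (A.pos i).ne']
        exact hX0.le
      · rw [Int.cast_one] at hk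
        have h7 := mul_le_mul_of_nonneg_left (hμX i) hst0
        rw [hk, ← div_eq_mul_inv, div_le_one hX0] at h7
        exact h7
    have hyt : y ≤ w + t := by
      by_contra hcon2
      push Not at hcon2
      rw [stepFn_of_ge ht hcon2.le, mul_one] at hle
      linarith
    have h7 : α * stepFn w t y * y ≤ X * (w + t) := mul_le_mul hle hyt (by linarith) hX0.le
    have h8 : π * (α * stepFn w t y * y - corner α w t y) ≤ π * (X * (w + t)) := by
      gcongr; linarith
    linarith

end Barrier
end LinSymp

namespace LinSymp
variable {E : Type*} [NormedAddCommGroup E] [InnerProductSpace ℝ E]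

/-- `φ` is a smooth symplectic embedding of the open set `Z`. -/
structure SympOn (S : LinSymp E) (Z : Set E) (φ : E → E) : Prop where
  isOpen : IsOpen Z
  smooth : ContDiffOn ℝ ∞ φ Z
  inj : InjOn φ Z
  symp : ∀ p ∈ Z, ∀ v w, inner ℝ (S.J (fderiv ℝ φ p v)) (fderiv ℝ φ p w) = inner ℝ (S.J v) w

namespace SympOn
variable {S : LinSymp E} {Z : Set E} {φ : E → E}

theorem mono (hφ : SympOn S Z φ) {Z' : Set E} (ho : IsOpen Z') (h : Z' ⊆ Z) : SympOn S Z' φ :=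
  ⟨ho, hφ.smooth.mono h, hφ.inj.mono h, fun p hp => hφ.symp p (h hp)⟩

theorem contDiffAt (hφ : SympOn S Z φ) {p : E} (hp : p ∈ Z) : ContDiffAt ℝ ∞ φ p :=
  hφ.smooth.contDiffAt (hφ.isOpen.mem_nhds hp)

theorem hasFDerivAt (hφ : SympOn S Z φ) {p : E} (hp : p ∈ Z) :
    HasFDerivAt φ (fderiv ℝ φ p) p :=
  ((hφ.contDiffAt hp).differentiableAt (by simp)).hasFDerivAt

theorem injective_fderiv (hφ : SympOn S Z φ) {p : E} (hp : p ∈ Z) :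
    Function.Injective (fderiv ℝ φ p) := by
  refine (injective_iff_map_eq_zero _).2 fun v hv => ?_
  have h := hφ.symp p hp v (S.J v)
  rw [hv, map_zero, inner_zero_left, eq_comm, inner_self_eq_zero] at h
  have h2 := S.sq v
  rw [h, map_zero] at h2
  exact neg_eq_zero.1 h2.symm

variable [FiniteDimensional ℝ E]

theorem exists_equiv (hφ : SympOn S Z φ) {p : E} (hp : p ∈ Z) :
    ∃ e : E ≃L[ℝ] E, (e : E →L[ℝ] E) = fderiv ℝ φ p :=
  ⟨(LinearEquiv.ofInjectiveEndo (fderiv ℝ φ p : E →ₗ[ℝ] E)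
    (hφ.injective_fderiv hp)).toContinuousLinearEquiv, by ext; rfl⟩

theorem map_nhds (hφ : SympOn S Z φ) {p : E} (hp : p ∈ Z) : map φ (𝓝 p) = 𝓝 (φ p) := by
  obtain ⟨e, he⟩ := hφ.exists_equiv hp
  have h : HasStrictFDerivAt φ (e : E →L[ℝ] E) p := by
    rw [he]; exact (hφ.contDiffAt hp).hasStrictFDerivAt (by simp)
  exact h.map_nhds_eq_of_equiv

theorem isOpen_image (hφ : SympOn S Z φ) : IsOpen (φ '' Z) := by
  rw [isOpen_iff_mem_nhds]
  rintro _ ⟨p, hp, rfl⟩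
  rw [← hφ.map_nhds hp]
  exact image_mem_map (hφ.isOpen.mem_nhds hp)

/-- A symplectic embedding has a smooth inverse on its image. -/
theorem exists_inverse (hφ : SympOn S Z φ) :
    ∃ ψ : E → E, (∀ z ∈ Z, ψ (φ z) = z) ∧ ContDiffOn ℝ ∞ ψ (φ '' Z) := by
  have hopen : IsOpenMap ((hφ.inj.toPartialEquiv φ Z).source.domRestrict
      (hφ.inj.toPartialEquiv φ Z)) := by
    intro V hV
    obtain ⟨W, hW, rfl⟩ := isOpen_induced_iff.1 hV
    convert! (hφ.mono (hφ.isOpen.inter hW) inter_subset_left).isOpen_image using 1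
    ext y
    constructor
    · rintro ⟨⟨z, hz⟩, hzW, rfl⟩
      exact ⟨z, ⟨hz, hzW⟩, rfl⟩
    · rintro ⟨z, ⟨hz, hzW⟩, rfl⟩
      exact ⟨⟨z, hz⟩, hzW, rfl⟩
  let e := OpenPartialHomeomorph.ofContinuousOpenRestrict (hφ.inj.toPartialEquiv φ Z)
    hφ.smooth.continuousOn hopen hφ.isOpen
  refine ⟨e.symm, fun z hz => e.left_inv hz, ?_⟩
  rintro _ ⟨z, hz, rfl⟩
  have hz' : e.symm (e z) = z := e.left_inv hz
  obtain ⟨A, hA⟩ := hφ.exists_equiv hz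
  refine (e.contDiffAt_symm (f₀' := A) (e.map_source hz) ?_ ?_).contDiffWithinAt
  · rw [hz', hA]; exact hφ.hasFDerivAt hz
  · rw [hz']; exact hφ.contDiffAt hz

end SympOn

section Liouville
variable (S : LinSymp E) {F : Type*} [NormedAddCommGroup F] [NormedSpace ℝ F]

/-- The pull-back under `Φ` of twice the radial primitive of the symplectic form. -/
def liouville (Φ : F → E) (p : F) : F →L[ℝ] ℝ := (innerSL ℝ (S.J (Φ p))).comp (fderiv ℝ Φ p)

theorem liouville_apply (Φ : F → E) (p v : F) :
    S.liouville Φ p v = inner ℝ (S.J (Φ p)) (fderiv ℝ Φ p v) := rfl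

theorem contDiff_liouville {Φ : F → E} (hΦ : ContDiff ℝ 2 Φ) : ContDiff ℝ 1 (S.liouville Φ) := by
  unfold liouville
  have h1 : ContDiff ℝ 1 Φ := hΦ.of_le (by norm_num)
  exact ((innerSL ℝ).contDiff.comp (S.J.contDiff.comp h1)).clm_comp
    (hΦ.fderiv_right (by norm_num))

theorem fderiv_liouville {Φ : F → E} (hΦ : ContDiff ℝ 2 Φ) (p v w : F) :
    fderiv ℝ (S.liouville Φ) p v w = inner ℝ (S.J (fderiv ℝ Φ p v)) (fderiv ℝ Φ p w)
      + inner ℝ (S.J (Φ p)) (fderiv ℝ (fderiv ℝ Φ) p v w) := by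
  have h0 : HasFDerivAt (S.liouville Φ) (fderiv ℝ (S.liouville Φ) p) p :=
    ((S.contDiff_liouville hΦ).differentiable (by norm_num) p).hasFDerivAt
  have h1 : HasFDerivAt (fun q => S.liouville Φ q w) _ p := h0.clm_apply (hasFDerivAt_const w p)
  have h2 : HasFDerivAt Φ (fderiv ℝ Φ p) p := (hΦ.differentiable (by norm_num) p).hasFDerivAt
  have h3 : HasFDerivAt (fderiv ℝ Φ) (fderiv ℝ (fderiv ℝ Φ) p) p :=
    ((hΦ.fderiv_right (m := 1) (by norm_num)).differentiable (by norm_num) p).hasFDerivAt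
  have h4 : HasFDerivAt (fun q => inner ℝ (S.J (Φ q)) (fderiv ℝ Φ q w)) _ p :=
    (S.J.hasFDerivAt.comp p h2).inner ℝ (h3.clm_apply (hasFDerivAt_const w p))
  have h := congrArg (fun L : F →L[ℝ] ℝ => L v) (h1.unique h4)
  simp at h
  rw [h]
  ring

/-- If `Φ` and `Ψ` pull the symplectic form back to the same form, then the difference of the
pulled back primitives is exact. -/
theorem exists_potential {Φ Ψ : F → E} (hΦ : ContDiff ℝ 2 Φ) (hΨ : ContDiff ℝ 2 Ψ)
    (h : ∀ p v w, inner ℝ (S.J (fderiv ℝ Φ p v)) (fderiv ℝ Φ p w)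
      = inner ℝ (S.J (fderiv ℝ Ψ p v)) (fderiv ℝ Ψ p w)) :
    ∃ f : F → ℝ, ∀ p, HasFDerivAt f (S.liouville Φ p - S.liouville Ψ p) p := by
  have hsym : ∀ {Φ : F → E}, ContDiff ℝ 2 Φ → ∀ p v w,
      fderiv ℝ (fderiv ℝ Φ) p v w = fderiv ℝ (fderiv ℝ Φ) p w v := fun hΦ p v w =>
    hΦ.contDiffAt.isSymmSndFDerivAt (by simp) v w
  have hd1 := (S.contDiff_liouville hΦ).differentiable (by norm_num)
  have hd2 := (S.contDiff_liouville hΨ).differentiable (by norm_num)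
  have hd : Differentiable ℝ fun p => S.liouville Φ p - S.liouville Ψ p := hd1.sub hd2
  obtain ⟨f, hf⟩ := convex_univ.exists_forall_hasFDerivAt_of_fderiv_symmetric (𝕜 := ℝ)
    isOpen_univ hd.differentiableOn fun p _ v w => by
      have e : fderiv ℝ (fun p => S.liouville Φ p - S.liouville Ψ p) p
          = fderiv ℝ (S.liouville Φ) p - fderiv ℝ (S.liouville Ψ) p :=
        fderiv_fun_sub (hd1 p) (hd2 p)
      simp only [e, _root_.sub_apply, S.fderiv_liouville hΦ, S.fderiv_liouville hΨ, h p,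
        hsym hΦ p v w, hsym hΨ p v w]
      ring
  exact ⟨f, fun p => hf p (mem_univ p)⟩

end Liouville

end LinSymp

/-- The open spherical shell. -/
def oshell (E : Type*) [Norm E] (ρ₁ ρ₂ : ℝ) : Set E := {z | ‖z‖ ∈ Ioo ρ₁ ρ₂}

namespace LinSymp
variable {E : Type*} [NormedAddCommGroup E] [InnerProductSpace ℝ E] [FiniteDimensional ℝ E]
variable {S : LinSymp E} {φ : E → E} {ρ₁ ρ₂ : ℝ}

theorem exists_orthogonal (S : LinSymp E) (hdim : 2 < Module.finrank ℝ E) (z : E) :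
    ∃ w : E, ‖w‖ = ‖z‖ ∧ inner ℝ z w = 0 ∧ inner ℝ (S.J z) w = 0 := by
  classical
  let V : Submodule ℝ E := Submodule.span ℝ ((({z, S.J z} : Finset E) : Set E))
  have hV : Module.finrank ℝ V ≤ 2 := (finrank_span_finset_le_card _).trans Finset.card_le_two
  have hne : Vᗮ ≠ ⊥ := by
    intro h
    have := V.finrank_add_finrank_orthogonal
    rw [h, finrank_bot] at this
    omega
  obtain ⟨x, hx, hx0⟩ := Submodule.exists_mem_ne_zero_of_ne_bot hne
  have hx' : ∀ v ∈ V, inner ℝ v x = 0 := fun v hv => (Submodule.mem_orthogonal V x).1 hx v hv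
  have h1 : inner ℝ z x = 0 := hx' z (Submodule.subset_span (by simp))
  have h2 : inner ℝ (S.J z) x = 0 := hx' _ (Submodule.subset_span (by simp))
  refine ⟨(‖z‖ / ‖x‖) • x, ?_, ?_, ?_⟩
  · rw [norm_smul, norm_div, norm_norm, norm_norm, div_mul_cancel₀ _ (norm_ne_zero_iff.2 hx0)]
  · rw [inner_smul_right, h1, mul_zero]
  · rw [inner_smul_right, h2, mul_zero]

/-- The action of the image of a Hopf circle under a symplectic embedding of a shell. -/
theorem SympOn.action_loop (hφ : SympOn S (oshell E ρ₁ ρ₂) φ) (hdim : 2 < Module.finrank ℝ E)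
    {z : E} (hz : z ∈ oshell E ρ₁ ρ₂) (k : ℤ) :
    ∫ t in (0 : ℝ)..1, inner ℝ (S.J (φ (S.rot (2 * π * k * t) z)))
      (fderiv ℝ φ (S.rot (2 * π * k * t) z) ((2 * π * k) • S.J (S.rot (2 * π * k * t) z)))
      = 2 * π * k * ‖z‖ ^ 2 := by
  obtain ⟨w, hw, hzw, hJw⟩ := S.exists_orthogonal hdim z
  let c : ℝ := 2 * π * k
  let Ψ : ℝ × ℝ → E := fun p => cos p.1 • w + sin p.1 • S.rot (c * p.2) z
  have hΨ : ContDiff ℝ ∞ Ψ := by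
    simp only [Ψ, rot_apply]
    fun_prop
  have hΨn : ∀ p, ‖Ψ p‖ = ‖z‖ := fun p => by
    have hin : inner ℝ w (S.rot (c * p.2) z) = 0 := by
      rw [rot_apply, inner_add_right, inner_smul_right, inner_smul_right, real_inner_comm,
        hzw, real_inner_comm, hJw]
      ring
    refine (sq_eq_sq₀ (norm_nonneg _) (norm_nonneg _)).1 ?_
    rw [norm_add_sq_real, norm_smul, norm_smul, inner_smul_left, inner_smul_right, hin, mul_pow,
      mul_pow, S.norm_rot, hw, Real.norm_eq_abs, Real.norm_eq_abs, sq_abs, sq_abs]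
    linear_combination ‖z‖ ^ 2 * cos_sq_add_sin_sq p.1
  have hΨZ : ∀ p, Ψ p ∈ oshell E ρ₁ ρ₂ := fun p => by
    change ‖Ψ p‖ ∈ Ioo ρ₁ ρ₂; rw [hΨn]; exact hz
  have hΦ : ContDiff ℝ ∞ (φ ∘ Ψ) := hφ.smooth.comp_contDiff hΨ hΨZ
  have hΦ2 : ContDiff ℝ 2 (φ ∘ Ψ) := by exact_mod_cast contDiff_infty.1 hΦ 2
  have hΨ2 : ContDiff ℝ 2 Ψ := by exact_mod_cast contDiff_infty.1 hΨ 2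
  have hd : ∀ p, HasFDerivAt Ψ (fderiv ℝ Ψ p) p := fun p =>
    (hΨ.differentiable (by simp) p).hasFDerivAt
  have hc : ∀ p, fderiv ℝ (φ ∘ Ψ) p = (fderiv ℝ φ (Ψ p)).comp (fderiv ℝ Ψ p) := fun p =>
    ((hφ.hasFDerivAt (hΨZ p)).comp p (hd p)).fderiv
  obtain ⟨f, hf⟩ := S.exists_potential (Φ := φ ∘ Ψ) (Ψ := Ψ) hΦ2 hΨ2
    fun p v w => by rw [hc]; exact hφ.symp _ (hΨZ p) _ _
  have h1 : ∀ s t, HasDerivAt (fun s => Ψ (s, t)) (fderiv ℝ Ψ (s, t) (1, 0)) s := fun s t => 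
    HasFDerivAt.comp_hasDerivAt (f := fun s => (s, t)) s (hd (s, t)) ((hasDerivAt_id' s).prodMk (hasDerivAt_const s t))
  have h2 : ∀ s t, HasDerivAt (fun t => Ψ (s, t)) (fderiv ℝ Ψ (s, t) (0, 1)) t := fun s t => 
    HasFDerivAt.comp_hasDerivAt (f := fun t => (s, t)) t (hd (s, t)) ((hasDerivAt_const t s).prodMk (hasDerivAt_id' t))
  have h3 : ∀ s t, HasDerivAt (fun s => f (s, t)) 
      ((S.liouville (φ ∘ Ψ) (s, t) - S.liouville Ψ (s, t)) (1, 0)) s := fun s t => 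
    HasFDerivAt.comp_hasDerivAt (f := fun s => (s, t)) s (hf (s, t)) ((hasDerivAt_id' s).prodMk (hasDerivAt_const s t))
  have h4 : ∀ s t, HasDerivAt (fun t => f (s, t)) 
      ((S.liouville (φ ∘ Ψ) (s, t) - S.liouville Ψ (s, t)) (0, 1)) t := fun s t => 
    HasFDerivAt.comp_hasDerivAt (f := fun t => (s, t)) t (hf (s, t)) ((hasDerivAt_const t s).prodMk (hasDerivAt_id' t))
  have hper : ∀ s, Ψ (s, 1) = Ψ (s, 0) := fun s => by
    simp [Ψ, c, S.rot_two_pi_int, S.rot_zero]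
  have hper' : ∀ s, fderiv ℝ Ψ (s, 1) (1, 0) = fderiv ℝ Ψ (s, 0) (1, 0) := fun s => by
    have := h1 s 1
    simp_rw [hper] at this
    exact this.unique (h1 s 0)
  have hconst : f (π / 2, 1) - f (π / 2, 0) = f (0, 1) - f (0, 0) := by
    refine is_const_of_deriv_eq_zero (f := fun s => f (s, 1) - f (s, 0))
      (fun s => ((h3 s 1).sub (h3 s 0)).differentiableAt) (fun s => ?_) _ _
    rw [((h3 s 1).fun_sub (h3 s 0)).deriv]
    simp only [_root_.sub_apply, liouville_apply, hc, ContinuousLinearMap.comp_apply,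
      Function.comp_apply, hper, hper', sub_self]
  have hzero : f (0, 1) = f (0, 0) := by
    refine is_const_of_deriv_eq_zero (f := fun t => f (0, t))
      (fun t => (h4 0 t).differentiableAt) (fun t => ?_) _ _
    have h0 : fderiv ℝ Ψ (0, t) (0, 1) = 0 := by
      refine (h2 0 t).unique ?_
      simp only [Ψ, cos_zero, sin_zero, zero_smul, add_zero, one_smul]
      exact hasDerivAt_const t w
    rw [(h4 0 t).deriv]
    simp [_root_.sub_apply, liouville_apply, hc, h0]
  have hu : ∀ t, Ψ (π / 2, t) = S.rot (c * t) z := fun t => by simp [Ψ]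
  have hu' : ∀ t, fderiv ℝ Ψ (π / 2, t) (0, 1) = c • S.J (S.rot (c * t) z) := fun t => by
    have := h2 (π / 2) t
    simp_rw [hu] at this
    exact this.unique (S.hasDerivAt_rot c z t)
  have hcont : Continuous fun t =>
      (S.liouville (φ ∘ Ψ) (π / 2, t) - S.liouville Ψ (π / 2, t)) (0, 1) := by
    have e1 := (S.contDiff_liouville hΦ2).continuous
    have e2 := (S.contDiff_liouville hΨ2).continuous
    exact ((e1.comp (by fun_prop)).sub (e2.comp (by fun_prop))).clm_apply continuous_const
  have hintg : ∫ t in (0 : ℝ)..1, (S.liouville (φ ∘ Ψ) (π / 2, t) - S.liouville Ψ (π / 2, t)) (0, 1)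
      = 0 := by
    rw [intervalIntegral.integral_eq_sub_of_hasDerivAt (fun t _ => h4 _ t)
      (hcont.intervalIntegrable _ _), hconst, hzero, sub_self]
  calc _ = ∫ t in (0 : ℝ)..1, ((S.liouville (φ ∘ Ψ) (π / 2, t) - S.liouville Ψ (π / 2, t)) (0, 1)
        + c * ‖z‖ ^ 2) := by
        congr 1
        funext t
        simp only [_root_.sub_apply, liouville_apply, hc, ContinuousLinearMap.comp_apply,
          Function.comp_apply, hu, hu']
        rw [inner_smul_right (S.J (S.rot (c * t) z)), real_inner_self_eq_norm_sq, S.norm_J,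
          S.norm_rot]
        ring
    _ = _ := by
        rw [intervalIntegral.integral_add (hcont.intervalIntegrable _ _)
          (continuous_const.intervalIntegrable _ _), hintg]
        simp [c]

end LinSymp

/-- `χ` is a smooth step from `0` to `1` that is strictly increasing exactly on `(s₁, s₂)`. -/
structure Step (χ χ' : ℝ → ℝ) (s₁ s₂ : ℝ) : Prop where
  deriv : ∀ y, HasDerivAt χ (χ' y) y
  smooth : ContDiff ℝ ∞ χ'
  pos : ∀ y ∈ Ioo s₁ s₂, 0 < χ' y
  zero : ∀ y, y ∉ Ioo s₁ s₂ → χ' y = 0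
  left : ∀ y ≤ s₁, χ y = 0
  right : ∀ y, s₂ ≤ y → χ y = 1

namespace Step
variable {χ χ' : ℝ → ℝ} {s₁ s₂ : ℝ}

theorem nonneg (h : Step χ χ' s₁ s₂) (y : ℝ) : 0 ≤ χ' y := by
  by_cases hy : y ∈ Ioo s₁ s₂
  · exact (h.pos y hy).le
  · exact (h.zero y hy).ge

theorem monotone (h : Step χ χ' s₁ s₂) : Monotone χ :=
  monotone_of_deriv_nonneg (fun y => (h.deriv y).differentiableAt) fun y => by
    rw [(h.deriv y).deriv]; exact h.nonneg y

theorem mem (h : Step χ χ' s₁ s₂) (y : ℝ) : χ y ∈ Icc (0 : ℝ) 1 := by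
  constructor
  · rw [← h.left _ (min_le_right y s₁)]; exact h.monotone (min_le_left _ _)
  · rw [← h.right _ (le_max_right y s₂)]; exact h.monotone (le_max_left _ _)

theorem dich (h : Step χ χ' s₁ s₂) {y : ℝ} (hy : χ' y = 0) : χ y = 0 ∨ χ y = 1 := by
  rcases le_or_gt y s₁ with h1 | h1
  · exact Or.inl (h.left y h1)
  · rcases le_or_gt s₂ y with h2 | h2
    · exact Or.inr (h.right y h2)
    · exact absurd hy (h.pos y ⟨h1, h2⟩).ne'

theorem contDiff (h : Step χ χ' s₁ s₂) : ContDiff ℝ ∞ χ := by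
  rw [contDiff_infty_iff_deriv]
  exact ⟨fun y => (h.deriv y).differentiableAt, by
    rw [show _root_.deriv χ = χ' from funext fun y => (h.deriv y).deriv]; exact h.smooth⟩

end Step

theorem exists_step {s₁ s₂ : ℝ} (h : s₁ < s₂) : ∃ χ χ' : ℝ → ℝ, Step χ χ' s₁ s₂ := by
  let b : ContDiffBump ((s₁ + s₂) / 2) :=
    { rIn := (s₂ - s₁) / 4, rOut := (s₂ - s₁) / 2, rIn_pos := by linarith, rIn_lt_rOut := by linarith }
  have hball : ball ((s₁ + s₂) / 2) b.rOut = Ioo s₁ s₂ := by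
    rw [Real.ball_eq_Ioo]; congr 1 <;> simp only [b] <;> ring
  have hsupp : Function.support (b.normed volume) = Ioo s₁ s₂ := by
    rw [b.support_normed_eq, hball]
  have hc : Continuous (b.normed volume) := b.continuous_normed
  have hintg : ∀ y, s₂ ≤ y → ∫ t in s₁..y, b.normed volume t = 1 := fun y hy => by
    rw [intervalIntegral.integral_eq_integral_of_support_subset, b.integral_normed]
    rw [hsupp]
    exact fun t ht => ⟨ht.1, ht.2.le.trans hy⟩
  refine ⟨fun y => ∫ t in s₁..y, b.normed volume t, b.normed volume, ?_, b.contDiff_normed,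
    fun y hy => ?_, fun y hy => ?_, fun y hy => ?_, hintg⟩
  · exact fun y => intervalIntegral.integral_hasDerivAt_right (hc.intervalIntegrable _ _)
      (hc.stronglyMeasurableAtFilter _ _) hc.continuousAt
  · have : y ∈ Function.support (b.normed volume) := by rw [hsupp]; exact hy
    exact lt_of_le_of_ne (b.nonneg_normed y) (Ne.symm this)
  · rw [← hsupp] at hy
    simpa using hy
  · rw [intervalIntegral.integral_congr (g := fun _ => 0), intervalIntegral.integral_zero]
    intro t ht
    rw [uIcc_of_ge hy] at ht
    have : t ∉ Function.support (b.normed volume) := by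
      rw [hsupp]; exact fun h' => absurd h'.1 (not_lt.2 ht.2)
    simpa using this

namespace LinSymp
variable {E : Type*} [NormedAddCommGroup E] [InnerProductSpace ℝ E] [FiniteDimensional ℝ E]
variable {S : LinSymp E} {φ : E → E} {ρ₁ ρ₂ s₁ s₂ : ℝ} {χ χ' : ℝ → ℝ}

theorem isPreconnected_oshell (hdim : 2 < Module.finrank ℝ E) (hρ : 0 ≤ ρ₁) :
    IsPreconnected (oshell E ρ₁ ρ₂) := by
  have hr : 1 < Module.rank ℝ E := by
    rw [← Module.finrank_eq_rank]; exact_mod_cast (by omega : 1 < Module.finrank ℝ E)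
  have : oshell E ρ₁ ρ₂ = (fun p : ℝ × E => p.1 • p.2) '' (Ioo ρ₁ ρ₂ ×ˢ sphere (0 : E) 1) := by
    ext z
    constructor
    · intro hz
      have hz0 : 0 < ‖z‖ := hρ.trans_lt hz.1
      refine ⟨(‖z‖, ‖z‖⁻¹ • z), ⟨hz, ?_⟩, ?_⟩
      · simp [norm_smul, hz0.ne']
      · simp [smul_smul, hz0.ne']
    · rintro ⟨⟨t, e⟩, ⟨ht, he⟩, rfl⟩
      have he' : ‖e‖ = 1 := by simpa using he
      have ht0 : 0 < t := hρ.trans_lt ht.1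
      change ‖t • e‖ ∈ Ioo ρ₁ ρ₂
      rw [norm_smul, he', mul_one, Real.norm_eq_abs, abs_of_pos ht0]
      exact ht
  rw [this]
  exact (isPreconnected_Ioo.prod (isPreconnected_sphere hr 0 1)).image _ (by fun_prop)

namespace SympOn

/-- The gradient of `χ(|φ⁻¹|²)`, expressed through `φ`. -/
def gradAt (S : LinSymp E) (φ : E → E) (χ' : ℝ → ℝ) (z : E) : E :=
  -(2 * χ' (‖z‖ ^ 2)) • S.J (fderiv ℝ φ z (S.J z))

theorem inner_gradAt {Z : Set E} (hφ : SympOn S Z φ) {z : E} (hz : z ∈ Z) (v : E) :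
    inner ℝ (gradAt S φ χ' z) (fderiv ℝ φ z v) = 2 * χ' (‖z‖ ^ 2) * inner ℝ z v := by
  rw [gradAt, inner_smul_left, hφ.symp z hz, S.sq, inner_neg_left]
  simp

theorem gradAt_eq_zero_iff {Z : Set E} (hφ : SympOn S Z φ) {z : E} (hz : z ∈ Z) (h0 : z ≠ 0) :
    gradAt S φ χ' z = 0 ↔ χ' (‖z‖ ^ 2) = 0 := by
  constructor
  · intro h
    have := hφ.inner_gradAt (χ' := χ') hz z
    rw [h, inner_zero_left, real_inner_self_eq_norm_sq, eq_comm] at this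
    simpa [h0] using this
  · intro h; simp [gradAt, h]

theorem hasGradientAt_of_comp {Z : Set E} (hφ : SympOn S Z φ) (hχ : Step χ χ' s₁ s₂) {z : E}
    (hz : z ∈ Z) {f : E → ℝ} (hf : DifferentiableAt ℝ f (φ z))
    (hfφ : ∀ y ∈ Z, f (φ y) = χ (‖y‖ ^ 2)) : HasGradientAt f (gradAt S φ χ' z) (φ z) := by
  have h1 : HasFDerivAt (f ∘ φ) _ z := hf.hasFDerivAt.comp z (hφ.hasFDerivAt hz)
  have h2 : HasFDerivAt (fun y => χ (‖y‖ ^ 2)) _ z :=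
    (hχ.deriv _).comp_hasFDerivAt z (hasStrictFDerivAt_norm_sq z).hasFDerivAt
  have h3 : HasFDerivAt (f ∘ φ) _ z := h2.congr_of_eventuallyEq
    (Filter.eventually_of_mem (hφ.isOpen.mem_nhds hz) fun y hy => hfφ y hy)
  have h4 := h1.unique h3
  obtain ⟨A, hA⟩ := hφ.exists_equiv hz
  rw [hasGradientAt_iff_hasFDerivAt]
  refine hf.hasFDerivAt.congr_fderiv ?_
  ext v
  obtain ⟨v, rfl⟩ := A.surjective v
  have hAv : A v = fderiv ℝ φ z v := by rw [← hA]; rfl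
  have h5 := congrArg (fun L : E →L[ℝ] ℝ => L v) h4
  rw [hAv]
  change _ = inner ℝ (gradAt S φ χ' z) (fderiv ℝ φ z v)
  rw [hφ.inner_gradAt hz]
  simp at h5
  rw [h5]; ring

theorem exists_hamiltonian (hφ : SympOn S (oshell E ρ₁ ρ₂) φ) (hχ : Step χ χ' s₁ s₂)
    (hρ : 0 < ρ₁) (h1 : ρ₁ ^ 2 < s₁) (h12 : s₁ < s₂) (hρ₂ : 0 < ρ₂) (h2 : s₂ < ρ₂ ^ 2)
    (hdim : 2 < Module.finrank ℝ E) :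
    ∃ (H : E → ℝ) (gH : E → E), (∀ x, HasGradientAt H (gH x) x) ∧ ContDiff ℝ 1 gH ∧
      (∀ z ∈ oshell E ρ₁ ρ₂, H (φ z) = χ (‖z‖ ^ 2)) ∧
      (∀ z ∈ oshell E ρ₁ ρ₂, gH (φ z) = gradAt S φ χ' z) ∧
      (∀ x, gH x ≠ 0 → ∃ z, ‖z‖ ^ 2 ∈ Ioo s₁ s₂ ∧ φ z = x) ∧
      (∀ x, gH x = 0 → H x = 0 ∨ H x = 1) := by
  classical
  set Z := oshell E ρ₁ ρ₂ with hZ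
  obtain ⟨ψ, hψ, hψs⟩ := hφ.exists_inverse
  have hZ0 : ∀ z ∈ Z, z ≠ 0 := fun z hz => norm_pos_iff.1 (hρ.trans hz.1)
  let K : Set E := {z | ‖z‖ ^ 2 ∈ Icc s₁ s₂}
  have hKZ : K ⊆ Z := fun z hz =>
    ⟨lt_of_pow_lt_pow_left₀ 2 (norm_nonneg z) (h1.trans_le hz.1),
      lt_of_pow_lt_pow_left₀ 2 hρ₂.le (hz.2.trans_lt h2)⟩
  have hK : IsCompact K := by
    refine (isCompact_closedBall (0 : E) ρ₂).of_isClosed_subset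
      (isClosed_Icc.preimage (by fun_prop : Continuous fun z : E => ‖z‖ ^ 2)) fun z hz => ?_
    simpa using (hKZ hz).2.le
  have hφK : IsCompact (φ '' K) := hK.image_of_continuousOn (hφ.smooth.continuousOn.mono hKZ)
  have hopen := hφ.isOpen_image
  let gH : E → E := fun x => if x ∈ φ '' Z then gradAt S φ χ' (ψ x) else 0
  have hgφ : ∀ z ∈ Z, gH (φ z) = gradAt S φ χ' z := fun z hz => by
    simp only [gH, if_pos (mem_image_of_mem φ hz), hψ z hz]
  have hsupp : ∀ x, gH x ≠ 0 → ∃ z, ‖z‖ ^ 2 ∈ Ioo s₁ s₂ ∧ φ z = x := by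
    intro x hx
    by_cases hxZ : x ∈ φ '' Z
    · obtain ⟨z, hz, rfl⟩ := hxZ
      rw [hgφ z hz, ne_eq, hφ.gradAt_eq_zero_iff hz (hZ0 z hz)] at hx
      exact ⟨z, by_contra fun h => hx (hχ.zero _ h), rfl⟩
    · exact absurd (if_neg hxZ) hx
  have hoff : ∀ x, x ∉ φ '' K → gH =ᶠ[𝓝 x] fun _ => 0 := fun x hx => by
    filter_upwards [hφK.isClosed.isOpen_compl.mem_nhds hx] with y hy
    by_contra h
    obtain ⟨z, hz, rfl⟩ := hsupp y h
    exact hy ⟨z, Ioo_subset_Icc_self hz, rfl⟩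
  have hψZ : ∀ x ∈ φ '' Z, ψ x ∈ Z := by
    rintro _ ⟨z, hz, rfl⟩; rw [hψ z hz]; exact hz
  have hsm : ContDiff ℝ 1 gH := by
    rw [contDiff_iff_contDiffAt]
    intro x
    by_cases hx : x ∈ φ '' K
    · have hxZ := image_mono hKZ hx
      have hψx : ContDiffAt ℝ 1 ψ x :=
        (hψs.contDiffAt (hopen.mem_nhds hxZ)).of_le (by simp)
      have hfd : ContDiffAt ℝ 1 (fderiv ℝ φ) (ψ x) :=
        (hφ.contDiffAt (hψZ x hxZ)).fderiv_right (by
          rw [one_add_one_eq_two]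
          exact WithTop.coe_le_coe.2 (le_top : (2 : ℕ∞) ≤ ⊤))
      have h3 : ContDiffAt ℝ 1 (fun y => gradAt S φ χ' (ψ y)) x := by
        unfold gradAt
        have e1 : ContDiffAt ℝ 1 (fun y => fderiv ℝ φ (ψ y)) x := hfd.comp x hψx
        have e2 : ContDiffAt ℝ 1 (fun y => χ' (‖ψ y‖ ^ 2)) x :=
          (hχ.smooth.of_le (by simp)).contDiffAt.comp x (hψx.norm_sq ℝ)
        exact ((contDiffAt_const.mul e2).neg).smul
          (S.J.contDiff.contDiffAt.comp x (e1.clm_apply (S.J.contDiff.contDiffAt.comp x hψx)))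
      refine h3.congr_of_eventuallyEq ?_
      filter_upwards [hopen.mem_nhds hxZ] with y hy
      simp only [gH, if_pos hy]
    · exact contDiffAt_const.congr_of_eventuallyEq (hoff x hx)
  let f : E → ℝ := fun x => χ (‖ψ x‖ ^ 2)
  have hfφ : ∀ z ∈ Z, f (φ z) = χ (‖z‖ ^ 2) := fun z hz => by simp only [f, hψ z hz]
  have hfg : ∀ x ∈ φ '' Z, HasGradientAt f (gH x) x := by
    rintro _ ⟨z, hz, rfl⟩
    rw [hgφ z hz]
    refine hφ.hasGradientAt_of_comp hχ hz ?_ hfφ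
    have e : ContDiffAt ℝ ∞ ψ (φ z) := hψs.contDiffAt (hopen.mem_nhds (mem_image_of_mem φ hz))
    exact (hχ.contDiff.contDiffAt.comp (φ z) (e.norm_sq ℝ)).differentiableAt (by simp)
  have hω : Differentiable ℝ fun x => innerSL ℝ (gH x) :=
    ((innerSL ℝ).contDiff.comp hsm).differentiable (by norm_num)
  obtain ⟨H₀, hH₀⟩ := convex_univ.exists_forall_hasFDerivAt_of_fderiv_symmetric (𝕜 := ℝ)
    isOpen_univ hω.differentiableOn fun x _ v w => by
      by_cases hx : x ∈ φ '' K
      · have hxZ := image_mono hKZ hx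
        refine second_derivative_symmetric_of_eventually (f := f) ?_ (hω x).hasFDerivAt v w
        filter_upwards [hopen.mem_nhds hxZ] with y hy
        exact (hfg y hy).hasFDerivAt
      · have : (fun x => innerSL ℝ (gH x)) =ᶠ[𝓝 x] fun _ => (0 : E →L[ℝ] ℝ) := by
          filter_upwards [hoff x hx] with y hy
          simp [hy]
        rw [this.fderiv_eq]
        simp
  have hconst := hφ.isOpen.exists_is_const_of_fderiv_eq_zero (𝕜 := ℝ)
    (f := fun z => H₀ (φ z) - χ (‖z‖ ^ 2)) (isPreconnected_oshell hdim hρ.le) ?_ ?_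
  · obtain ⟨c, hc⟩ := hconst
    have hH : ∀ x, HasGradientAt (fun y => H₀ y - c) (gH x) x := fun x =>
      (hH₀ x (mem_univ x)).sub_const c
    have hHφ : ∀ z ∈ Z, H₀ (φ z) - c = χ (‖z‖ ^ 2) := fun z hz => by
      have := hc z hz; linarith
    refine ⟨fun y => H₀ y - c, gH, hH, hsm, hHφ, hgφ, hsupp, fun x hx => ?_⟩
    obtain ⟨z₀, hz₀⟩ : ∃ z₀ : E, ‖z₀‖ ^ 2 = (s₁ + s₂) / 2 := by
      have : Nontrivial E := Module.nontrivial_of_finrank_pos (R := ℝ) (by omega)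
      obtain ⟨z₀, hz₀⟩ := exists_norm_eq E (sqrt_nonneg ((s₁ + s₂) / 2))
      refine ⟨z₀, ?_⟩
      rw [hz₀, sq_sqrt]
      nlinarith [sq_nonneg ρ₁]
    have hz₀s : ‖z₀‖ ^ 2 ∈ Ioo s₁ s₂ := by rw [hz₀]; constructor <;> linarith
    have hz₀Z : z₀ ∈ Z := hKZ (Ioo_subset_Icc_self hz₀s)
    let γ : ℝ → E := AffineMap.lineMap x (φ z₀)
    have hγ : Continuous γ := AffineMap.lineMap_continuous
    have hγd : ∀ t, HasDerivAt γ (φ z₀ - x) t := fun t => AffineMap.hasDerivAt_lineMap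
    let T : Set ℝ := {t | 0 ≤ t ∧ gH (γ t) ≠ 0}
    have h1T : (1 : ℝ) ∈ T := by
      refine ⟨zero_le_one, ?_⟩
      simp only [γ, AffineMap.lineMap_apply_one]
      rw [hgφ z₀ hz₀Z, ne_eq, hφ.gradAt_eq_zero_iff hz₀Z (hZ0 z₀ hz₀Z)]
      exact (hχ.pos _ hz₀s).ne'
    have hTb : BddBelow T := ⟨0, fun t ht => ht.1⟩
    set τ := sInf T with hτ
    have hτ0 : 0 ≤ τ := le_csInf ⟨1, h1T⟩ fun t ht => ht.1
    have hlt : ∀ t ∈ Ico 0 τ, gH (γ t) = 0 := fun t ht => by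
      by_contra h
      exact absurd (csInf_le hTb (⟨ht.1, h⟩ : t ∈ T)) (not_le.2 ht.2)
    have hτg : gH (γ τ) = 0 := by
      rcases hτ0.eq_or_lt with h | h
      · rw [← h]; simpa [γ] using hx
      · have hcl : IsClosed {t | gH (γ t) = 0} :=
          isClosed_singleton.preimage (hsm.continuous.comp hγ)
        have : τ ∈ closure (Ico 0 τ) := by
          rw [closure_Ico h.ne]; exact ⟨h.le, le_rfl⟩
        exact hcl.closure_subset_iff.2 hlt this
    have hτK : γ τ ∈ φ '' K := by
      have hcl : IsClosed (γ ⁻¹' (φ '' K)) := hφK.isClosed.preimage hγ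
      refine hcl.closure_subset_iff.2 (fun t ht => ?_) (csInf_mem_closure ⟨1, h1T⟩ hTb)
      obtain ⟨z, hz, hzt⟩ := hsupp _ ht.2
      exact ⟨z, Ioo_subset_Icc_self hz, hzt⟩
    have hder : ∀ t, HasDerivAt (fun t => H₀ (γ t) - c) (inner ℝ (gH (γ t)) (φ z₀ - x)) t :=
      fun t => (hH (γ t)).hasFDerivAt.comp_hasDerivAt t (hγd t)
    have hHτ : H₀ (γ τ) - c = H₀ (γ 0) - c :=
      constant_of_has_deriv_right_zero (f := fun t => H₀ (γ t) - c)
        (fun t _ => (hder t).continuousAt.continuousWithinAt)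
        (fun t ht => by
          have := (hder t).hasDerivWithinAt (s := Ici t)
          rwa [hlt t ht, inner_zero_left] at this) τ ⟨hτ0, le_rfl⟩
    obtain ⟨z, hz, hzτ⟩ := hτK
    have hzZ := hKZ hz
    rw [← hzτ, hgφ z hzZ, hφ.gradAt_eq_zero_iff hzZ (hZ0 z hzZ)] at hτg
    have h0 : γ 0 = x := by simp [γ]
    rw [h0, ← hzτ, hHφ z hzZ] at hHτ
    change H₀ x - c = 0 ∨ H₀ x - c = 1
    rw [← hHτ]
    exact hχ.dich hτg
  · intro z hz
    exact (((hH₀ _ (mem_univ _)).differentiableAt.comp z (hφ.hasFDerivAt hz).differentiableAt).sub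
      ((hχ.deriv _).differentiableAt.comp z
        (hasStrictFDerivAt_norm_sq z).hasFDerivAt.differentiableAt)).differentiableWithinAt
  · intro z hz
    have e1 : HasFDerivAt (fun z => H₀ (φ z)) _ z :=
      (hH₀ _ (mem_univ _)).comp z (hφ.hasFDerivAt hz)
    have e2 : HasFDerivAt (fun y : E => χ (‖y‖ ^ 2)) _ z :=
      (hχ.deriv _).comp_hasFDerivAt z (hasStrictFDerivAt_norm_sq z).hasFDerivAt
    rw [(e1.fun_sub e2).fderiv]
    ext v
    have := hφ.inner_gradAt (χ' := χ') hz v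
    simp [hgφ z hz, this]
    ring

end SympOn
end LinSymp

namespace LinSymp
variable {E : Type*} [NormedAddCommGroup E] [InnerProductSpace ℝ E] [FiniteDimensional ℝ E]
variable {S : LinSymp E} {ι : Type*} [Fintype ι] [DecidableEq ι]
variable {φ : E → E} {ρ₁ ρ₂ s₁ s₂ u w : ℝ} {χ χ' : ℝ → ℝ}

namespace Ell
variable (A : Ell S ι)

theorem N_smul (t : ℝ) (x : E) : A.N (t • x) = t ^ 2 * A.N x := by
  simp [N, inner_smul_left, inner_smul_right]; ring

theorem N_pos {x : E} (hx : x ≠ 0) : 0 < A.N x := by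
  obtain ⟨c, hc, h⟩ := A.exists_lower_bound
  exact (mul_pos hc (pow_pos (norm_pos_iff.2 hx) 2)).trans_le (A.mul_norm_sq_le_N h x)

theorem isPreconnected_superlevel (hdim : 2 < Module.finrank ℝ E) (hw : 0 < w) :
    IsPreconnected {x | w ≤ A.N x} := by
  have hr : 1 < Module.rank ℝ E := by
    rw [← Module.finrank_eq_rank]; exact_mod_cast (by omega : 1 < Module.finrank ℝ E)
  have : {x | w ≤ A.N x} = (fun x => max 1 (√(w / A.N x)) • x) '' {0}ᶜ := by
    ext x
    constructor
    · intro hx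
      have h0 : x ≠ 0 := by
        rintro rfl
        have : w ≤ A.N 0 := hx
        simp [N] at this
        linarith
      refine ⟨x, h0, ?_⟩
      have : √(w / A.N x) ≤ 1 := by
        exact Real.sqrt_le_one.2 ((div_le_one (A.N_pos h0)).2 hx)
      simp [max_eq_left this]
    · rintro ⟨x, hx, rfl⟩
      have hN := A.N_pos (show x ≠ 0 from hx)
      change w ≤ A.N _
      rw [A.N_smul]
      have h1 : √(w / A.N x) ^ 2 ≤ max 1 (√(w / A.N x)) ^ 2 :=
        pow_le_pow_left₀ (sqrt_nonneg _) (le_max_right _ _) 2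
      rw [sq_sqrt (div_pos hw hN).le, div_le_iff₀ hN] at h1
      exact h1
  rw [this]
  refine (isConnected_compl_singleton_of_one_lt_rank hr 0).isPreconnected.image _ ?_
  refine ContinuousOn.smul (ContinuousOn.sup continuousOn_const ?_) continuousOn_id
  exact (continuousOn_const.div A.continuous_N.continuousOn
    fun x hx => (A.N_pos (show x ≠ 0 from hx)).ne').sqrt

end Ell

theorem SympOn.gradAt_orbit {Z : Set E} (hφ : SympOn S Z φ) (hZ : ∀ θ : ℝ, ∀ z ∈ Z, S.rot θ z ∈ Z)
    {z : E} (hz : z ∈ Z) (h t : ℝ) :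
    HasDerivAt (fun t => φ (S.rot (2 * h * χ' (‖z‖ ^ 2) * t) z))
      (S.J (h • gradAt S φ χ' (S.rot (2 * h * χ' (‖z‖ ^ 2) * t) z))) t := by
  have h1 := (hφ.hasFDerivAt (hZ (2 * h * χ' (‖z‖ ^ 2) * t) z hz)).comp_hasDerivAt t
    (S.hasDerivAt_rot (2 * h * χ' (‖z‖ ^ 2)) z t)
  refine h1.congr_deriv ?_
  simp only [gradAt, S.norm_rot, map_smul, S.sq, smul_neg, smul_smul, ← neg_smul]
  congr 1
  ring

theorem SympOn.exists_barrier (A : Ell S ι) (hφ : SympOn S (oshell E ρ₁ ρ₂) φ)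
    (hχ : Step χ χ' s₁ s₂) (hρ : 0 < ρ₁) (h1 : ρ₁ ^ 2 < s₁) (h12 : s₁ < s₂) (hρ₂ : 0 < ρ₂)
    (h2 : s₂ < ρ₂ ^ 2) (hdim : 2 < Module.finrank ℝ E) (hu : 0 < u) (huw : u < w)
    (hmaps : ∀ z ∈ oshell E ρ₁ ρ₂, A.N (φ z) ∈ Ioo u w) :
    ∃ (H : E → ℝ) (gH : E → E) (H₀ H₁ : ℝ), Barrier A u w s₁ s₂ H₀ H₁ H gH ∧
      (H₀ = 0 ∨ H₀ = 1) ∧ (H₁ = 0 ∨ H₁ = 1) ∧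
      (∀ z ∈ oshell E ρ₁ ρ₂, gH (φ z) = gradAt S φ χ' z) ∧
      (∀ x, gH x ≠ 0 → ∃ z ∈ oshell E ρ₁ ρ₂, φ z = x) := by
  obtain ⟨H, gH, hgrad, hsm, hHφ, hgφ, hsupp, hdich⟩ :=
    hφ.exists_hamiltonian hχ hρ h1 h12 hρ₂ h2 hdim
  have hsupp' : ∀ x, gH x ≠ 0 → ∃ z ∈ oshell E ρ₁ ρ₂, ‖z‖ ^ 2 ∈ Ioo s₁ s₂ ∧ φ z = x := by
    intro x hx
    obtain ⟨z, hz, hzx⟩ := hsupp x hx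
    exact ⟨z, ⟨lt_of_pow_lt_pow_left₀ 2 (norm_nonneg z) (h1.trans hz.1),
      lt_of_pow_lt_pow_left₀ 2 hρ₂.le (hz.2.trans h2)⟩, hz, hzx⟩
  have hN : ∀ x, gH x ≠ 0 → A.N x ∈ Ioo u w := fun x hx => by
    obtain ⟨z, hz, -, rfl⟩ := hsupp' x hx; exact hmaps z hz
  have hHc : Continuous H := continuous_iff_continuousAt.2 fun x => (hgrad x).hasFDerivAt.continuousAt
  have hdisc : IsDiscrete ({0, 1} : Set ℝ) := (Set.toFinite _).isDiscrete
  have hin : ∀ x, A.N x ≤ u → H x = H 0 := by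
    intro x hx
    have := isPreconnected_Icc.constant_of_mapsTo (S := Icc (0 : ℝ) 1) hdisc
      (f := fun t : ℝ => H (t • x)) (by fun_prop) (fun t ht => ?_)
      (right_mem_Icc.2 zero_le_one) (left_mem_Icc.2 zero_le_one)
    · simpa using this
    · refine hdich _ (by_contra fun h => absurd (hN _ h).1 (not_lt.2 ?_))
      rw [A.N_smul]
      exact (mul_le_of_le_one_left (A.N_nonneg x) (pow_le_one₀ ht.1 ht.2)).trans hx
  have hzero : gH 0 = 0 := by
    by_contra h
    have := (hN 0 h).1
    simp [Ell.N] at this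
    linarith
  have hout : ∃ H₁, (H₁ = 0 ∨ H₁ = 1) ∧ ∀ x, w ≤ A.N x → H x = H₁ :=
    (A.isPreconnected_superlevel hdim (hu.trans huw)).eqOn_const_of_mapsTo hdisc hHc.continuousOn
      (fun x hx => hdich x (by_contra fun h => absurd (hN x h).2 (not_lt.2 hx))) ⟨0, by simp⟩
  obtain ⟨H₁, hH₁, hout⟩ := hout
  refine ⟨H, gH, H 0, H₁, ⟨hgrad, hsm, hN, fun x => ?_, hdich, hin, hout, ?_⟩, hdich 0 hzero, hH₁,
    hgφ, fun x hx => by obtain ⟨z, hz, -, hzx⟩ := hsupp' x hx; exact ⟨z, hz, hzx⟩⟩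
  · by_cases hx : gH x = 0
    · rcases hdich x hx with h | h <;> simp [h]
    · obtain ⟨z, hz, -, rfl⟩ := hsupp' x hx
      rw [hHφ z hz]; exact hχ.mem _
  intro h hh x hx
  obtain ⟨z, hz, hzs, rfl⟩ := hsupp' x hx
  have hrot : ∀ θ : ℝ, ∀ z ∈ oshell E ρ₁ ρ₂, S.rot θ z ∈ oshell E ρ₁ ρ₂ := fun θ z hz => by
    change ‖S.rot θ z‖ ∈ Ioo ρ₁ ρ₂; rw [S.norm_rot]; exact hz
  have hz0 : z ≠ 0 := norm_pos_iff.1 (hρ.trans hz.1)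
  set θ := 2 * h * χ' (‖z‖ ^ 2) with hθ
  have hθ0 : 0 < θ := by have := hχ.pos _ hzs; positivity
  have hder : ∀ t, HasDerivAt (fun t => φ (S.rot (θ * t) z))
      (S.J (h • gH (φ (S.rot (θ * t) z)))) t := fun t => by
    rw [hgφ _ (hrot _ _ hz)]
    exact hφ.gradAt_orbit (χ' := χ') hrot hz h t
  refine ⟨fun t => φ (S.rot (θ * t) z), by simp [S.rot_zero], hder, fun t => ⟨?_, ?_⟩, fun hper => ?_⟩
  · rw [hgφ _ (hrot _ _ hz), ne_eq, hφ.gradAt_eq_zero_iff (hrot _ _ hz), S.norm_rot]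
    · exact (hχ.pos _ hzs).ne'
    · rw [← norm_ne_zero_iff, S.norm_rot, norm_ne_zero_iff]; exact hz0
  · rw [hHφ _ (hrot _ _ hz), hHφ _ hz, S.norm_rot]
  · have h3 : S.rot θ z = z := by
      have := hφ.inj (hrot _ _ hz) (hrot _ _ hz) hper
      simpa [S.rot_zero] using this.symm
    have h4 : cos θ = 1 := by
      have h5 : inner ℝ (S.rot θ z) z = ‖z‖ ^ 2 := by rw [h3, real_inner_self_eq_norm_sq]
      rw [rot_apply, inner_add_left, inner_smul_left, inner_smul_left, S.inner_J_self,
        real_inner_self_eq_norm_sq] at h5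
      simpa [hz0] using h5
    obtain ⟨k, hk⟩ := (cos_eq_one_iff θ).1 h4
    have hk0 : 0 < k := by
      have : (0 : ℝ) < k := by
        rw [← hk] at hθ0
        exact pos_of_mul_pos_left hθ0 (by positivity)
      exact_mod_cast this
    have hθk : θ = 2 * π * k := by rw [← hk]; ring
    refine ⟨k.toNat, by omega, ‖z‖ ^ 2, hzs, ?_⟩
    have hkk : ((k.toNat : ℕ) : ℝ) = k := by
      exact_mod_cast congrArg (Int.cast : ℤ → ℝ) (Int.toNat_of_nonneg hk0.le)
    have hact := hφ.action_loop hdim hz k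
    have : ∀ t, 2⁻¹ * inner ℝ (h • gH (φ (S.rot (θ * t) z))) (φ (S.rot (θ * t) z))
        = 2⁻¹ * inner ℝ (S.J (φ (S.rot (2 * π * k * t) z)))
          (fderiv ℝ φ (S.rot (2 * π * k * t) z) ((2 * π * k) • S.J (S.rot (2 * π * k * t) z))) := by
      intro t
      have e1 := (hder t).unique ((hφ.hasFDerivAt (hrot (θ * t) z hz)).comp_hasDerivAt t
        (S.hasDerivAt_rot θ z t))
      rw [hθk] at e1 ⊢
      rw [← e1, S.inner_J_J, real_inner_comm]
    simp_rw [this]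
    rw [intervalIntegral.integral_const_mul, hact, hkk]
    ring

end LinSymp

theorem continuous_indicator_of_zero_off {E : Type*} [TopologicalSpace E] {Z K : Set E} {f : E → ℝ}
    (hZ : IsOpen Z) (hK : IsClosed K) (hKZ : K ⊆ Z) (hf : ContinuousOn f Z)
    (h0 : ∀ z ∈ Z, z ∉ K → f z = 0) : Continuous (Z.indicator f) := by
  rw [continuous_iff_continuousAt]
  intro z
  by_cases hz : z ∈ K
  · refine (hf.continuousAt (hZ.mem_nhds (hKZ hz))).congr ?_
    filter_upwards [hZ.mem_nhds (hKZ hz)] with y hy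
    rw [indicator_of_mem hy]
  · refine (continuousAt_const (y := (0 : ℝ))).congr ?_
    filter_upwards [hK.isOpen_compl.mem_nhds hz] with y hy
    by_cases hyZ : y ∈ Z
    · rw [indicator_of_mem hyZ, h0 y hyZ hy]
    · rw [indicator_of_notMem hyZ]

section Euler
variable {E : Type*} [NormedAddCommGroup E] [InnerProductSpace ℝ E] [FiniteDimensional ℝ E]
  [MeasurableSpace E] [BorelSpace E]

theorem finrank_mul_integral {f : E → ℝ} {g : E → E} (hf : ∀ x, HasGradientAt f (g x) x)
    (hg : Continuous g) (hc : HasCompactSupport f) :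
    (Module.finrank ℝ E : ℝ) * ∫ x, f x = -∫ x, inner ℝ (g x) x := by
  have hfc : Continuous f := continuous_iff_continuousAt.2 fun x => (hf x).hasFDerivAt.continuousAt
  have hgc : HasCompactSupport g := by
    refine HasCompactSupport.intro hc fun x hx => ?_
    have h1 : f =ᶠ[𝓝 x] fun _ => 0 := by
      filter_upwards [(isClosed_tsupport f).isOpen_compl.mem_nhds hx] with y hy
      exact image_eq_zero_of_notMem_tsupport hy
    have h2 : HasGradientAt f 0 x := (hasGradientAt_const x (0 : ℝ)).congr_of_eventuallyEq h1
    exact (hf x).unique h2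
  let b := stdOrthonormalBasis ℝ E
  have hfd : ∀ x v, fderiv ℝ f x v = inner ℝ (g x) v := fun x v => by
    rw [(hf x).hasFDerivAt.fderiv]; rfl
  have hbd : ∀ i x, fderiv ℝ (fun y => inner ℝ (b i) y) x (b i) = (1 : ℝ) := fun i x => by
    have : HasFDerivAt (fun y => inner ℝ (b i) y) (innerSL ℝ (b i)) x := (innerSL ℝ (b i)).hasFDerivAt
    rw [this.fderiv]
    simp
  have key : ∀ i, ∫ x, f x = -∫ x, inner ℝ (g x) (b i) * inner ℝ (b i) x := fun i => by
    have := integral_mul_fderiv_eq_neg_fderiv_mul_of_integrable (μ := (volume : Measure E)) (f := f)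
      (g := fun y => inner ℝ (b i) y) (v := b i) ?_ ?_ ?_
      (fun x _ => (hf x).hasFDerivAt.differentiableAt) (fun x _ => (innerSL ℝ (b i)).differentiableAt)
    · simpa [hfd, hbd] using this
    · simp only [hfd]
      exact Continuous.integrable_of_hasCompactSupport (by fun_prop)
        (hgc.mono fun x hx h => hx (by simp [h]))
    · simp only [hbd, mul_one]
      exact hfc.integrable_of_hasCompactSupport hc
    · exact Continuous.integrable_of_hasCompactSupport (by fun_prop) hc.mul_right
  have hi : ∀ i, Integrable fun x => inner ℝ (g x) (b i) * inner ℝ (b i) x := fun i =>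
    Continuous.integrable_of_hasCompactSupport (by fun_prop)
        (hgc.mono fun x hx h => hx (by simp [h]))
  calc (Module.finrank ℝ E : ℝ) * ∫ x, f x = ∑ i : Fin (Module.finrank ℝ E), ∫ x, f x := by simp
    _ = ∑ i, -∫ x, inner ℝ (g x) (b i) * inner ℝ (b i) x := Finset.sum_congr rfl fun i _ => key i
    _ = -∫ x, ∑ i, inner ℝ (g x) (b i) * inner ℝ (b i) x := by
      rw [integral_finsetSum _ fun i _ => hi i, Finset.sum_neg_distrib]
    _ = _ := by simp_rw [b.sum_inner_mul_inner]

end Euler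

namespace LinSymp
variable {E : Type*} [NormedAddCommGroup E] [InnerProductSpace ℝ E] [FiniteDimensional ℝ E]
variable {S : LinSymp E} {φ : E → E} {ρ₁ ρ₂ s₁ s₂ : ℝ} {χ χ' : ℝ → ℝ}

theorem abs_det_of_symp {A : E →L[ℝ] E} (h : ∀ v w, inner ℝ (S.J (A v)) (A w) = inner ℝ (S.J v) w) :
    |A.det| = 1 := by
  let b := stdOrthonormalBasis ℝ E
  have hadj : ∀ f : E →ₗ[ℝ] E, LinearMap.det (LinearMap.adjoint f) = LinearMap.det f := fun f => by
    rw [← LinearMap.det_toMatrix b.toBasis, ← LinearMap.det_toMatrix b.toBasis f,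
      LinearMap.toMatrix_adjoint b b, Matrix.det_conjTranspose, star_trivial]
  let J : E →ₗ[ℝ] E := S.J
  let L : E →ₗ[ℝ] E := A
  have h1 : LinearMap.adjoint L ∘ₗ J ∘ₗ L = J := by
    ext v
    refine ext_inner_right ℝ fun w => ?_
    simp only [LinearMap.comp_apply, LinearMap.adjoint_inner_left]
    exact h v w
  have h2 : LinearMap.det J * LinearMap.det J ≠ 0 := by
    rw [← LinearMap.det_comp, show J ∘ₗ J = -LinearMap.id from LinearMap.ext fun v => S.sq v,
      ← neg_one_smul ℝ (LinearMap.id : E →ₗ[ℝ] E), LinearMap.det_smul, LinearMap.det_id]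
    simp
  have h3 := congrArg LinearMap.det h1
  rw [LinearMap.det_comp, LinearMap.det_comp, hadj] at h3
  have h4 : LinearMap.det L ^ 2 = 1 :=
    mul_right_cancel₀ (left_ne_zero_of_mul h2) (by linear_combination h3)
  change |LinearMap.det L| = 1
  exact (pow_eq_one_iff_of_nonneg (abs_nonneg _) two_ne_zero).1 (by rw [sq_abs, h4])

variable [MeasurableSpace E] [BorelSpace E]

theorem integral_rot_eq (S : LinSymp E) (θ : ℝ) (f : E → ℝ) : ∫ z, f (S.rot θ z) = ∫ z, f z := by
  let R : E ≃ₗᵢ[ℝ] E :=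
    { toFun := S.rot θ, invFun := S.rot (-θ), left_inv := S.rot_neg_rot θ,
      right_inv := fun v => by simpa using S.rot_neg_rot (-θ) v,
      map_add' := map_add _, map_smul' := map_smul _, norm_map' := S.norm_rot θ }
  exact R.measurePreserving.integral_comp R.toHomeomorph.measurableEmbedding f

theorem integral_average (S : LinSymp E) {G : E → ℝ} (hG : Continuous G) {r : ℝ}
    (h0 : ∀ z, G z ≠ 0 → ‖z‖ ≤ r) : ∫ z, G z = ∫ z, ∫ t in (0 : ℝ)..1, G (S.rot (2 * π * t) z) := by
  have h1 : ∀ t, ∫ z in closedBall (0 : E) r, G (S.rot (2 * π * t) z) = ∫ z, G z := fun t => by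
    rw [← S.integral_rot_eq (2 * π * t) G]
    refine setIntegral_eq_integral_of_forall_compl_eq_zero fun z hz => ?_
    by_contra h
    have := h0 _ h
    rw [S.norm_rot] at this
    simp at hz
    linarith
  have h2 : ∫ z, ∫ t in (0 : ℝ)..1, G (S.rot (2 * π * t) z)
      = ∫ z in closedBall (0 : E) r, ∫ t in Icc (0 : ℝ) 1, G (S.rot (2 * π * t) z) := by
    simp_rw [intervalIntegral.integral_of_le zero_le_one, integral_Icc_eq_integral_Ioc]
    refine (setIntegral_eq_integral_of_forall_compl_eq_zero fun z hz => ?_).symm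
    have : ∀ t, G (S.rot (2 * π * t) z) = 0 := fun t => by
      by_contra h
      have := h0 _ h
      rw [S.norm_rot] at this
      simp at hz
      linarith
    simp [this]
  rw [h2, integral_integral_swap]
  · simp_rw [h1]; simp
  · rw [Measure.prod_restrict]
    have : Continuous fun p : E × ℝ => G (S.rot (2 * π * p.2) p.1) := by
      simp only [rot_apply]; fun_prop
    exact (this.continuousOn).integrableOn_compact ((isCompact_closedBall 0 r).prod isCompact_Icc)

theorem SympOn.integral_gradAt (hφ : SympOn S (oshell E ρ₁ ρ₂) φ) (hχ : Step χ χ' s₁ s₂)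
    (h1 : ρ₁ ^ 2 < s₁) (hρ₂ : 0 < ρ₂)
    (h2 : s₂ < ρ₂ ^ 2) (hdim : 2 < Module.finrank ℝ E) :
    ∫ z in oshell E ρ₁ ρ₂, inner ℝ (gradAt S φ χ' z) (φ z) = ∫ z : E, 2 * χ' (‖z‖ ^ 2) * ‖z‖ ^ 2 := by
  set Z := oshell E ρ₁ ρ₂ with hZ
  let K : Set E := {z | ‖z‖ ^ 2 ∈ Icc s₁ s₂}
  have hKZ : K ⊆ Z := fun z hz =>
    ⟨lt_of_pow_lt_pow_left₀ 2 (norm_nonneg z) (h1.trans_le hz.1),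
      lt_of_pow_lt_pow_left₀ 2 hρ₂.le (hz.2.trans_lt h2)⟩
  have hK : IsClosed K := isClosed_Icc.preimage (by fun_prop : Continuous fun z : E => ‖z‖ ^ 2)
  have hχ0 : ∀ z : E, z ∉ K → χ' (‖z‖ ^ 2) = 0 := fun z hz =>
    hχ.zero _ fun h => hz (Ioo_subset_Icc_self h)
  have hrot : ∀ θ : ℝ, ∀ z, S.rot θ z ∈ Z ↔ z ∈ Z := fun θ z => by
    change ‖S.rot θ z‖ ∈ Ioo ρ₁ ρ₂ ↔ _; rw [S.norm_rot]; rfl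
  let f : E → ℝ := fun z => inner ℝ (gradAt S φ χ' z) (φ z)
  have hf : ∀ z, f z = 2 * χ' (‖z‖ ^ 2) * inner ℝ (S.J (φ z)) (fderiv ℝ φ z (S.J z)) := fun z => by
    simp only [f, gradAt]
    rw [inner_smul_left, S.skew, real_inner_comm]
    simp
  have hG : Continuous (Z.indicator f) := by
    refine continuous_indicator_of_zero_off hφ.isOpen hK hKZ ?_ fun z _ hz => by
      rw [hf, hχ0 z hz]; simp
    rw [show f = _ from funext hf]
    have e1 := hφ.smooth.continuousOn
    have e2 := hφ.smooth.continuousOn_fderiv_of_isOpen hφ.isOpen (by simp)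
    have e3 := hχ.smooth.continuous
    refine ContinuousOn.mul (by fun_prop) ?_
    exact (S.J.continuous.comp_continuousOn e1).inner (e2.clm_apply S.J.continuous.continuousOn)
  rw [← integral_indicator hφ.isOpen.measurableSet, S.integral_average hG (r := ρ₂) ?_]
  · congr 1
    ext z
    by_cases hz : z ∈ Z
    · have := hφ.action_loop hdim hz 1
      simp only [Int.cast_one, mul_one, map_smul, inner_smul_right,
        intervalIntegral.integral_const_mul] at this
      have h3 := mul_left_cancel₀ (by positivity : (2 * π) ≠ 0) this
      trans 2 * χ' (‖z‖ ^ 2) * ∫ t in (0 : ℝ)..1, inner ℝ (S.J (φ (S.rot (2 * π * t) z)))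
        (fderiv ℝ φ (S.rot (2 * π * t) z) (S.J (S.rot (2 * π * t) z)))
      swap
      · rw [h3]
      rw [← intervalIntegral.integral_const_mul]
      congr 1
      ext t
      rw [indicator_of_mem ((hrot _ _).2 hz), hf, S.norm_rot]
    · have : ∀ t, Z.indicator f (S.rot (2 * π * t) z) = 0 := fun t =>
        indicator_of_notMem (fun h => hz ((hrot _ _).1 h)) _
      simp [this, hχ0 z fun h => hz (hKZ h)]
  · intro z hz
    exact (mem_of_indicator_ne_zero hz).2.le

/-- The Hamiltonian and the radial model have the same mean slope. -/
theorem SympOn.integral_inner_grad (hφ : SympOn S (oshell E ρ₁ ρ₂) φ) (hχ : Step χ χ' s₁ s₂)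
    (h1 : ρ₁ ^ 2 < s₁) (hρ₂ : 0 < ρ₂) (h2 : s₂ < ρ₂ ^ 2) (hdim : 2 < Module.finrank ℝ E)
    {gH : E → E} (hgφ : ∀ z ∈ oshell E ρ₁ ρ₂, gH (φ z) = gradAt S φ χ' z)
    (hsupp : ∀ x, gH x ≠ 0 → ∃ z ∈ oshell E ρ₁ ρ₂, φ z = x) :
    ∫ x, inner ℝ (gH x) x = (Module.finrank ℝ E : ℝ) * ∫ z : E, (1 - χ (‖z‖ ^ 2)) := by
  have e1 : ∫ x, inner ℝ (gH x) x = ∫ x in φ '' oshell E ρ₁ ρ₂, inner ℝ (gH x) x := by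
    refine (setIntegral_eq_integral_of_forall_compl_eq_zero fun x hx => ?_).symm
    have : gH x = 0 := by_contra fun h => hx (hsupp x h)
    simp [this]
  rw [e1, integral_image_eq_integral_abs_det_fderiv_smul volume hφ.isOpen.measurableSet
    (fun x hx => (hφ.hasFDerivAt hx).hasFDerivWithinAt) hφ.inj]
  rw [setIntegral_congr_fun hφ.isOpen.measurableSet (g := fun z => inner ℝ (gradAt S φ χ' z) (φ z))
    fun z hz => by simp only [abs_det_of_symp (hφ.symp z hz), one_smul, hgφ z hz]]
  rw [hφ.integral_gradAt hχ h1 hρ₂ h2 hdim]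
  have hgrad : ∀ z : E, HasGradientAt (fun z : E => 1 - χ (‖z‖ ^ 2)) (-(2 * χ' (‖z‖ ^ 2)) • z) z := by
    intro z
    have := ((hχ.deriv _).comp_hasFDerivAt z (hasStrictFDerivAt_norm_sq z).hasFDerivAt).const_sub 1
    rw [hasGradientAt_iff_hasFDerivAt]
    refine this.congr_fderiv ?_
    ext v
    simp
    ring
  have e3 := hχ.smooth.continuous
  rw [finrank_mul_integral hgrad (by fun_prop), ← integral_neg]
  · congr 1
    ext z
    rw [inner_smul_left, real_inner_self_eq_norm_sq]
    simp
  · refine HasCompactSupport.intro (isCompact_closedBall (0 : E) ρ₂) fun z hz => ?_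
    have : ρ₂ < ‖z‖ := by simpa using hz
    rw [hχ.right _ (h2.le.trans (pow_le_pow_left₀ hρ₂.le this.le 2)), sub_self]

theorem integrable_one_sub (hχ : Step χ χ' s₁ s₂) :
    Integrable fun z : E => 1 - χ (‖z‖ ^ 2) := by
  have e3 := hχ.contDiff.continuous
  refine Continuous.integrable_of_hasCompactSupport (by fun_prop) ?_
  refine HasCompactSupport.intro (isCompact_closedBall (0 : E) (√ s₂)) fun z hz => ?_
  have : √s₂ < ‖z‖ := by simpa using hz
  rw [hχ.right _ (Real.sqrt_le_left (norm_nonneg z) |>.1 this.le), sub_self]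

theorem volume_ball_le_integral (hχ : Step χ χ' s₁ s₂)  :
    volume.real (ball (0 : E) (√s₁)) ≤ ∫ z : E, (1 - χ (‖z‖ ^ 2)) := by
  rw [← integral_indicator_one measurableSet_ball]
  refine integral_mono_of_nonneg (Eventually.of_forall fun z => indicator_nonneg (by simp) z)
    (integrable_one_sub hχ) (Eventually.of_forall fun z => ?_)
  by_cases hz : z ∈ ball (0 : E) (√s₁)
  · have h1 : ‖z‖ < √s₁ := by simpa using hz
    simp only [indicator_of_mem hz]
    rw [hχ.left _ ((Real.lt_sqrt (norm_nonneg z)).1 h1).le]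
    simp
  · simp only [indicator_of_notMem hz]
    have := (hχ.mem (‖z‖ ^ 2)).2
    linarith

theorem integral_le_volume_ball (hχ : Step χ χ' s₁ s₂) :
    ∫ z : E, (1 - χ (‖z‖ ^ 2)) ≤ volume.real (ball (0 : E) (√s₂)) := by
  rw [← integral_indicator_one measurableSet_ball]
  refine integral_mono (integrable_one_sub hχ)
    ((integrable_indicator_iff measurableSet_ball).2 (integrableOn_const measure_ball_lt_top.ne))
    fun z => ?_
  by_cases hz : z ∈ ball (0 : E) (√s₂)
  · simp only [indicator_of_mem hz]
    have := (hχ.mem (‖z‖ ^ 2)).1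
    simp
    linarith
  · have h1 : √s₂ ≤ ‖z‖ := by simpa using hz
    simp only [indicator_of_notMem hz]
    rw [hχ.right _ (Real.sqrt_le_left (norm_nonneg z) |>.1 h1), sub_self]

end LinSymp

namespace LinSymp
variable {E : Type*} [NormedAddCommGroup E] [InnerProductSpace ℝ E] [FiniteDimensional ℝ E]
  [MeasurableSpace E] [BorelSpace E]
variable {S : LinSymp E} {ι : Type*} [Fintype ι] [DecidableEq ι]
variable {φ : E → E} {ρ₁ ρ₂ s₁ s₂ u w : ℝ} {χ χ' : ℝ → ℝ}

/-- Either the embedded shell bounds a region outside the inner ellipsoid, and its volume is at most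
that of the ellipsoidal shell, or it surrounds the inner ellipsoid. -/
theorem SympOn.volume_dichotomy (A : Ell S ι) (hφ : SympOn S (oshell E ρ₁ ρ₂) φ)
    (hρ : 0 < ρ₁) (h1 : ρ₁ ^ 2 < s₁) (h12 : s₁ < s₂) (hρ₂ : 0 < ρ₂)
    (h2 : s₂ < ρ₂ ^ 2) (hdim : 2 < Module.finrank ℝ E) (hu : 0 < u) (huw : u < w)
    (hmaps : ∀ z ∈ oshell E ρ₁ ρ₂, A.N (φ z) ∈ Ioo u w) :
    volume.real (ball (0 : E) (√s₁)) ≤ volume.real {x : E | A.N x ∈ Ioo u w} ∨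
      volume.real {x : E | A.N x ≤ u} ≤ volume.real (ball (0 : E) (√s₂)) ∧
      ∃ (H : E → ℝ) (gH : E → E), Barrier A u w s₁ s₂ 0 1 H gH := by
  obtain ⟨χ, χ', hχ⟩ := exists_step h12
  obtain ⟨H, gH, H₀, H₁, hB, hH₀, hH₁, hgφ, hsupp⟩ :=
    hφ.exists_barrier A hχ hρ h1 h12 hρ₂ h2 hdim hu huw hmaps
  have hs₁ : 0 < s₁ := (pow_pos hρ 2).trans h1
  have hintg := hφ.integral_inner_grad hχ h1 hρ₂ h2 hdim hgφ hsupp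
  have hd : (0 : ℝ) < Module.finrank ℝ E := by exact_mod_cast (by omega : 0 < Module.finrank ℝ E)
  have hgc : Continuous gH := hB.smooth.continuous
  have hNm : Measurable A.N := A.continuous_N.measurable
  have hlow := volume_ball_le_integral (E := E) hχ
  have hup := integral_le_volume_ball (E := E) hχ
  rcases hH₁ with rfl | rfl
  · exfalso
    have e1 := finrank_mul_integral hB.grad hgc
      (HasCompactSupport.intro (A.isCompact_sublevel w) fun x hx =>
        hB.outside x (not_le.1 hx).le)
    rw [hintg] at e1
    have e2 : 0 ≤ ∫ x, H x := integral_nonneg fun x => (hB.mem x).1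
    have e3 : 0 < volume.real (ball (0 : E) (√s₁)) :=
      ENNReal.toReal_pos (measure_ball_pos _ _ (sqrt_pos.2 hs₁)).ne' measure_ball_lt_top.ne
    nlinarith [mul_nonneg hd.le e2, mul_pos hd (e3.trans_le hlow)]
  · have hcs : HasCompactSupport fun x => 1 - H x :=
      HasCompactSupport.intro (A.isCompact_sublevel w) fun x hx => by
        rw [hB.outside x (not_le.1 hx).le, sub_self]
    have hgr : ∀ x, HasGradientAt (fun x => 1 - H x) (-gH x) x := fun x => by
      have := (hB.grad x).hasFDerivAt.const_sub 1
      rw [hasGradientAt_iff_hasFDerivAt]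
      refine this.congr_fderiv ?_
      simp
    have e1 := finrank_mul_integral hgr hgc.neg hcs
    simp only [inner_neg_left, integral_neg, neg_neg] at e1
    rw [hintg] at e1
    have e2 := mul_left_cancel₀ hd.ne' e1
    rw [← e2] at hlow hup
    have hHc : Continuous fun x => 1 - H x :=
      continuous_iff_continuousAt.2 fun x => (hgr x).hasFDerivAt.continuousAt
    have hi : Integrable fun x => 1 - H x := hHc.integrable_of_hasCompactSupport hcs
    have hfin : ∀ s : Set E, s ⊆ {x | A.N x ≤ w} → volume s ≠ ⊤ := fun s hs =>
      ((measure_mono hs).trans_lt (A.isCompact_sublevel w).measure_lt_top).ne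
    rcases hH₀ with rfl | rfl
    · refine Or.inr ⟨le_trans ?_ hup, H, gH, hB⟩
      have hm : MeasurableSet {x : E | A.N x ≤ u} := hNm measurableSet_Iic
      rw [← integral_indicator_one hm]
      refine integral_mono ((integrable_indicator_iff hm).2
        (integrableOn_const (hfin _ fun x hx => le_trans hx huw.le))) hi fun x => ?_
      by_cases hx : x ∈ {x : E | A.N x ≤ u}
      · simp [indicator_of_mem hx, hB.inside x hx]
      · simp only [indicator_of_notMem hx]
        linarith [(hB.mem x).2]
    · refine Or.inl (hlow.trans ?_)
      have hm : MeasurableSet {x : E | A.N x ∈ Ioo u w} := hNm measurableSet_Ioo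
      rw [← integral_indicator_one hm]
      refine integral_mono hi ((integrable_indicator_iff hm).2
        (integrableOn_const (hfin _ fun x hx => hx.2.le))) fun x => ?_
      by_cases hx : x ∈ {x : E | A.N x ∈ Ioo u w}
      · simp only [indicator_of_mem hx]
        simp [(hB.mem x).1]
      · simp only [indicator_of_notMem hx]
        rcases le_or_gt (A.N x) u with h | h
        · rw [hB.inside x h, sub_self]
        · rw [hB.outside x (not_lt.1 fun h' => hx ⟨h, h'⟩), sub_self]

end LinSymp

namespace R2n
variable {n : ℕ}

/-- The position index of the `i`-th symplectic plane. -/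
def ix (i : Fin n) : Fin (2 * n) := ⟨2 * i.1, by have := i.isLt; omega⟩

/-- The momentum index of the `i`-th symplectic plane. -/
def iy (i : Fin n) : Fin (2 * n) := ⟨2 * i.1 + 1, by have := i.isLt; omega⟩

/-- The symplectic plane containing a coordinate. -/
def half (j : Fin (2 * n)) : Fin n := ⟨j.1 / 2, by have := j.isLt; omega⟩

/-- The coordinate conjugate to a given one. -/
def conjIdx (j : Fin (2 * n)) : Fin (2 * n) := if j.1 % 2 = 0 then iy (half j) else ix (half j)

theorem half_ix (i : Fin n) : half (ix i) = i := by ext; simp [half, ix]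

theorem half_iy (i : Fin n) : half (iy i) = i := by ext; simp [half, iy]; omega

theorem eq_ix_or_eq_iy (j : Fin (2 * n)) : (∃ i, j = ix i) ∨ ∃ i, j = iy i := by
  rcases Nat.mod_two_eq_zero_or_one j.1 with h | h
  · exact Or.inl ⟨half j, by ext; simp [half, ix]; omega⟩
  · exact Or.inr ⟨half j, by ext; simp [half, iy]; omega⟩

theorem sum_eq {M : Type*} [AddCommMonoid M] (f : Fin (2 * n) → M) :
    ∑ j, f j = ∑ i : Fin n, (f (ix i) + f (iy i)) := by
  let e : Fin n × Fin 2 ≃ Fin (2 * n) := finProdFinEquiv.trans (finCongr (mul_comm n 2))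
  rw [← e.sum_comp, Fintype.sum_prod_type]
  refine Finset.sum_congr rfl fun i _ => ?_
  rw [Fin.sum_univ_two]
  have hx : e (i, 0) = ix i := by ext; simp [e, ix]
  have hy : e (i, 1) = iy i := by ext; simp [e, iy]; omega
  rw [hx, hy]

theorem prod_eq {M : Type*} [CommMonoid M] (f : Fin (2 * n) → M) :
    ∏ j, f j = ∏ i : Fin n, (f (ix i) * f (iy i)) := by
  let e : Fin n × Fin 2 ≃ Fin (2 * n) := finProdFinEquiv.trans (finCongr (mul_comm n 2))
  rw [← e.prod_comp, Fintype.prod_prod_type]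
  refine Finset.prod_congr rfl fun i _ => ?_
  rw [Fin.prod_univ_two]
  have hx : e (i, 0) = ix i := by ext; simp [e, ix]
  have hy : e (i, 1) = iy i := by ext; simp [e, iy]; omega
  rw [hx, hy]

/-- The standard complex structure. -/
def J (n : ℕ) : R2n n →L[ℝ] R2n n :=
  LinearMap.toContinuousLinearMap
    { toFun := fun v => WithLp.toLp 2 fun j => (if j.1 % 2 = 0 then -1 else 1) * v (conjIdx j)
      map_add' := fun v w => by ext j; simp [mul_add]
      map_smul' := fun c v => by ext j; simp }

theorem J_ix (v : R2n n) (i : Fin n) : J n v (ix i) = -v (iy i) := by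
  have h : (ix i).1 % 2 = 0 := by simp [ix]
  simp [J, conjIdx, h, half_ix]

theorem J_iy (v : R2n n) (i : Fin n) : J n v (iy i) = v (ix i) := by
  have h : (iy i).1 % 2 ≠ 0 := by simp [iy]
  simp [J, conjIdx, h, half_iy]

theorem inner_eq (v w : R2n n) :
    inner ℝ v w = ∑ i : Fin n, (v (ix i) * w (ix i) + v (iy i) * w (iy i)) := by
  rw [PiLp.inner_apply, sum_eq]
  simp [mul_comm]

theorem inner_J (v w : R2n n) : inner ℝ (J n v) w = sympForm n v w := by
  rw [inner_eq, sympForm]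
  refine Finset.sum_congr rfl fun i _ => ?_
  rw [J_ix, J_iy, ix, iy]
  ring

/-- The standard linear symplectic structure on `ℝ^{2n}`. -/
def symp (n : ℕ) : LinSymp (R2n n) where
  J := J n
  sq v := by
    ext j
    rcases eq_ix_or_eq_iy j with ⟨i, rfl⟩ | ⟨i, rfl⟩
    · simp [J_ix, J_iy]
    · simp [J_ix, J_iy]
  skew v w := by
    rw [inner_J, real_inner_comm, inner_J, sympForm, sympForm, ← Finset.sum_neg_distrib]
    exact Finset.sum_congr rfl fun i _ => by ring

/-- The orthogonal projection to a symplectic plane. -/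
def proj (i : Fin n) : R2n n →L[ℝ] R2n n :=
  LinearMap.toContinuousLinearMap
    { toFun := fun v => WithLp.toLp 2 fun j => if half j = i then v j else 0
      map_add' := fun v w => by ext j; simp only [PiLp.add_apply]; split_ifs <;> simp
      map_smul' := fun c v => by ext j; simp }

theorem proj_apply (i : Fin n) (v : R2n n) (j : Fin (2 * n)) :
    proj i v j = if half j = i then v j else 0 := rfl

/-- The quadratic form of an ellipsoid. -/
def ell {a : Fin n → ℝ} (ha : ∀ i, 0 < a i) : (symp n).Ell (Fin n) where
  P := proj
  μ i := (a i ^ 2)⁻¹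
  sum x := by ext j; simp [proj_apply]
  comm i v := by
    ext j
    change proj i (J n v) j = J n (proj i v) j
    rcases eq_ix_or_eq_iy j with ⟨k, rfl⟩ | ⟨k, rfl⟩
    · simp only [proj_apply, J_ix, half_ix, half_iy]; split_ifs <;> simp
    · simp only [proj_apply, J_iy, half_ix, half_iy]
  symm i v w := by
    simp only [PiLp.inner_apply, proj_apply]
    exact Finset.sum_congr rfl fun j _ => by split_ifs <;> simp
  mul i j v := by
    ext k
    rw [proj_apply]
    by_cases h : i = j
    · subst h
      simp only [proj_apply, if_true]; split_ifs <;> rfl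
    · simp only [h, if_false, proj_apply, PiLp.zero_apply]
      split_ifs with h1 h2
      · exact absurd (h1.symm.trans h2) h
      · rfl
      · rfl
  pos i := inv_pos.2 (pow_pos (ha i) 2)

variable {a : Fin n → ℝ}

theorem ell_N (ha : ∀ i, 0 < a i) (x : R2n n) : (ell ha).N x = ellQ n a x := by
  rw [LinSymp.Ell.N_eq, ellQ]
  refine Finset.sum_congr rfl fun i _ => ?_
  change (a i ^ 2)⁻¹ * ‖proj i x‖ ^ 2 = _
  have : ‖proj i x‖ ^ 2 = x (ix i) ^ 2 + x (iy i) ^ 2 := by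
    rw [← real_inner_self_eq_norm_sq, inner_eq, Finset.sum_eq_single i]
    · simp [proj_apply, half_ix, half_iy]; ring
    · intro k _ hk; simp [proj_apply, half_ix, half_iy, hk]
    · simp
  rw [this, inv_mul_eq_div]
  rfl

theorem ell_D_single (ha : ∀ i, 0 < a i) (i : Fin n) :
    (ell ha).D (EuclideanSpace.single (ix i) 1) = (a i ^ 2)⁻¹ • EuclideanSpace.single (ix i) (1 : ℝ) := by
  have h : proj i (EuclideanSpace.single (ix i) 1) = EuclideanSpace.single (ix i) (1 : ℝ) := by
    ext j
    rw [proj_apply]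
    by_cases hj : j = ix i
    · simp [hj, half_ix]
    · simp [hj]
  have := (ell ha).D_P i (EuclideanSpace.single (ix i) 1)
  change (ell ha).D (proj i _) = (a i ^ 2)⁻¹ • proj i _ at this
  rwa [h] at this

theorem volume_ball (hn : 0 < n) {r : ℝ} (hr : 0 ≤ r) :
    volume.real (ball (0 : R2n n) r) = (r ^ 2) ^ n * volume.real (ball (0 : R2n n) 1) := by
  have : Nonempty (Fin (2 * n)) := ⟨⟨0, by omega⟩⟩
  have h := Measure.addHaar_ball (volume : Measure (R2n n)) 0 hr
  rw [measureReal_def, h, ENNReal.toReal_mul, ENNReal.toReal_ofReal (by positivity)]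
  simp [pow_mul, measureReal_def]

theorem volume_ellQ_lt (ha : ∀ i, 0 < a i) {c : ℝ} (hc : 0 < c) :
    volume.real {x : R2n n | ellQ n a x < c}
      = c ^ n * (∏ i, a i ^ 2) * volume.real (ball (0 : R2n n) 1) := by
  let d : Fin (2 * n) → ℝ := fun j => (√c * a (half j))⁻¹
  let L : R2n n →ₗ[ℝ] R2n n :=
    { toFun := fun v => WithLp.toLp 2 fun j => d j * v j
      map_add' := fun v w => by ext j; simp [mul_add]
      map_smul' := fun t v => by ext j; simp; ring }
  have hL : ∀ v j, L v j = d j * v j := fun v j => rfl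
  have hdet : LinearMap.det L = (c ^ n * ∏ i, a i ^ 2)⁻¹ := by
    let b := (EuclideanSpace.basisFun (Fin (2 * n)) ℝ).toBasis
    have hM : LinearMap.toMatrix b b L = Matrix.diagonal d := by
      ext j k
      rw [LinearMap.toMatrix_apply]
      by_cases h : j = k
      · subst h; simp [b, hL]
      · simp [b, hL, h]
    rw [← LinearMap.det_toMatrix b, hM, Matrix.det_diagonal, prod_eq]
    simp only [d, half_ix, half_iy]
    have : ∀ i, (√c * a i)⁻¹ * (√c * a i)⁻¹ = (c * a i ^ 2)⁻¹ := fun i => by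
      rw [← mul_inv, mul_mul_mul_comm, mul_self_sqrt hc.le, ← sq]
    simp only [this, Finset.prod_inv_distrib, Finset.prod_mul_distrib]
    simp
  have hP : 0 < ∏ i, a i ^ 2 := Finset.prod_pos fun i _ => pow_pos (ha i) 2
  have hnorm : ∀ x, ‖L x‖ ^ 2 = ellQ n a x / c := fun x => by
    rw [← real_inner_self_eq_norm_sq, inner_eq, ellQ, Finset.sum_div]
    refine Finset.sum_congr rfl fun i _ => ?_
    have h1 := (ha i).ne'
    have h2 : √c ≠ 0 := (sqrt_pos.2 hc).ne'
    simp only [hL, d, half_ix, half_iy]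
    change _ = (x (ix i) ^ 2 + x (iy i) ^ 2) / a i ^ 2 / c
    nth_rw 5 [← sq_sqrt hc.le]
    field_simp
  have hset : {x : R2n n | ellQ n a x < c} = L ⁻¹' ball 0 1 := by
    ext x
    rw [mem_preimage, mem_ball_zero_iff, ← sq_lt_one_iff₀ (norm_nonneg _), hnorm, div_lt_one hc]
    rfl
  rw [hset, measureReal_def, Measure.addHaar_preimage_linearMap _ (by rw [hdet]; positivity), hdet,
    inv_inv, abs_of_pos (by positivity), ENNReal.toReal_mul, ENNReal.toReal_ofReal (by positivity)]
  rfl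

theorem volume_ellQ_Ioo_le (ha : ∀ i, 0 < a i) {u w : ℝ}
    (hu : 0 < u) (huw : u < w) :
    volume.real {x : R2n n | ellQ n a x ∈ Ioo u w}
      ≤ (w ^ n - u ^ n) * (∏ i, a i ^ 2) * volume.real (ball (0 : R2n n) 1) := by
  have hc : Continuous (ellQ n a) := by
    rw [show ellQ n a = (ell ha).N from funext fun x => (ell_N ha x).symm]
    exact (ell ha).continuous_N
  have hw := volume_ellQ_lt ha (hu.trans huw)
  have hu' := volume_ellQ_lt ha hu
  have hpos : 0 < volume.real (ball (0 : R2n n) 1) :=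
    ENNReal.toReal_pos (measure_ball_pos _ _ one_pos).ne' measure_ball_lt_top.ne
  have hP : 0 < ∏ i, a i ^ 2 := Finset.prod_pos fun i _ => pow_pos (ha i) 2
  have hfin : volume {x : R2n n | ellQ n a x < w} ≠ ⊤ := by
    intro h
    rw [measureReal_def, h, ENNReal.toReal_top] at hw
    have : 0 < w ^ n * (∏ i, a i ^ 2) * volume.real (ball (0 : R2n n) 1) := by
      have := hu.trans huw; positivity
    exact this.ne hw
  have hsub : {x : R2n n | ellQ n a x < u} ⊆ {x | ellQ n a x < w} := fun x hx => lt_trans hx huw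
  have hd := measureReal_sdiff (μ := (volume : Measure (R2n n))) hsub
    (hc.measurable measurableSet_Iio) hfin
  calc _ ≤ volume.real ({x : R2n n | ellQ n a x < w} \ {x | ellQ n a x < u}) :=
        measureReal_mono (fun x hx => ⟨hx.2, fun h => absurd hx.1 (not_lt.2 (le_of_lt h))⟩)
          (measure_ne_top_of_subset sdiff_subset hfin)
    _ = _ := by rw [hd, hw, hu']; ring

end R2n

theorem mul_two_mul_sub_le_of_pow_lt {n : ℕ} (hn : 2 ≤ n) {u w X ρ : ℝ} (hu : 0 < u) (huw : u < w)
    (hX1 : 1 < X) (hXn : X ^ n < 2) (hwX : w ≤ X * u) (hρ : 0 < ρ) (h1 : u ^ n * X ≤ ρ ^ n)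
    (h2 : (w ^ n - u ^ n) * X ^ n ≤ ρ ^ n) : X * (2 * w - u) ≤ 2 * ρ := by
  have hX0 : 0 < X := by linarith
  rcases eq_or_lt_of_le hn with rfl | hn3
  · refine (sq_le_sq₀ (mul_nonneg hX0.le (by linarith)) (by linarith)).1 ?_
    rcases le_total (5 * u) (4 * w) with h | h
    · have h3 : (2 * w - u) ^ 2 ≤ 4 * (w ^ 2 - u ^ 2) := by nlinarith
      have := mul_le_mul_of_nonneg_left h3 (sq_nonneg X)
      nlinarith
    · have h3 : (2 * w - u) ^ 2 ≤ (3 / 2 * u) ^ 2 :=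
        pow_le_pow_left₀ (by linarith) (by linarith) 2
      have h4 := mul_le_mul_of_nonneg_left h3 (sq_nonneg X)
      have hX : X ≤ 3 / 2 := by nlinarith
      have h5 : X ^ 2 * (9 / 4) ≤ 4 * X := by nlinarith
      have := mul_le_mul_of_nonneg_left h5 (sq_nonneg u)
      nlinarith
  · have hX3 : X ^ 3 < 2 := (pow_le_pow_right₀ hX1.le hn3).trans_lt hXn
    have hρu : u ≤ ρ := by
      refine le_of_pow_le_pow_left₀ (by omega : n ≠ 0) hρ.le (le_trans ?_ h1)
      exact le_mul_of_one_le_right (pow_pos hu n).le hX1.le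
    have hX : X ≤ 32 / 25 := by
      by_contra h
      push Not at h
      have := pow_lt_pow_left₀ h (by norm_num) (by norm_num : (3 : ℕ) ≠ 0)
      norm_num at this
      linarith
    have h5 : X * (2 * X - 1) ≤ 2 := by nlinarith
    have h6 := mul_le_mul_of_nonneg_right h5 hu.le
    have h7 := mul_le_mul_of_nonneg_left hwX hX0.le
    nlinarith

namespace R2n
variable {n : ℕ} {a : Fin n → ℝ}

theorem ellQ_smul (t : ℝ) (x : R2n n) : ellQ n a (t • x) = t ^ 2 * ellQ n a x := by
  simp only [ellQ, PiLp.smul_apply, smul_eq_mul, Finset.mul_sum]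
  exact Finset.sum_congr rfl fun i _ => by ring

theorem mem_ellipsoid_mul {c : ℝ} (hc : 0 < c) (x : R2n n) :
    x ∈ ellipsoid n (fun i => c * a i) ↔ ellQ n a x < c ^ 2 := by
  have : ellQ n (fun i => c * a i) x = ellQ n a x / c ^ 2 := by
    rw [ellQ, ellQ, Finset.sum_div]
    exact Finset.sum_congr rfl fun i _ => by rw [mul_pow, div_div, mul_comm (c ^ 2)]
  change ellQ n (fun i => c * a i) x < 1 ↔ _
  rw [this, div_lt_one (pow_pos hc 2)]

theorem continuous_ellQ : Continuous (ellQ n a) := by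
  unfold ellQ; fun_prop

theorem ellQ_mem_of_mem_ellShell {ε : ℝ} (h0 : 0 < ε) (h1 : ε < 1) {x : R2n n}
    (hx : x ∈ ellShell n a ε) : ellQ n a x ∈ Ioo ((1 - ε) ^ 2) ((1 + ε) ^ 2) := by
  have he : 0 < 1 - ε := by linarith
  refine ⟨?_, (mem_ellipsoid_mul (by linarith) x).1 hx.1⟩
  by_contra hle
  push Not at hle
  refine hx.2 ?_
  have h2 : Tendsto (fun t : ℝ => t • x) (𝓝[<] 1) (𝓝 x) := by
    have : Tendsto (fun t : ℝ => t • x) (𝓝 1) (𝓝 ((1 : ℝ) • x)) :=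
      (continuous_id.smul continuous_const).tendsto 1
    rw [one_smul] at this
    exact this.mono_left nhdsWithin_le_nhds
  refine mem_closure_of_tendsto h2 ?_
  filter_upwards [Ioo_mem_nhdsLT (zero_lt_one' ℝ)] with t ht
  rw [mem_ellipsoid_mul he, ellQ_smul]
  have h3 : t ^ 2 < 1 := pow_lt_one₀ ht.1.le ht.2 two_ne_zero
  have h4 : 0 < (1 - ε) ^ 2 := pow_pos he 2
  nlinarith [sq_nonneg t]

theorem exists_oshell (hn : 0 < n) {r u w : ℝ} (hr : 0 < r) {U : Set (R2n n)}
    (hU : ∀ x ∈ U, ellQ n a x ∈ Ioo u w) (h : SympEmbNbhd n (sphere (0 : R2n n) r) U) :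
    ∃ (φ : R2n n → R2n n) (u' w' ρ₁ ρ₂ : ℝ), u < u' ∧ u' < w' ∧ w' < w ∧ 0 < ρ₁ ∧ ρ₁ < r ∧
      r < ρ₂ ∧ (symp n).SympOn (oshell (R2n n) ρ₁ ρ₂) φ ∧
      ∀ z ∈ oshell (R2n n) ρ₁ ρ₂, ellQ n a (φ z) ∈ Ioo u' w' := by
  obtain ⟨N, φ, hsub, hNo, hφs, hφi, hφU, hφω⟩ := h
  have : Nonempty (Fin (2 * n)) := ⟨⟨0, by omega⟩⟩
  have hK : IsCompact (sphere (0 : R2n n) r) := isCompact_sphere 0 r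
  have hne : (sphere (0 : R2n n) r).Nonempty := NormedSpace.sphere_nonempty.2 hr.le
  have hc : ContinuousOn (fun z => ellQ n a (φ z)) N :=
    continuous_ellQ.comp_continuousOn hφs.continuousOn
  obtain ⟨p, hp, hpm⟩ := hK.exists_isMinOn hne (hc.mono hsub)
  obtain ⟨q, hq, hqm⟩ := hK.exists_isMaxOn hne (hc.mono hsub)
  obtain ⟨u', hu, hu'⟩ := exists_between (hU _ (hφU (hsub hp))).1
  obtain ⟨w', hw', hw⟩ := exists_between (hU _ (hφU (hsub hq))).2
  have hopen : IsOpen (N ∩ (fun z => ellQ n a (φ z)) ⁻¹' Ioo u' w') :=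
    hc.isOpen_inter_preimage hNo isOpen_Ioo
  obtain ⟨δ, hδ, hδs⟩ := hK.exists_thickening_subset_open hopen fun z hz =>
    ⟨hsub hz, hu'.trans_le (hpm hz), (hqm hz : _ ≤ _).trans_lt hw'⟩
  have hm : 0 < min δ (r / 2) := lt_min hδ (by linarith)
  have hm1 := min_le_left δ (r / 2)
  have hm2 := min_le_right δ (r / 2)
  have hshell : oshell (R2n n) (r - min δ (r / 2)) (r + min δ (r / 2)) ⊆
      N ∩ (fun z => ellQ n a (φ z)) ⁻¹' Ioo u' w' := by
    refine Subset.trans (fun z hz => ?_) hδs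
    have hz0 : 0 < ‖z‖ := lt_trans (by linarith) hz.1
    refine mem_thickening_iff.2 ⟨(r / ‖z‖) • z, ?_, ?_⟩
    · simp [norm_smul, abs_of_pos hr, hz0.ne']
    · have e : z - (r / ‖z‖) • z = ((‖z‖ - r) / ‖z‖) • z := by
        rw [sub_div, sub_smul, div_self hz0.ne', one_smul]
      rw [dist_eq_norm, e, norm_smul, norm_div, norm_norm, div_mul_cancel₀ _ hz0.ne',
        Real.norm_eq_abs, abs_lt]
      constructor <;> linarith [hz.1, hz.2]
  refine ⟨φ, u', w', r - min δ (r / 2), r + min δ (r / 2), hu,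
    hu'.trans_le ((hpm hq : _ ≤ _).trans hw'.le), hw, by linarith, by linarith, by linarith,
    ?_, fun z hz => (hshell hz).2⟩
  refine LinSymp.SympOn.mono (Z := N) ⟨hNo, hφs, hφi, fun p hp v w => ?_⟩
    (isOpen_Ioo.preimage continuous_norm) fun z hz => (hshell hz).1
  change inner ℝ (J n _) _ = inner ℝ (J n _) _
  rw [inner_J, inner_J]
  exact hφω p hp v w

/-- A sphere embedded in an ellipsoidal shell bounds no more volume than the shell stretched to
the largest half axis. -/
theorem radius_pow_le (hn : 2 ≤ n) {R : ℝ} {i₀ i₁ : Fin n} (hfirst : a i₀ = 1) (hlast : a i₁ = R)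
    (ha1 : ∀ i, 1 ≤ a i) (haR : ∀ i, a i ≤ R) (hR1 : 1 < R) (hRn : (R ^ 2) ^ n < 2) {u w : ℝ} (hu : 0 < u)
    (huw : u < w) (hwX : w ≤ R ^ 2 * u) {r : ℝ} (hr : 0 < r) {U : Set (R2n n)}
    (hU : ∀ x ∈ U, ellQ n a x ∈ Ioo u w) (h : SympEmbNbhd n (sphere (0 : R2n n) r) U) :
    (r ^ 2) ^ n ≤ (w ^ n - u ^ n) * (R ^ 2) ^ n := by
  have ha : ∀ i, 0 < a i := fun i => one_pos.trans_le (ha1 i)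
  have hn0 : 0 < n := zero_lt_two.trans_le hn
  by_contra hcon
  push Not at hcon
  obtain ⟨φ, u', w', ρ₁, ρ₂, huu, huw', hww, hρ₁, hρr, hrρ, hφ, hmaps⟩ :=
    exists_oshell hn0 hr hU h
  have hu' : 0 < u' := hu.trans huu
  set X := R ^ 2 with hX
  have hX1 : 1 < X := one_lt_pow₀ hR1 two_ne_zero
  have hX0 : 0 < X := by linarith
  have hXX : X ^ 2 < 2 := (pow_le_pow_right₀ hX1.le hn).trans_lt hRn
  have hX2 : X < 2 := by nlinarith
  have hgap : w' < X * u' := hww.trans (hwX.trans_lt (mul_lt_mul_of_pos_left huu hX0))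
  set P := ∏ i, a i ^ 2 with hP
  have hPX : X ≤ P := by
    rw [hP, ← Finset.mul_prod_erase Finset.univ _ (Finset.mem_univ i₁), hlast]
    refine le_mul_of_one_le_right hX0.le ?_
    rw [← Finset.prod_const_one (s := Finset.univ.erase i₁)]
    exact Finset.prod_le_prod (fun _ _ => zero_le_one) fun i _ => one_le_pow₀ (ha1 i)
  have hPn : P ≤ X ^ n := by
    calc P ≤ ∏ _i : Fin n, X := Finset.prod_le_prod (fun i _ => sq_nonneg _)
          fun i _ => pow_le_pow_left₀ (ha i).le (haR i) 2
      _ = X ^ n := by simp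
  have hr2 : 0 < r ^ 2 := pow_pos hr 2
  have hneg : Tendsto (fun δ : ℝ => r ^ 2 - δ) (𝓝[>] 0) (𝓝 (r ^ 2)) := by
    have : Tendsto (fun δ : ℝ => r ^ 2 - δ) (𝓝 0) (𝓝 (r ^ 2 - 0)) :=
      (continuous_const.sub continuous_id).tendsto 0
    rw [sub_zero] at this
    exact this.mono_left nhdsWithin_le_nhds
  have hpos : Tendsto (fun δ : ℝ => r ^ 2 + δ) (𝓝[>] 0) (𝓝 (r ^ 2)) := by
    have : Tendsto (fun δ : ℝ => r ^ 2 + δ) (𝓝 0) (𝓝 (r ^ 2 + 0)) :=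
      (continuous_const.add continuous_id).tendsto 0
    rw [add_zero] at this
    exact this.mono_left nhdsWithin_le_nhds
  have c1 : ∀ᶠ δ in 𝓝[>] (0 : ℝ), (w ^ n - u ^ n) * X ^ n < (r ^ 2 - δ) ^ n :=
    (hneg.pow n).eventually_const_lt hcon
  have c2 : ∀ᶠ δ in 𝓝[>] (0 : ℝ), ρ₁ ^ 2 < r ^ 2 - δ :=
    hneg.eventually_const_lt (pow_lt_pow_left₀ hρr hρ₁.le two_ne_zero)
  have c3 : ∀ᶠ δ in 𝓝[>] (0 : ℝ), r ^ 2 + δ < ρ₂ ^ 2 :=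
    hpos.eventually_lt_const (pow_lt_pow_left₀ hrρ hr.le two_ne_zero)
  have c4 : ∀ᶠ δ in 𝓝[>] (0 : ℝ), δ < (X * u' - w') / 2 :=
    nhdsWithin_le_nhds (Iio_mem_nhds (by linarith))
  have c5 : ∀ᶠ δ in 𝓝[>] (0 : ℝ),
      (r ^ 2 + δ) ^ n < u ^ n * X ∨ X * (2 * w' - u') < 2 * (r ^ 2 - δ) := by
    rcases lt_or_ge ((r ^ 2) ^ n) (u ^ n * X) with h1 | h1
    · filter_upwards [(hpos.pow n).eventually_lt_const h1] with δ hδ using Or.inl hδ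
    · have h2 := mul_two_mul_sub_le_of_pow_lt hn hu huw hX1 hRn hwX hr2 h1 hcon.le
      have h3 : X * (2 * w' - u') < X * (2 * w - u) :=
        mul_lt_mul_of_pos_left (by linarith) hX0
      filter_upwards [(hneg.const_mul 2).eventually_const_lt (h3.trans_le h2)] with δ hδ
        using Or.inr hδ
  obtain ⟨δ, d1, d2, d3, d4, d5, hδ⟩ :=
    (c1.and (c2.and (c3.and (c4.and (c5.and self_mem_nhdsWithin))))).exists
  have hδ0 : 0 < δ := hδ
  have hs₁ : 0 < r ^ 2 - δ := (pow_pos hρ₁ 2).trans d2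
  have hs₂ : 0 < r ^ 2 + δ := by linarith
  have hdim : 2 < Module.finrank ℝ (R2n n) := by simp; omega
  have hball : 0 < volume.real (ball (0 : R2n n) 1) :=
    ENNReal.toReal_pos (measure_ball_pos _ _ one_pos).ne' measure_ball_lt_top.ne
  have hP0 : 0 < P := hX0.trans_le hPX
  have hvol : ∀ {s : ℝ}, 0 < s → volume.real (ball (0 : R2n n) (√s))
      = s ^ n * volume.real (ball (0 : R2n n) 1) := fun {s} hs => by
    rw [volume_ball hn0 (sqrt_nonneg s), sq_sqrt hs.le]
  rcases hφ.volume_dichotomy (ell ha) hρ₁ d2 (by linarith) (hρ₁.trans (hρr.trans hrρ)) d3 hdim hu'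
    huw' (fun z hz => by rw [ell_N]; exact hmaps z hz) with hv | ⟨hv, H, gH, hB⟩
  · simp only [ell_N] at hv
    have h1 := hv.trans (volume_ellQ_Ioo_le ha hu' huw')
    rw [hvol hs₁] at h1
    have h2 := le_of_mul_le_mul_right h1 hball
    have h3 : w' ^ n ≤ w ^ n := pow_le_pow_left₀ (hu'.trans huw').le hww.le n
    have h4 : u ^ n ≤ u' ^ n := pow_le_pow_left₀ hu.le huu.le n
    have h5 : u' ^ n ≤ w' ^ n := pow_le_pow_left₀ hu'.le huw'.le n
    have h6 : (w' ^ n - u' ^ n) * P ≤ (w ^ n - u ^ n) * X ^ n :=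
      mul_le_mul (by linarith) hPn hP0.le (by linarith)
    linarith
  · have hμ1 : ∀ i, (ell ha).μ i ≤ 1 := fun i => inv_le_one_of_one_le₀ (one_le_pow₀ (ha1 i))
    have hμX : ∀ i, X⁻¹ ≤ (ell ha).μ i := fun i =>
      inv_anti₀ (pow_pos (ha i) 2) (pow_le_pow_left₀ (ha i).le (haR i) 2)
    have h1 : r ^ 2 - δ ≤ w' := hB.le_outer hu' huw' hs₁ hμ1
      (e := EuclideanSpace.single (ix i₀) 1) (by simp) (by
        rw [ell_D_single, hfirst]; simp)
    rcases d5 with d5 | d5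
    · simp only [ell_N] at hv
      have h2 : volume.real {x : R2n n | ellQ n a x < u'} ≤ volume.real {x : R2n n | ellQ n a x ≤ u'} := by
        refine measureReal_mono (fun x (hx : ellQ n a x < u') => (hx.le : ellQ n a x ≤ u')) ?_
        have := (ell ha).isCompact_sublevel u'
        simp only [ell_N] at this
        exact this.measure_lt_top.ne
      rw [volume_ellQ_lt ha hu'] at h2
      have h3 := h2.trans hv
      rw [hvol hs₂] at h3
      have h4 := le_of_mul_le_mul_right h3 hball
      have h5 : u ^ n * X ≤ u' ^ n * P :=
        mul_le_mul (pow_le_pow_left₀ hu.le huu.le n) hPX hX0.le (pow_nonneg hu'.le n)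
      linarith
    · have h2 := hB.inner_le hu' huw' hs₁ hμ1 hX1 hX2 hμX
        (e := EuclideanSpace.single (ix i₁) 1) (by simp) (by
          rw [ell_D_single, hlast]) (by nlinarith) d5
      linarith

end R2n

/-- For `ε ∈ (0, ε₀]` with `ε₀ = (R-1)/(R+1)`, the spherical capacity of the ellipsoidal
shell satisfies `s(U_ε) ≤ ((1+ε)^(2n) - (1-ε)^(2n))^(1/n) · π R²`. -/
theorem spherical_capacity_upper_bound_on_ellipsoidal_shells
    (n : ℕ) (hn : 2 ≤ n) (a : Fin n → ℝ) (R : ℝ)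
    (hmono : Monotone a) (hfirst : a ⟨0, by omega⟩ = 1) (hlast : a ⟨n - 1, by omega⟩ = R)
    (hR1 : 1 < R) (hR2 : R < (2 : ℝ) ^ ((1 : ℝ) / (2 * (n : ℝ))))
    (ε : ℝ) (hε : ε ∈ Ioc (0 : ℝ) ((R - 1) / (R + 1))) :
    sphericalCap n (ellShell n a ε) ≤
      ENNReal.ofReal ((((1 + ε) ^ (2 * n) - (1 - ε) ^ (2 * n)) ^ ((1 : ℝ) / (n : ℝ))) *
        (π * R ^ 2)) := by
  have hn0 : n ≠ 0 := by omega
  have hR0 : 0 < R := by linarith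
  obtain ⟨he0, he1⟩ := hε
  rw [le_div_iff₀ (by linarith)] at he1
  have he : ε < 1 := by nlinarith
  have hu : 0 < 1 - ε := by linarith
  have hRn : (R ^ 2) ^ n < 2 := by
    have h := pow_lt_pow_left₀ hR2 hR0.le (by omega : 2 * n ≠ 0)
    rw [← pow_mul]
    refine h.trans_eq ?_
    rw [← rpow_natCast, ← rpow_mul (by norm_num)]
    push_cast
    rw [one_div, inv_mul_cancel₀ (by positivity), rpow_one]
  have hwX : (1 + ε) ^ 2 ≤ R ^ 2 * (1 - ε) ^ 2 := by
    rw [← mul_pow]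
    exact pow_le_pow_left₀ (by linarith) (by nlinarith) 2
  have hT : 0 ≤ (1 + ε) ^ (2 * n) - (1 - ε) ^ (2 * n) :=
    sub_nonneg.2 (pow_le_pow_left₀ hu.le (by linarith) _)
  refine sSup_le ?_
  rintro _ ⟨r, hr, rfl, hemb⟩
  have key := R2n.radius_pow_le hn hfirst hlast
    (fun i => hfirst ▸ hmono (Fin.mk_le_of_le_val (Nat.zero_le _)))
    (fun i => hlast ▸ hmono (Fin.le_iff_val_le_val.2 (Nat.le_sub_one_of_lt i.2))) hR1 hRn (pow_pos hu 2)
    (pow_lt_pow_left₀ (by linarith : 1 - ε < 1 + ε) hu.le two_ne_zero) hwX hr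
    (fun x hx => R2n.ellQ_mem_of_mem_ellShell he0 he hx) hemb
  rw [← pow_mul (1 + ε), ← pow_mul (1 - ε)] at key
  refine ENNReal.ofReal_le_ofReal ?_
  have h2 : r ^ 2 ≤ ((1 + ε) ^ (2 * n) - (1 - ε) ^ (2 * n)) ^ ((1 : ℝ) / n) * R ^ 2 := by
    refine le_of_pow_le_pow_left₀ hn0 (by positivity) (key.trans_eq ?_)
    rw [mul_pow, ← rpow_natCast (_ ^ ((1 : ℝ) / n)), ← rpow_mul hT, one_div,
      inv_mul_cancel₀ (by positivity), rpow_one]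
  nlinarith [mul_le_mul_of_nonneg_left h2 pi_pos.le]
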